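/- Almost conservation law in ℝ². Let s ∈ (4/7, 1) and let ε > 0 be sufficiently small. For every R > 0 there exist δ > 0 (depending only on R) and C = C(s, ε, m₁) such that: for every N ≥ 1, every Schwartz datum φ₀ on ℝ² with ‖φ₀‖_{L²(ℝ²)} ≤ R and E(I_N φ₀) ≤ 1, and every solution φ of the cubic defocussing NLS on ℝ² × [0, δ] with data φ₀, one has |E(I_N φ)(t) − E(I_N φ₀)| ≤ C N^{−3/2 + ε} for all t ∈ [0, δ]. -/

import Mathlib

open MeasureTheory Complex Set
open scoped FourierTransform BigOperators RealInnerProductSpace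

noncomputable section

abbrev Rn (n : ℕ) := EuclideanSpace ℝ (Fin n)

/-- Japanese bracket of a vector. -/
def jap {n : ℕ} (ξ : Rn n) : ℝ := Real.sqrt (1 + ‖ξ‖ ^ 2)

/-- Japanese bracket of a real number. -/
def japR (x : ℝ) : ℝ := Real.sqrt (1 + x ^ 2)

/-- Inhomogeneous Sobolev norm ‖⟨ξ⟩^s f̂‖_{L²}. -/
def sobNorm (n : ℕ) (s : ℝ) (f : Rn n → ℂ) : ℝ :=
  (∫ ξ : Rn n, jap ξ ^ (2 * s) * ‖𝓕 f ξ‖ ^ 2) ^ (1/2 : ℝ)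

/-- Homogeneous Sobolev norm ‖|ξ|^s f̂‖_{L²}. -/
def sobNormHom (n : ℕ) (s : ℝ) (f : Rn n → ℂ) : ℝ :=
  (∫ ξ : Rn n, ‖ξ‖ ^ (2 * s) * ‖𝓕 f ξ‖ ^ 2) ^ (1/2 : ℝ)

/-- L^p norm on ℝⁿ. -/
def lpNorm (n : ℕ) (p : ℝ) (f : Rn n → ℂ) : ℝ :=
  (∫ x : Rn n, ‖f x‖ ^ p) ^ (1/p)

/-- Laplacian: sum of second partial derivatives. -/
def laplacian {n : ℕ} (f : Rn n → ℂ) (x : Rn n) : ℂ :=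
  ∑ i : Fin n, fderiv ℝ (fun y => fderiv ℝ f y (EuclideanSpace.single i 1)) x
    (EuclideanSpace.single i 1)

/-- Complex gradient as a vector in Euclidean space. -/
def gradC {n : ℕ} (f : Rn n → ℂ) (x : Rn n) : EuclideanSpace ℂ (Fin n) :=
  (WithLp.equiv 2 (Fin n → ℂ)).symm fun i => fderiv ℝ f x (EuclideanSpace.single i 1)

/-- φ is a solution of the cubic defocussing NLS on ℝⁿ × [0,T] with data φ₀:
smooth, Schwartz in x uniformly for t ∈ [0,T] (with all derivatives),
satisfying i∂ₜφ + Δφ = |φ|²φ and φ(·,0) = φ₀. -/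
def IsNLSSolution (n : ℕ) (T : ℝ) (φ : Rn n → ℝ → ℂ) (φ₀ : Rn n → ℂ) : Prop :=
  ContDiff ℝ (⊤ : ℕ∞) (fun p : Rn n × ℝ => φ p.1 p.2) ∧
  (∀ k l : ℕ, ∃ C : ℝ, ∀ t ∈ Icc (0:ℝ) T, ∀ x : Rn n,
      ‖x‖ ^ k * ‖iteratedFDeriv ℝ l (fun y => φ y t) x‖ ≤ C) ∧
  (∀ x : Rn n, ∀ t ∈ Icc (0:ℝ) T,
      Complex.I * deriv (fun t' => φ x t') t + laplacian (fun y => φ y t) x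
        = (‖φ x t‖ : ℂ) ^ 2 * φ x t) ∧
  (∀ x : Rn n, φ x 0 = φ₀ x)

/-- The energy E(f) = ∫ (1/2)|∇f|² + (1/4)|f|⁴. -/
def energy {n : ℕ} (f : Rn n → ℂ) : ℝ :=
  ∫ x : Rn n, ((1/2 : ℝ) * ∑ i : Fin n, ‖fderiv ℝ f x (EuclideanSpace.single i 1)‖ ^ 2
    + (1/4 : ℝ) * ‖f x‖ ^ 4)

/-- m₁ is a smooth, radially symmetric, nonincreasing multiplier with
m₁ = 1 on the unit ball, m₁(ξ) = |ξ|^{-(1-s)} for |ξ| ≥ 2, 0 < m₁ ≤ 1. -/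
def IsAdmissibleMultiplier (n : ℕ) (s : ℝ) (m₁ : Rn n → ℝ) : Prop :=
  ContDiff ℝ (⊤ : ℕ∞) m₁ ∧
  (∀ ξ : Rn n, 0 < m₁ ξ ∧ m₁ ξ ≤ 1) ∧
  (∀ ξ η : Rn n, ‖ξ‖ = ‖η‖ → m₁ ξ = m₁ η) ∧
  (∀ ξ η : Rn n, ‖ξ‖ ≤ ‖η‖ → m₁ η ≤ m₁ ξ) ∧
  (∀ ξ : Rn n, ‖ξ‖ ≤ 1 → m₁ ξ = 1) ∧
  (∀ ξ : Rn n, 2 ≤ ‖ξ‖ → m₁ ξ = ‖ξ‖ ^ (-(1 - s)))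

/-- The rescaled multiplier m_N(ξ) = m₁(ξ/N). -/
def mN {n : ℕ} (m₁ : Rn n → ℝ) (N : ℝ) (ξ : Rn n) : ℝ := m₁ (N⁻¹ • ξ)

/-- The smoothing operator I_N with Fourier multiplier m_N. -/
def Iop {n : ℕ} (m₁ : Rn n → ℝ) (N : ℝ) (f : Rn n → ℂ) : Rn n → ℂ :=
  fun x => 𝓕⁻ (fun ξ => (mN m₁ N ξ : ℂ) * 𝓕 f ξ) x

/-- The spatial multiplier ⟨∇⟩^s. -/
def japMul (n : ℕ) (s : ℝ) (f : Rn n → ℂ) : Rn n → ℂ :=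
  fun x => 𝓕⁻ (fun ξ => ((jap ξ ^ s : ℝ) : ℂ) * 𝓕 f ξ) x

/-- Sharp Littlewood–Paley projection onto {M ≤ ⟨ξ⟩ ≤ 2M}. -/
def LP (n : ℕ) (M : ℝ) (f : Rn n → ℂ) : Rn n → ℂ :=
  fun x => 𝓕⁻ (fun ξ => if M ≤ jap ξ ∧ jap ξ ≤ 2 * M then 𝓕 f ξ else 0) x

/-- Space-time Fourier transform ψ̃(ξ,τ). -/
def stFourier (n : ℕ) {E : Type*} [NormedAddCommGroup E] [NormedSpace ℂ E]
    (ψ : Rn n → ℝ → E) (ξ : Rn n) (τ : ℝ) : E :=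
  ∫ x : Rn n, ∫ t : ℝ,
    Complex.exp (Complex.I * ((-2 * Real.pi * (⟪x, ξ⟫ + t * τ) : ℝ) : ℂ)) • ψ x t

/-- The X_{s,b} norm ‖⟨ξ⟩^s ⟨τ-|ξ|²⟩^b ψ̃‖_{L²}. -/
def XNorm (n : ℕ) {E : Type*} [NormedAddCommGroup E] [NormedSpace ℂ E]
    (s b : ℝ) (ψ : Rn n → ℝ → E) : ℝ :=
  (∫ ξ : Rn n, ∫ τ : ℝ,
    jap ξ ^ (2 * s) * japR (τ - ‖ξ‖ ^ 2) ^ (2 * b) * ‖stFourier n ψ ξ τ‖ ^ 2) ^ (1/2 : ℝ)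

/-- The restricted norm X^δ_{s,b}: infimum over Schwartz extensions off ℝⁿ × [0,δ]. -/
def XRNorm (n : ℕ) {E : Type*} [NormedAddCommGroup E] [NormedSpace ℂ E]
    (s b δ : ℝ) (f : Rn n → ℝ → E) : ℝ :=
  sInf { r : ℝ | ∃ ψ : SchwartzMap (Rn n × ℝ) E,
    (∀ x : Rn n, ∀ t ∈ Icc (0:ℝ) δ, ψ (x, t) = f x t) ∧
    r = XNorm n s b (fun x t => ψ (x, t)) }

/-- Space-time L^p norm on ℝⁿ × ℝ. -/
def lpNormST (n : ℕ) {E : Type*} [NormedAddCommGroup E] (p : ℝ) (F : Rn n → ℝ → E) : ℝ :=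
  (∫ t : ℝ, ∫ x : Rn n, ‖F x t‖ ^ p) ^ (1/p)

/-- Space-time L^p norm on ℝⁿ × [0,δ]. -/
def lpNormSTt (n : ℕ) {E : Type*} [NormedAddCommGroup E] (p δ : ℝ) (F : Rn n → ℝ → E) : ℝ :=
  (∫ t in Icc (0:ℝ) δ, ∫ x : Rn n, ‖F x t‖ ^ p) ^ (1/p)

namespace AlmostConservation

open scoped ENNReal NNReal

section

/-! ### Power kernels in one variable -/

lemma ennreal_rpow_anti {x y : ℝ≥0∞} {p : ℝ} (h : x ≤ y) (hp : p ≤ 0) : y ^ p ≤ x ^ p := by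
  have := ENNReal.rpow_le_rpow h (neg_nonneg.2 hp)
  rw [ENNReal.rpow_neg, ENNReal.rpow_neg] at this
  exact ENNReal.inv_le_inv.1 this

lemma enorm_mul_rpow {c : ℝ} (hc : c ≠ 0) (x p : ℝ) :
    ‖c * x‖ₑ ^ p = ‖c‖ₑ ^ p * ‖x‖ₑ ^ p := by
  rw [enorm_mul]
  by_cases hx : x = 0
  · rcases lt_trichotomy p 0 with hp | hp | hp
    · simp [hx, ENNReal.zero_rpow_of_neg hp, ENNReal.mul_top, hc]
    · simp [hp]
    · simp [hx, ENNReal.zero_rpow_of_pos hp]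
  · exact ENNReal.mul_rpow_of_ne_zero (by simpa using hc) (by simpa using hx) _

lemma measurable_enorm_rpow (p : ℝ) : Measurable fun x : ℝ => ‖x‖ₑ ^ p :=
  measurable_enorm.pow_const _

lemma lintegral_Ioc_enorm_rpow {θ B : ℝ} (hθ : 0 < θ) (hB : 0 ≤ B) :
    ∫⁻ x in Ioc 0 B, ‖x‖ₑ ^ (θ - 1) = ENNReal.ofReal (B ^ θ / θ) := by
  have h1 : ∫⁻ x in Ioc 0 B, ‖x‖ₑ ^ (θ - 1) = ∫⁻ x in Ioc 0 B, ENNReal.ofReal (x ^ (θ - 1)) := by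
    refine setLIntegral_congr_fun measurableSet_Ioc fun x hx => ?_
    show ‖x‖ₑ ^ (θ - 1) = _
    rw [Real.enorm_of_nonneg hx.1.le, ENNReal.ofReal_rpow_of_pos hx.1]
  have hi : IntervalIntegrable (fun x : ℝ => x ^ (θ - 1)) volume 0 B :=
    intervalIntegral.intervalIntegrable_rpow' (by linarith)
  rw [h1, ← ofReal_integral_eq_lintegral_ofReal
    ((intervalIntegrable_iff_integrableOn_Ioc_of_le hB).1 hi)
    ((ae_restrict_iff' measurableSet_Ioc).2 (.of_forall fun x hx => Real.rpow_nonneg hx.1.le _)),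
    ← intervalIntegral.integral_of_le hB, integral_rpow (Or.inl (by linarith))]
  rw [sub_add_cancel, Real.zero_rpow hθ.ne', sub_zero]

lemma lintegral_Icc_enorm_rpow {θ B : ℝ} (hθ : 0 < θ) (hB : 0 ≤ B) :
    ∫⁻ x in Icc (-B) B, ‖x‖ₑ ^ (θ - 1) ≤ ENNReal.ofReal (2 / θ * B ^ θ) := by
  have hneg : ∫⁻ x in Ico (-B) 0, ‖x‖ₑ ^ (θ - 1) = ∫⁻ x in Ioc 0 B, ‖x‖ₑ ^ (θ - 1) := by
    rw [← lintegral_indicator measurableSet_Ico, ← lintegral_indicator measurableSet_Ioc,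
      ← lintegral_neg_eq_self]
    congr 1; ext x
    simp only [indicator, mem_Ico, mem_Ioc, enorm_neg]
    refine if_congr ⟨fun h => ⟨?_, ?_⟩, fun h => ⟨?_, ?_⟩⟩ rfl rfl <;> linarith [h.1, h.2]
  have hsub : Icc (-B) B ⊆ (Ico (-B) 0 ∪ Ioc 0 B) ∪ {0} := by
    intro x hx
    rcases lt_trichotomy x 0 with h | h | h
    · exact Or.inl (Or.inl ⟨hx.1, h⟩)
    · exact Or.inr h
    · exact Or.inl (Or.inr ⟨h, hx.2⟩)
  calc _ ≤ ∫⁻ x in (Ico (-B) 0 ∪ Ioc 0 B) ∪ {0}, ‖x‖ₑ ^ (θ - 1) := lintegral_mono_set hsub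
    _ ≤ (∫⁻ x in Ico (-B) 0, ‖x‖ₑ ^ (θ - 1)) + (∫⁻ x in Ioc 0 B, ‖x‖ₑ ^ (θ - 1))
        + ∫⁻ x in ({0} : Set ℝ), ‖x‖ₑ ^ (θ - 1) :=
      (lintegral_union_le _ _ _).trans (add_le_add (lintegral_union_le _ _ _) le_rfl)
    _ = ENNReal.ofReal (2 / θ * B ^ θ) := by
      rw [hneg, lintegral_Ioc_enorm_rpow hθ hB, setLIntegral_measure_zero _ _ (by simp), add_zero,
        ← ENNReal.ofReal_add (by positivity) (by positivity)]
      congr 1; ring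

lemma lintegral_translate_enorm_rpow {θ B : ℝ} (hθ : 0 < θ) (hθ1 : θ < 1) (hB : 0 < B) (c : ℝ) :
    ∫⁻ x in Icc (-B) B, ‖x + c‖ₑ ^ (θ - 1) ≤ ENNReal.ofReal (4 / θ * B ^ θ) := by
  have hpt : ∀ x : ℝ, (Icc (-B) B).indicator (fun x => ‖x + c‖ₑ ^ (θ - 1)) x ≤
      (Icc (-B) B).indicator (fun x => ‖x‖ₑ ^ (θ - 1)) (x + c) +
      (Icc (-B) B).indicator (fun _ => ENNReal.ofReal (B ^ (θ - 1))) x := by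
    intro x
    by_cases hx : x ∈ Icc (-B) B
    · by_cases hy : x + c ∈ Icc (-B) B
      · simp only [indicator, if_pos hx, if_pos hy]; exact le_self_add
      · simp only [indicator, if_pos hx, if_neg hy, zero_add]
        rw [← ENNReal.ofReal_rpow_of_pos hB]
        refine ennreal_rpow_anti ?_ (by linarith)
        rw [Real.enorm_eq_ofReal_abs]
        refine ENNReal.ofReal_le_ofReal ?_
        by_contra h
        exact hy (abs_le.1 (not_le.1 h).le)
    · simp [indicator, hx]
  rw [← lintegral_indicator measurableSet_Icc]
  refine (lintegral_mono hpt).trans ?_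
  rw [lintegral_add_right _ (measurable_const.indicator measurableSet_Icc),
    lintegral_add_right_eq_self (fun x => (Icc (-B) B).indicator (fun x => ‖x‖ₑ ^ (θ - 1)) x) c,
    lintegral_indicator measurableSet_Icc, lintegral_indicator measurableSet_Icc,
    setLIntegral_const, Real.volume_Icc, ← ENNReal.ofReal_mul (by positivity)]
  refine (add_le_add_left (lintegral_Icc_enorm_rpow hθ hB.le) _).trans ?_
  have h1 : B ^ (θ - 1) * (B - -B) = 2 * B ^ θ := by
    rw [Real.rpow_sub_one hB.ne']; field_simp; ring
  rw [h1, ← ENNReal.ofReal_add (by positivity) (by positivity)]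
  refine ENNReal.ofReal_le_ofReal ?_
  have h2 : 2 ≤ 2 / θ := by rw [le_div_iff₀ hθ]; linarith
  have h3 : 0 ≤ B ^ θ := by positivity
  calc _ ≤ 2 / θ * B ^ θ + 2 / θ * B ^ θ := by gcongr
    _ = _ := by ring

lemma lintegral_affine_enorm_rpow {θ B : ℝ} (hθ : 0 < θ) (hθ1 : θ < 1) (hB : 0 < B) {β : ℝ}
    (hβ : β ≠ 0) (c : ℝ) :
    ∫⁻ x in Icc (-B) B, ‖β * x + c‖ₑ ^ (θ - 1) ≤
      ‖β‖ₑ ^ (θ - 1) * ENNReal.ofReal (4 / θ * B ^ θ) := by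
  have : ∀ x : ℝ, ‖β * x + c‖ₑ ^ (θ - 1) = ‖β‖ₑ ^ (θ - 1) * ‖x + c / β‖ₑ ^ (θ - 1) := fun x => by
    rw [← enorm_mul_rpow hβ]; congr 2; field_simp
  have hm : Measurable fun x : ℝ => ‖x + c / β‖ₑ ^ (θ - 1) :=
    (measurable_enorm_rpow _).comp (measurable_id.add_const _)
  simp_rw [this]
  rw [lintegral_const_mul _ hm]
  gcongr
  exact lintegral_translate_enorm_rpow hθ hθ1 hB _

lemma exists_lintegral_one_add_abs_rpow {κ : ℝ} (hκ : 0 < κ) :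
    ∃ C : ℝ≥0, ∀ c : ℝ, ∫⁻ y : ℝ, ENNReal.ofReal ((1 + |y - c|) ^ (-(1 + κ))) ≤ C := by
  have hi : Integrable (fun x : ℝ => (1 + ‖x‖) ^ (-(1 + κ))) := by
    refine integrable_one_add_norm ?_
    simp [hκ]
  refine ⟨(∫⁻ y : ℝ, ENNReal.ofReal ((1 + |y|) ^ (-(1 + κ)))).toNNReal, fun c => ?_⟩
  rw [lintegral_sub_right_eq_self (fun y => ENNReal.ofReal ((1 + |y|) ^ (-(1 + κ)))) c,
    ENNReal.coe_toNNReal]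
  exact hi.lintegral_lt_top.ne

lemma exists_lintegral_weight_enorm_rpow {θ κ : ℝ} (hθ : 0 < θ) (hθκ : θ < κ) (hκ : κ < 1) :
    ∃ C : ℝ≥0, ∀ c : ℝ,
      ∫⁻ x : ℝ, ENNReal.ofReal ((1 + |x|) ^ (-κ)) * ‖x - c‖ₑ ^ (θ - 1) ≤ C := by
  obtain ⟨C, hC⟩ := exists_lintegral_one_add_abs_rpow (κ := κ - θ) (by linarith)
  refine ⟨(2 / θ).toNNReal + 2 * (C + C), fun c => ?_⟩
  have hpt : ∀ x : ℝ, ENNReal.ofReal ((1 + |x|) ^ (-κ)) * ‖x - c‖ₑ ^ (θ - 1) ≤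
      (Icc (-1) 1).indicator (fun x : ℝ => ‖x‖ₑ ^ (θ - 1)) (x - c) +
      2 * (ENNReal.ofReal ((1 + |x - 0|) ^ (-(1 + (κ - θ)))) +
        ENNReal.ofReal ((1 + |x - c|) ^ (-(1 + (κ - θ))))) := by
    intro x
    have hx1 : (1:ℝ) ≤ 1 + |x| := by linarith [abs_nonneg x]
    by_cases hy : x - c ∈ Icc (-1 : ℝ) 1
    · refine le_trans ?_ le_self_add
      simp only [indicator, if_pos hy]
      refine mul_le_of_le_one_left (by simp) ?_
      rw [ENNReal.ofReal_le_one]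
      exact Real.rpow_le_one_of_one_le_of_nonpos hx1 (by linarith)
    · refine le_trans ?_ le_add_self
      have hy' : 1 < |x - c| := by
        by_contra h
        exact hy (abs_le.1 (not_lt.1 h))
      rw [Real.enorm_eq_ofReal_abs, ENNReal.ofReal_rpow_of_pos (by linarith),
        ← ENNReal.ofReal_mul (by positivity), ← ENNReal.ofReal_add (by positivity) (by positivity),
        ← ENNReal.ofReal_ofNat, ← ENNReal.ofReal_mul (by norm_num)]
      refine ENNReal.ofReal_le_ofReal ?_
      rw [sub_zero]
      set u := 1 + |x|
      set w := 1 + |x - c|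
      have hw : 0 < w := by positivity
      have hu : 0 < u := by positivity
      have h1 : |x - c| ^ (θ - 1) ≤ 2 * w ^ (θ - 1) := by
        have : w / 2 ≤ |x - c| := by simp only [w]; linarith
        calc |x - c| ^ (θ - 1) ≤ (w / 2) ^ (θ - 1) :=
              Real.rpow_le_rpow_of_nonpos (by positivity) this (by linarith)
          _ = w ^ (θ - 1) * 2 ^ (1 - θ) := by
              rw [Real.div_rpow hw.le (by norm_num), div_eq_mul_inv, ← Real.rpow_neg (by norm_num)]
              congr 2; ring
          _ ≤ w ^ (θ - 1) * 2 := by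
              gcongr
              calc (2:ℝ) ^ (1 - θ) ≤ 2 ^ (1:ℝ) :=
                    Real.rpow_le_rpow_of_exponent_le (by norm_num) (by linarith)
                _ = 2 := by simp
          _ = _ := by ring
      have h2 : u ^ (-κ) * w ^ (θ - 1) ≤ u ^ (-(1 + (κ - θ))) + w ^ (-(1 + (κ - θ))) := by
        rcases le_total u w with h | h
        · refine le_trans ?_ (le_add_of_nonneg_right (by positivity))
          calc u ^ (-κ) * w ^ (θ - 1) ≤ u ^ (-κ) * u ^ (θ - 1) := by
                have := Real.rpow_le_rpow_of_nonpos hu h (by linarith : θ - 1 ≤ 0)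
                exact mul_le_mul_of_nonneg_left this (by positivity)
            _ = _ := by rw [← Real.rpow_add hu]; congr 1; ring
        · refine le_trans ?_ (le_add_of_nonneg_left (by positivity))
          calc u ^ (-κ) * w ^ (θ - 1) ≤ w ^ (-κ) * w ^ (θ - 1) := by
                have := Real.rpow_le_rpow_of_nonpos hw h (by linarith : -κ ≤ 0)
                exact mul_le_mul_of_nonneg_right this (by positivity)
            _ = _ := by rw [← Real.rpow_add hw]; congr 1; ring
      calc u ^ (-κ) * |x - c| ^ (θ - 1) ≤ u ^ (-κ) * (2 * w ^ (θ - 1)) := by gcongr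
        _ = 2 * (u ^ (-κ) * w ^ (θ - 1)) := by ring
        _ ≤ _ := by gcongr
  refine (lintegral_mono hpt).trans ?_
  have hm : ∀ c : ℝ, Measurable fun x : ℝ =>
      ENNReal.ofReal ((1 + |x - c|) ^ (-(1 + (κ - θ)))) := fun c => by fun_prop
  have hsum : Measurable fun x : ℝ => 2 * (ENNReal.ofReal ((1 + |x - 0|) ^ (-(1 + (κ - θ)))) +
        ENNReal.ofReal ((1 + |x - c|) ^ (-(1 + (κ - θ))))) := ((hm 0).add (hm c)).const_mul _
  rw [lintegral_add_right _ hsum,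
    lintegral_const_mul 2 (f := fun x : ℝ => ENNReal.ofReal ((1 + |x - 0|) ^ (-(1 + (κ - θ)))) +
        ENNReal.ofReal ((1 + |x - c|) ^ (-(1 + (κ - θ))))) ((hm 0).add (hm c)),
    lintegral_add_left (hm 0),
    lintegral_sub_right_eq_self (fun x => (Icc (-1 : ℝ) 1).indicator (fun x => ‖x‖ₑ ^ (θ - 1)) x) c,
    lintegral_indicator measurableSet_Icc]
  push_cast
  refine add_le_add ?_ (mul_le_mul_right (add_le_add (hC 0) (hC c)) _)
  refine (lintegral_Icc_enorm_rpow hθ zero_le_one).trans ?_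
  rw [Real.one_rpow, mul_one]; rfl

end

section

/-! ### Coordinates in the plane -/

lemma lintegral_plane (f : Rn 2 → ℝ≥0∞) (hf : Measurable f) :
    ∫⁻ a, f a = ∫⁻ y : ℝ, ∫⁻ x : ℝ, f !₂[x, y] := by
  have h1 := (EuclideanSpace.volume_preserving_symm_measurableEquiv_toLp (Fin 2)).symm
  have h2 := (volume_preserving_finTwoArrow ℝ).symm
  have h := h1.comp h2
  rw [← show (∫⁻ z, (f ∘ _) z) = _ from h.lintegral_comp hf, Measure.volume_eq_prod,
    lintegral_prod_symm _ (hf.comp h.measurable).aemeasurable]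
  rfl

lemma lintegral_plane' (f : Rn 2 → ℝ≥0∞) (hf : Measurable f) :
    ∫⁻ a, f a = ∫⁻ y : ℝ, ∫⁻ x : ℝ, f !₂[y, x] := by
  have h1 := (EuclideanSpace.volume_preserving_symm_measurableEquiv_toLp (Fin 2)).symm
  have h2 := (volume_preserving_finTwoArrow ℝ).symm
  have h := h1.comp h2
  rw [← show (∫⁻ z, (f ∘ _) z) = _ from h.lintegral_comp hf, Measure.volume_eq_prod,
    lintegral_prod _ (hf.comp h.measurable).aemeasurable]
  rfl

/-- The point of the plane whose `i`-th coordinate is `x` and whose other coordinate is `y`. -/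
def planePt (i : Fin 2) (x y : ℝ) : Rn 2 := if i = 0 then !₂[x, y] else !₂[y, x]

lemma lintegral_planePt (i : Fin 2) (f : Rn 2 → ℝ≥0∞) (hf : Measurable f) :
    ∫⁻ a, f a = ∫⁻ y : ℝ, ∫⁻ x : ℝ, f (planePt i x y) := by
  fin_cases i
  · simpa [planePt] using lintegral_plane f hf
  · simpa [planePt] using lintegral_plane' f hf

lemma planePt_self (i : Fin 2) (x y : ℝ) : planePt i x y i = x := by
  fin_cases i <;> simp [planePt]

lemma planePt_other (i : Fin 2) (x y : ℝ) : planePt i x y (i + 1) = y := by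
  fin_cases i <;> simp [planePt]

lemma inner_planePt (i : Fin 2) (b : Rn 2) (x y : ℝ) :
    ⟪b, planePt i x y⟫ = b i * x + b (i + 1) * y := by
  fin_cases i <;> simp [planePt, PiLp.inner_apply, Fin.sum_univ_two] <;> ring

lemma abs_coord_le (b : Rn 2) (i : Fin 2) : |b i| ≤ ‖b‖ := by
  simpa using PiLp.norm_apply_le b i

lemma exists_coord (b : Rn 2) : ∃ i, ‖b‖ ≤ 2 * |b i| := by
  by_contra! h
  have h0 := h 0
  have h1 := h 1
  have h2 : ‖b‖ ^ 2 = |b 0| ^ 2 + |b 1| ^ 2 := by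
    rw [EuclideanSpace.norm_sq_eq]; simp
  nlinarith [abs_nonneg (b 0), abs_nonneg (b 1), norm_nonneg b]

/-! ### The Japanese bracket -/

lemma jap_sq (ξ : Rn 2) : jap ξ ^ 2 = 1 + ‖ξ‖ ^ 2 := Real.sq_sqrt (by positivity)

lemma one_le_jap (ξ : Rn 2) : 1 ≤ jap ξ := by
  rw [jap, Real.one_le_sqrt]; nlinarith [sq_nonneg ‖ξ‖]

lemma jap_pos (ξ : Rn 2) : 0 < jap ξ := zero_lt_one.trans_le (one_le_jap ξ)

lemma norm_le_jap (ξ : Rn 2) : ‖ξ‖ ≤ jap ξ := Real.le_sqrt_of_sq_le (by linarith)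

lemma jap_le (ξ : Rn 2) : jap ξ ≤ 1 + ‖ξ‖ := by
  rw [jap, Real.sqrt_le_left (by positivity)]; nlinarith [norm_nonneg ξ]

lemma one_add_norm_le (ξ : Rn 2) : 1 + ‖ξ‖ ≤ 2 * jap ξ := by
  linarith [one_le_jap ξ, norm_le_jap ξ]

lemma continuous_jap : Continuous (jap : Rn 2 → ℝ) := by unfold jap; fun_prop

lemma jap_mono {ξ η : Rn 2} (h : ‖ξ‖ ≤ ‖η‖) : jap ξ ≤ jap η := by
  unfold jap; gcongr

/-! ### Kernel bounds in the plane -/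

lemma two_mul_ofReal (x : ℝ) : (2 : ℝ≥0∞) * ENNReal.ofReal x = ENNReal.ofReal (2 * x) := by
  rw [ENNReal.ofReal_mul (by norm_num), ENNReal.ofReal_ofNat]

lemma enorm_coord_rpow_le {b : Rn 2} {i : Fin 2} (h : ‖b‖ ≤ 2 * |b i|) {θ : ℝ} (hθ : 0 < θ)
    (hθ1 : θ < 1) : ‖b i‖ₑ ^ (θ - 1) ≤ 2 * ‖b‖ₑ ^ (θ - 1) := by
  have h1 : ‖b‖ₑ ≤ 2 * ‖b i‖ₑ := by
    rw [Real.enorm_eq_ofReal_abs, ← ofReal_norm, two_mul_ofReal]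
    exact ENNReal.ofReal_le_ofReal h
  calc ‖b i‖ₑ ^ (θ - 1) = 2 ^ (1 - θ) * (2 ^ (θ - 1) * ‖b i‖ₑ ^ (θ - 1)) := by
        rw [← mul_assoc, ← ENNReal.rpow_add _ _ (by norm_num) (by norm_num)]; simp
    _ ≤ 2 ^ (1 : ℝ) * (2 ^ (θ - 1) * ‖b i‖ₑ ^ (θ - 1)) := by
        gcongr
        · norm_num
        · linarith
    _ = 2 * (2 * ‖b i‖ₑ) ^ (θ - 1) := by
        rw [ENNReal.rpow_one]
        congr 1
        by_cases hb : b i = 0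
        · simp [hb, ENNReal.zero_rpow_of_neg (by linarith : θ - 1 < 0), ENNReal.mul_top]
        · rw [ENNReal.mul_rpow_of_ne_zero (by norm_num) (by simpa using hb)]
    _ ≤ _ := by
        exact mul_le_mul' le_rfl (ennreal_rpow_anti h1 (by linarith))

lemma jap_inv_le (y : Rn 2) (i : Fin 2) {θ : ℝ} (hθ : 0 < θ) (hθ1 : θ < 1) :
    ENNReal.ofReal ((jap y)⁻¹) ≤ ‖y i‖ₑ ^ (θ - 1) := by
  have h1 : (jap y)⁻¹ ≤ jap y ^ (θ - 1) := by
    rw [← Real.rpow_neg_one]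
    exact Real.rpow_le_rpow_of_exponent_le (one_le_jap y) (by linarith)
  refine (ENNReal.ofReal_le_ofReal h1).trans ?_
  rw [← ENNReal.ofReal_rpow_of_pos (jap_pos y)]
  refine ennreal_rpow_anti ?_ (by linarith)
  rw [Real.enorm_eq_ofReal_abs]
  exact ENNReal.ofReal_le_ofReal ((abs_coord_le y i).trans (norm_le_jap y))

lemma measurable_kernel (b : Rn 2) (c p : ℝ) : Measurable fun a : Rn 2 => ‖⟪b, a⟫ + c‖ₑ ^ p :=
  (measurable_enorm_rpow p).comp (by fun_prop : Continuous fun a : Rn 2 => ⟪b, a⟫ + c).measurable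

/-- Planar integral over a ball of a weight depending on one coordinate against a kernel which
is a power of a nondegenerate linear form. -/
lemma lintegral_ball_kernel_le {θ : ℝ} (hθ : 0 < θ) (hθ1 : θ < 1) {b : Rn 2} (hb : b ≠ 0)
    {i : Fin 2} (hi : ‖b‖ ≤ 2 * |b i|) (w : Rn 2 → ℝ≥0∞) (hw : Measurable w) (ω : ℝ → ℝ≥0∞)
    (hω : Measurable ω) (h : ∀ a, w a ≤ ω (a (i + 1))) :
    ∫⁻ a in {a : Rn 2 | ‖a‖ ≤ ‖b‖}, w a * ‖⟪b, a⟫‖ₑ ^ (θ - 1) ≤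
      2 * ‖b‖ₑ ^ (θ - 1) * ENNReal.ofReal (4 / θ * ‖b‖ ^ θ) *
        ∫⁻ y in Icc (-‖b‖) ‖b‖, ω y := by
  have hb' : 0 < ‖b‖ := norm_pos_iff.2 hb
  have hbi : b i ≠ 0 := by
    intro h0; rw [h0] at hi; simp at hi; exact hb hi
  have hms : MeasurableSet {a : Rn 2 | ‖a‖ ≤ ‖b‖} := measurableSet_le measurable_norm measurable_const
  have hk : Measurable fun a : Rn 2 => ‖⟪b, a⟫‖ₑ ^ (θ - 1) := by
    simpa using measurable_kernel b 0 (θ - 1)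
  rw [← lintegral_indicator hms, lintegral_planePt i _
    (Measurable.indicator (f := fun a => w a * ‖⟪b, a⟫‖ₑ ^ (θ - 1)) (hw.mul hk) hms),
    ← lintegral_const_mul _ hω, ← lintegral_indicator measurableSet_Icc]
  refine lintegral_mono fun y => ?_
  by_cases hy : y ∈ Icc (-‖b‖) ‖b‖
  · simp only [indicator_of_mem hy]
    calc _ ≤ ∫⁻ x in Icc (-‖b‖) ‖b‖, ω y * ‖b i * x + b (i + 1) * y‖ₑ ^ (θ - 1) := by
          rw [← lintegral_indicator measurableSet_Icc]
          refine lintegral_mono fun x => ?_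
          by_cases hx : planePt i x y ∈ {a : Rn 2 | ‖a‖ ≤ ‖b‖}
          · have hx' : x ∈ Icc (-‖b‖) ‖b‖ := by
              have := (abs_coord_le (planePt i x y) i).trans hx
              rw [planePt_self] at this
              exact abs_le.1 this
            rw [indicator_of_mem hx, indicator_of_mem hx', inner_planePt]
            gcongr
            simpa [planePt_other] using h (planePt i x y)
          · rw [indicator_of_notMem hx]; exact zero_le
      _ = ω y * ∫⁻ x in Icc (-‖b‖) ‖b‖, ‖b i * x + b (i + 1) * y‖ₑ ^ (θ - 1) :=
          lintegral_const_mul _ ((measurable_enorm_rpow _).comp (by fun_prop))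
      _ ≤ ω y * (‖b i‖ₑ ^ (θ - 1) * ENNReal.ofReal (4 / θ * ‖b‖ ^ θ)) := by
          gcongr
          exact lintegral_affine_enorm_rpow hθ hθ1 hb' hbi _
      _ ≤ ω y * (2 * ‖b‖ₑ ^ (θ - 1) * ENNReal.ofReal (4 / θ * ‖b‖ ^ θ)) := by
          gcongr
          exact enorm_coord_rpow_le hi hθ hθ1
      _ = _ := mul_comm _ _
  · simp only [indicator_of_notMem hy]
    refine (lintegral_eq_zero_of_ae_eq_zero (.of_forall fun x => ?_)).le
    refine indicator_of_notMem (fun hx => hy ?_) _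
    have := (abs_coord_le (planePt i x y) (i + 1)).trans hx
    rw [planePt_other] at this
    exact abs_le.1 this

lemma enorm_rpow_eq {b : Rn 2} (hb : b ≠ 0) (p : ℝ) : ‖b‖ₑ ^ p = ENNReal.ofReal (‖b‖ ^ p) := by
  rw [← ofReal_norm, ENNReal.ofReal_rpow_of_pos (norm_pos_iff.2 hb)]

lemma lintegral_ball_jap_inv_kernel_le {θ : ℝ} (hθ : 0 < θ) (hθ1 : θ < 1) {b : Rn 2} (hb : b ≠ 0)
    (η : Rn 2) :
    ∫⁻ a in {a : Rn 2 | ‖a‖ ≤ ‖b‖}, ENNReal.ofReal (jap (η - a))⁻¹ * ‖⟪b, a⟫‖ₑ ^ (θ - 1) ≤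
      ENNReal.ofReal (32 / θ ^ 2 * ‖b‖ ^ (3 * θ - 1)) := by
  have hb' : 0 < ‖b‖ := norm_pos_iff.2 hb
  obtain ⟨i, hi⟩ := exists_coord b
  have hm : Continuous fun a : Rn 2 => (jap (η - a))⁻¹ :=
    (continuous_jap.comp (continuous_const.sub continuous_id)).inv₀ fun a => (jap_pos _).ne'
  refine (lintegral_ball_kernel_le hθ hθ1 hb hi _ hm.measurable.ennreal_ofReal
    (fun y => ‖y + - η (i + 1)‖ₑ ^ (θ - 1))
    ((measurable_enorm_rpow _).comp (by fun_prop)) fun a => ?_).trans ?_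
  · refine (jap_inv_le (η - a) (i + 1) hθ hθ1).trans_eq ?_
    rw [← enorm_neg]; congr 2; simp; ring
  · calc _ ≤ 2 * ‖b‖ₑ ^ (θ - 1) * ENNReal.ofReal (4 / θ * ‖b‖ ^ θ) *
          ENNReal.ofReal (4 / θ * ‖b‖ ^ θ) := by
          gcongr
          exact lintegral_translate_enorm_rpow hθ hθ1 hb' _
      _ = _ := by
          rw [enorm_rpow_eq hb, two_mul_ofReal,
            ← ENNReal.ofReal_mul (by positivity), ← ENNReal.ofReal_mul (by positivity)]
          congr 1
          have : ‖b‖ ^ (3 * θ - 1) = ‖b‖ ^ (θ - 1) * ‖b‖ ^ θ * ‖b‖ ^ θ := by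
            rw [← Real.rpow_add hb', ← Real.rpow_add hb']; congr 1; ring
          rw [this]; field_simp; norm_num

lemma lintegral_ball_kernel_le' {θ : ℝ} (hθ : 0 < θ) (hθ1 : θ < 1) {b : Rn 2} (hb : b ≠ 0) :
    ∫⁻ a in {a : Rn 2 | ‖a‖ ≤ ‖b‖}, ‖⟪b, a⟫‖ₑ ^ (θ - 1) ≤
      ENNReal.ofReal (16 / θ * ‖b‖ ^ (2 * θ)) := by
  have hb' : 0 < ‖b‖ := norm_pos_iff.2 hb
  obtain ⟨i, hi⟩ := exists_coord b
  have := lintegral_ball_kernel_le hθ hθ1 hb hi (fun _ => 1) measurable_const (fun _ => 1)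
    measurable_const fun _ => le_rfl
  simp only [one_mul] at this
  refine this.trans_eq ?_
  rw [setLIntegral_const, one_mul, Real.volume_Icc, enorm_rpow_eq hb, two_mul_ofReal,
    ← ENNReal.ofReal_mul (by positivity), ← ENNReal.ofReal_mul (by positivity)]
  congr 1
  have : ‖b‖ ^ (2 * θ) = ‖b‖ ^ (θ - 1) * ‖b‖ ^ θ * ‖b‖ := by
    rw [← Real.rpow_add hb', ← Real.rpow_add_one hb'.ne']; congr 1; ring
  rw [this]; field_simp; norm_num

lemma jap_rpow_le {κ : ℝ} (hκ : 0 < κ) (hκ1 : κ < 1) (ζ : Rn 2) (i : Fin 2) :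
    jap ζ ^ (-(1 + 2 * κ)) ≤ 8 * ((1 + |ζ (i + 1)|) ^ (-(1 + κ)) * (1 + |ζ i|) ^ (-κ)) := by
  have key : ∀ (j : Fin 2) (p : ℝ), 0 ≤ p → jap ζ ^ (-p) ≤ 2 ^ p * (1 + |ζ j|) ^ (-p) := by
    intro j p hp
    have h1 : (1 + |ζ j|) / 2 ≤ jap ζ := by
      linarith [one_add_norm_le ζ, abs_coord_le ζ j]
    calc jap ζ ^ (-p) ≤ ((1 + |ζ j|) / 2) ^ (-p) :=
          Real.rpow_le_rpow_of_nonpos (by positivity) h1 (by linarith)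
      _ = _ := by
          rw [Real.div_rpow (by positivity) (by norm_num), Real.rpow_neg (by norm_num : (0:ℝ) ≤ 2)]
          field_simp
  calc jap ζ ^ (-(1 + 2 * κ)) = jap ζ ^ (-(1 + κ)) * jap ζ ^ (-κ) := by
        rw [← Real.rpow_add (jap_pos ζ)]; congr 1; ring
    _ ≤ (2 ^ (1 + κ) * (1 + |ζ (i + 1)|) ^ (-(1 + κ))) * (2 ^ κ * (1 + |ζ i|) ^ (-κ)) :=
        mul_le_mul (key _ _ (by linarith)) (key _ _ hκ.le)
          (Real.rpow_nonneg (jap_pos ζ).le _) (by positivity)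
    _ = 2 ^ (1 + 2 * κ) * ((1 + |ζ (i + 1)|) ^ (-(1 + κ)) * (1 + |ζ i|) ^ (-κ)) := by
        rw [show 1 + 2 * κ = (1 + κ) + κ by ring, Real.rpow_add (by norm_num) (1 + κ) κ]; ring
    _ ≤ 2 ^ (3 : ℝ) * ((1 + |ζ (i + 1)|) ^ (-(1 + κ)) * (1 + |ζ i|) ^ (-κ)) := by
        gcongr
        · norm_num
        · linarith
    _ = _ := by norm_num

lemma measurable_jap_rpow (q : ℝ) : Measurable fun ζ : Rn 2 => ENNReal.ofReal (jap ζ ^ q) :=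
  (continuous_jap.rpow_const fun _ => Or.inl (jap_pos _).ne').measurable.ennreal_ofReal

lemma measurable_jap_kernel (b : Rn 2) (c p q : ℝ) :
    Measurable fun ζ : Rn 2 => ENNReal.ofReal (jap ζ ^ q) * ‖⟪b, ζ⟫ + c‖ₑ ^ p :=
  (measurable_jap_rpow q).mul (measurable_kernel _ _ _)

/-- Integrals of decaying weights against powers of a linear form. -/
lemma exists_lintegral_jap_kernel_le {θ κ : ℝ} (hθ : 0 < θ) (hθκ : θ < κ) (hκ : κ < 1) :
    ∃ C : ℝ≥0, ∀ (b : Rn 2) (c : ℝ),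
      ∫⁻ ζ, ENNReal.ofReal (jap ζ ^ (-(1 + 2 * κ))) * ‖⟪b, ζ⟫ + c‖ₑ ^ (θ - 1) ≤
        C * ‖b‖ₑ ^ (θ - 1) := by
  obtain ⟨C₁, hC₁⟩ := exists_lintegral_one_add_abs_rpow (hθ.trans hθκ)
  obtain ⟨C₂, hC₂⟩ := exists_lintegral_weight_enorm_rpow hθ hθκ hκ
  refine ⟨8 * 2 * C₂ * C₁ + 1, fun b c => ?_⟩
  by_cases hb : b = 0
  · have h0 : ((8 * 2 * C₂ * C₁ + 1 : ℝ≥0) : ℝ≥0∞) ≠ 0 := by positivity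
    rw [hb, enorm_zero, ENNReal.zero_rpow_of_neg (by linarith), ENNReal.mul_top h0]
    exact le_top
  obtain ⟨i, hi⟩ := exists_coord b
  have hbi : b i ≠ 0 := by
    intro h0; rw [h0] at hi; simp at hi; exact hb hi
  rw [lintegral_planePt i _ (measurable_jap_kernel b c _ _)]
  have h1 : ∀ y x : ℝ, ENNReal.ofReal (jap (planePt i x y) ^ (-(1 + 2 * κ))) *
      ‖⟪b, planePt i x y⟫ + c‖ₑ ^ (θ - 1) ≤
      (8 * ‖b i‖ₑ ^ (θ - 1) * ENNReal.ofReal ((1 + |y - 0|) ^ (-(1 + κ)))) *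
      (ENNReal.ofReal ((1 + |x|) ^ (-κ)) *
        ‖x - (-((b (i + 1) * y + c) / b i))‖ₑ ^ (θ - 1)) := by
    intro y x
    have e1 : ⟪b, planePt i x y⟫ + c = b i * (x - (-((b (i + 1) * y + c) / b i))) := by
      rw [inner_planePt]; field_simp; ring
    rw [e1, enorm_mul_rpow hbi]
    have h2 : ENNReal.ofReal (jap (planePt i x y) ^ (-(1 + 2 * κ))) ≤
        8 * (ENNReal.ofReal ((1 + |y - 0|) ^ (-(1 + κ))) * ENNReal.ofReal ((1 + |x|) ^ (-κ))) := by
      have h3 := jap_rpow_le (hθ.trans hθκ) hκ (planePt i x y) i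
      rw [planePt_self, planePt_other] at h3
      rw [← ENNReal.ofReal_mul (by positivity), ← ENNReal.ofReal_ofNat,
        ← ENNReal.ofReal_mul (by norm_num), sub_zero]
      exact ENNReal.ofReal_le_ofReal h3
    calc _ ≤ 8 * (ENNReal.ofReal ((1 + |y - 0|) ^ (-(1 + κ))) *
          ENNReal.ofReal ((1 + |x|) ^ (-κ))) * (‖b i‖ₑ ^ (θ - 1) *
          ‖x - (-((b (i + 1) * y + c) / b i))‖ₑ ^ (θ - 1)) := by gcongr
      _ = _ := by ring
  have hmw : ∀ y : ℝ, Measurable fun x : ℝ => ENNReal.ofReal ((1 + |x|) ^ (-κ)) *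
        ‖x - (-((b (i + 1) * y + c) / b i))‖ₑ ^ (θ - 1) := fun y =>
    (Measurable.ennreal_ofReal (by fun_prop)).mul ((measurable_enorm_rpow _).comp (by fun_prop))
  have hmy : Measurable fun y : ℝ => ENNReal.ofReal ((1 + |y - 0|) ^ (-(1 + κ))) := by fun_prop
  calc _ ≤ ∫⁻ y : ℝ, ∫⁻ x : ℝ, (8 * ‖b i‖ₑ ^ (θ - 1) *
        ENNReal.ofReal ((1 + |y - 0|) ^ (-(1 + κ)))) *
        (ENNReal.ofReal ((1 + |x|) ^ (-κ)) *
        ‖x - (-((b (i + 1) * y + c) / b i))‖ₑ ^ (θ - 1)) :=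
        lintegral_mono fun y => lintegral_mono fun x => h1 y x
    _ ≤ ∫⁻ y : ℝ, 8 * ‖b i‖ₑ ^ (θ - 1) * C₂ * ENNReal.ofReal ((1 + |y - 0|) ^ (-(1 + κ))) := by
        refine lintegral_mono fun y => ?_
        simp only
        rw [lintegral_const_mul _ (hmw y)]
        calc _ ≤ 8 * ‖b i‖ₑ ^ (θ - 1) * ENNReal.ofReal ((1 + |y - 0|) ^ (-(1 + κ))) * C₂ := by
              gcongr; exact hC₂ _
          _ = _ := by ring
    _ ≤ 8 * (2 * ‖b‖ₑ ^ (θ - 1)) * C₂ * C₁ := by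
        rw [lintegral_const_mul _ hmy]
        gcongr
        · exact enorm_coord_rpow_le hi hθ (hθκ.trans hκ)
        · exact hC₁ 0
    _ ≤ _ := by
        push_cast
        rw [add_mul]
        refine le_trans (le_of_eq ?_) le_self_add
        ring

/-- The trilinear resonance kernel integrated against a pair of weights. -/
lemma exists_lintegral_jap_jap_kernel_le {θ κ : ℝ} (hθ : 0 < θ) (hθκ : θ < κ) (hκ : κ < 1) :
    ∃ C : ℝ≥0, ∀ (ξ : Rn 2) (c : Rn 2 → ℝ),
      ∫⁻ η, ∫⁻ ζ, ENNReal.ofReal (jap η ^ (-(1 + 2 * κ))) *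
        ENNReal.ofReal (jap ζ ^ (-(1 + 2 * κ))) * ‖⟪ξ - η, ζ⟫ + c η‖ₑ ^ (θ - 1) ≤ C := by
  obtain ⟨C, hC⟩ := exists_lintegral_jap_kernel_le hθ hθκ hκ
  refine ⟨C * C, fun ξ c => ?_⟩
  have e0 : ‖(EuclideanSpace.single 0 1 : Rn 2)‖ₑ = 1 := by
    rw [← ofReal_norm]; simp
  calc _ ≤ ∫⁻ η, C * (ENNReal.ofReal (jap η ^ (-(1 + 2 * κ))) *
        ‖⟪(EuclideanSpace.single 0 1 : Rn 2), η⟫ + (-ξ 0)‖ₑ ^ (θ - 1)) := by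
        refine lintegral_mono fun η => ?_
        simp only [mul_assoc]
        rw [lintegral_const_mul _ (measurable_jap_kernel _ _ _ _), ← mul_assoc (C : ℝ≥0∞),
          mul_comm (C : ℝ≥0∞), mul_assoc]
        gcongr
        refine (hC _ _).trans ?_
        refine mul_le_mul' le_rfl (ennreal_rpow_anti ?_ (by linarith))
        rw [Real.enorm_eq_ofReal_abs, ← ofReal_norm]
        refine ENNReal.ofReal_le_ofReal ?_
        have := abs_coord_le (ξ - η) 0
        rw [PiLp.sub_apply, abs_sub_comm] at this
        simpa [sub_eq_add_neg, EuclideanSpace.inner_single_left] using this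
    _ = C * ∫⁻ η, (ENNReal.ofReal (jap η ^ (-(1 + 2 * κ))) *
        ‖⟪(EuclideanSpace.single 0 1 : Rn 2), η⟫ + (-ξ 0)‖ₑ ^ (θ - 1)) :=
        lintegral_const_mul _ (measurable_jap_kernel _ _ _ _)
    _ ≤ C * (C * 1) := by
        gcongr
        refine (hC _ _).trans_eq ?_
        rw [e0, ENNReal.one_rpow]
    _ = _ := by push_cast; ring

end

/-! ### Bounds for the multiplier -/

section Multiplier

variable {s : ℝ} {m₁ : Rn 2 → ℝ} {N : ℝ}

lemma mult_bounds (hs0 : 0 < s) (hs1 : s < 1) (hm : IsAdmissibleMultiplier 2 s m₁) (ξ : Rn 2) :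
    1 / 2 * (max 1 ‖ξ‖) ^ (-(1 - s)) ≤ m₁ ξ ∧ m₁ ξ ≤ 2 * (max 1 ‖ξ‖) ^ (-(1 - s)) := by
  obtain ⟨-, hpos, hrad, hmono, hone, hlarge⟩ := hm
  rcases le_total 2 ‖ξ‖ with h | h
  · rw [max_eq_right (by linarith), hlarge ξ h]
    have : 0 ≤ ‖ξ‖ ^ (-(1 - s)) := by positivity
    constructor <;> linarith
  · have h1 : (1:ℝ) ≤ max 1 ‖ξ‖ := le_max_left _ _
    have h2 : max 1 ‖ξ‖ ≤ 2 := max_le (by norm_num) h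
    have h3 : (max 1 ‖ξ‖) ^ (-(1 - s)) ≤ 1 := Real.rpow_le_one_of_one_le_of_nonpos h1 (by linarith)
    have h4 : (2:ℝ) ^ (-(1 - s)) ≤ (max 1 ‖ξ‖) ^ (-(1 - s)) :=
      Real.rpow_le_rpow_of_nonpos (by linarith) h2 (by linarith)
    have h5 : (2:ℝ) ^ (-1 : ℝ) ≤ 2 ^ (-(1 - s)) :=
      Real.rpow_le_rpow_of_exponent_le (by norm_num) (by linarith)
    have h5' : (1 / 2 : ℝ) ≤ 2 ^ (-(1 - s)) := by
      rwa [Real.rpow_neg_one, ← one_div] at h5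
    have h6 : (2:ℝ) ^ (-(1 - s)) ≤ m₁ ξ := by
      have e : ‖(EuclideanSpace.single 0 (2:ℝ) : Rn 2)‖ = 2 := by simp
      have := hmono ξ (EuclideanSpace.single 0 (2:ℝ)) (by rw [e]; exact h)
      rwa [hlarge _ (by rw [e]), e] at this
    have h7 := (hpos ξ).2
    constructor <;> linarith

lemma mN_bounds (hs0 : 0 < s) (hs1 : s < 1) (hm : IsAdmissibleMultiplier 2 s m₁) (hN : 1 ≤ N)
    (ξ : Rn 2) :
    1 / 2 * (max 1 (‖ξ‖ / N)) ^ (-(1 - s)) ≤ mN m₁ N ξ ∧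
      mN m₁ N ξ ≤ 2 * (max 1 (‖ξ‖ / N)) ^ (-(1 - s)) := by
  have := mult_bounds hs0 hs1 hm (N⁻¹ • ξ)
  rwa [norm_smul, Real.norm_of_nonneg (by positivity), inv_mul_eq_div] at this

lemma mN_pos (hm : IsAdmissibleMultiplier 2 s m₁) (ξ : Rn 2) : 0 < mN m₁ N ξ := (hm.2.1 _).1

lemma mN_le_one (hm : IsAdmissibleMultiplier 2 s m₁) (ξ : Rn 2) : mN m₁ N ξ ≤ 1 := (hm.2.1 _).2

lemma mN_eq_one (hm : IsAdmissibleMultiplier 2 s m₁) (hN : 1 ≤ N) {ξ : Rn 2} (h : ‖ξ‖ ≤ N) :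
    mN m₁ N ξ = 1 := by
  refine hm.2.2.2.2.1 _ ?_
  rw [norm_smul, Real.norm_of_nonneg (by positivity), inv_mul_eq_div, div_le_one (by linarith)]
  exact h

lemma mN_congr (hm : IsAdmissibleMultiplier 2 s m₁) {ξ η : Rn 2} (h : ‖ξ‖ = ‖η‖) :
    mN m₁ N ξ = mN m₁ N η := by
  refine hm.2.2.1 _ _ ?_
  rw [norm_smul, norm_smul, h]

lemma continuous_mN (hm : IsAdmissibleMultiplier 2 s m₁) : Continuous (mN m₁ N) :=
  hm.1.continuous.comp (continuous_const_smul _)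

/-- The symbol of `⟨∇⟩ I_N`. -/
def gw (m₁ : Rn 2 → ℝ) (N : ℝ) (ξ : Rn 2) : ℝ := mN m₁ N ξ * jap ξ

lemma gw_pos (hm : IsAdmissibleMultiplier 2 s m₁) (ξ : Rn 2) : 0 < gw m₁ N ξ :=
  mul_pos (mN_pos hm ξ) (jap_pos ξ)

lemma gw_le_jap (hm : IsAdmissibleMultiplier 2 s m₁) (ξ : Rn 2) : gw m₁ N ξ ≤ jap ξ :=
  mul_le_of_le_one_left (jap_pos ξ).le (mN_le_one hm ξ)

lemma continuous_gw (hm : IsAdmissibleMultiplier 2 s m₁) : Continuous (gw m₁ N) :=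
  (continuous_mN hm).mul continuous_jap

lemma gw_congr (hm : IsAdmissibleMultiplier 2 s m₁) {ξ η : Rn 2} (h : ‖ξ‖ = ‖η‖) :
    gw m₁ N ξ = gw m₁ N η := by
  rw [gw, gw, mN_congr hm h, jap, jap, h]

lemma gw_lower (hs0 : 0 < s) (hs1 : s < 1) (hm : IsAdmissibleMultiplier 2 s m₁) (hN : 1 ≤ N)
    {p : ℝ} (hp : p ≤ s) (ξ : Rn 2) : 1 / 2 * jap ξ ^ p ≤ gw m₁ N ξ := by
  have h1 := (mN_bounds hs0 hs1 hm hN ξ).1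
  have h2 : max 1 (‖ξ‖ / N) ≤ jap ξ :=
    max_le (one_le_jap ξ) ((div_le_self (norm_nonneg _) hN).trans (norm_le_jap ξ))
  have h3 : jap ξ ^ (-(1 - s)) ≤ (max 1 (‖ξ‖ / N)) ^ (-(1 - s)) :=
    Real.rpow_le_rpow_of_nonpos (by positivity) h2 (by linarith)
  calc 1 / 2 * jap ξ ^ p ≤ 1 / 2 * jap ξ ^ s := by
        have := Real.rpow_le_rpow_of_exponent_le (one_le_jap ξ) hp
        linarith
    _ = 1 / 2 * jap ξ ^ (-(1 - s)) * jap ξ := by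
        rw [mul_assoc, ← Real.rpow_add_one (jap_pos ξ).ne']; congr 2; ring
    _ ≤ mN m₁ N ξ * jap ξ := mul_le_mul_of_nonneg_right (by linarith) (jap_pos ξ).le

lemma gw_lower_of_le (hs0 : 0 < s) (hs1 : s < 1) (hm : IsAdmissibleMultiplier 2 s m₁) (hN : 1 ≤ N)
    {p : ℝ} (hp : p ≤ s) {ξ : Rn 2} (hξ : N ≤ jap ξ) :
    1 / 2 * (N ^ (1 - p) * jap ξ ^ p) ≤ gw m₁ N ξ := by
  have hN0 : 0 < N := by linarith
  have h1 := (mN_bounds hs0 hs1 hm hN ξ).1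
  have hq : 1 ≤ jap ξ / N := (one_le_div hN0).2 hξ
  have h2 : max 1 (‖ξ‖ / N) ≤ jap ξ / N :=
    max_le hq (div_le_div_of_nonneg_right (norm_le_jap ξ) hN0.le)
  have h3 : (jap ξ / N) ^ (-(1 - s)) ≤ (max 1 (‖ξ‖ / N)) ^ (-(1 - s)) :=
    Real.rpow_le_rpow_of_nonpos (by positivity) h2 (by linarith)
  have hj := jap_pos ξ
  calc 1 / 2 * (N ^ (1 - p) * jap ξ ^ p) = 1 / 2 * ((jap ξ / N) ^ p * N) := by
        rw [Real.div_rpow hj.le hN0.le, Real.rpow_sub hN0, Real.rpow_one]; field_simp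
    _ ≤ 1 / 2 * ((jap ξ / N) ^ s * N) := by
        have := Real.rpow_le_rpow_of_exponent_le hq hp
        have := mul_le_mul_of_nonneg_right this hN0.le
        linarith
    _ = 1 / 2 * (jap ξ / N) ^ (-(1 - s)) * jap ξ := by
        have : (jap ξ / N) ^ s = (jap ξ / N) ^ (-(1 - s)) * (jap ξ / N) := by
          rw [← Real.rpow_add_one (by positivity)]; congr 1; ring
        rw [this]; field_simp
    _ ≤ mN m₁ N ξ * jap ξ := mul_le_mul_of_nonneg_right (by linarith) hj.le

lemma gw_lower_third (hs0 : 0 < s) (hs1 : s < 1) (hm : IsAdmissibleMultiplier 2 s m₁) (hN : 1 ≤ N)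
    {ξ : Rn 2} (hξ : N / 3 ≤ ‖ξ‖) : N / 3 ≤ gw m₁ N ξ := by
  rcases le_total ‖ξ‖ N with h | h
  · rw [gw, mN_eq_one hm hN h, one_mul]
    exact hξ.trans (norm_le_jap ξ)
  · have := gw_lower_of_le hs0 hs1 hm hN (p := 0) hs0.le (h.trans (norm_le_jap ξ))
    simp at this
    linarith

lemma gw_le_of_norm_le (hs0 : 0 < s) (hs1 : s < 1) (hm : IsAdmissibleMultiplier 2 s m₁)
    (hN : 1 ≤ N) {ξ η : Rn 2} (h : ‖ξ‖ ≤ ‖η‖) : gw m₁ N ξ ≤ 16 * gw m₁ N η := by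
  have hN0 : 0 < N := by linarith
  have h1 := (mN_bounds hs0 hs1 hm hN ξ).2
  have h2 := (mN_bounds hs0 hs1 hm hN η).1
  set μ := max 1 (‖ξ‖ / N) with hμ
  set ν := max 1 (‖η‖ / N) with hν
  have hμ1 : 1 ≤ μ := le_max_left _ _
  have hν1 : 1 ≤ ν := le_max_left _ _
  have hx := norm_nonneg ξ
  have hy := norm_nonneg η
  set R := (1 + ‖η‖) / (1 + ‖ξ‖) with hR
  have hR1 : 1 ≤ R := (one_le_div (by positivity)).2 (by linarith)
  have hνμ : ν ≤ μ * (2 * R) := by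
    refine max_le (by nlinarith) ?_
    have h3 : 1 + ‖ξ‖ ≤ 2 * (N * μ) := by
      have e1 : ‖ξ‖ ≤ N * μ := by
        have := le_max_right 1 (‖ξ‖ / N)
        rw [div_le_iff₀ hN0] at this; linarith
      nlinarith
    rw [div_le_iff₀ hN0]
    calc ‖η‖ ≤ 1 + ‖η‖ := by linarith
      _ = R * (1 + ‖ξ‖) := by rw [hR]; field_simp
      _ ≤ R * (2 * (N * μ)) := by gcongr
      _ = _ := by ring
  have h4 : μ ^ (-(1 - s)) ≤ ν ^ (-(1 - s)) * (2 * R) := by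
    have e1 : ν ^ (1 - s) ≤ μ ^ (1 - s) * (2 * R) := by
      calc ν ^ (1 - s) ≤ (μ * (2 * R)) ^ (1 - s) :=
            Real.rpow_le_rpow (by positivity) hνμ (by linarith)
        _ = μ ^ (1 - s) * (2 * R) ^ (1 - s) := Real.mul_rpow (by positivity) (by positivity)
        _ ≤ μ ^ (1 - s) * (2 * R) ^ (1 : ℝ) := by
            have := Real.rpow_le_rpow_of_exponent_le (by linarith : 1 ≤ 2 * R)
              (by linarith : 1 - s ≤ 1)
            gcongr
        _ = _ := by rw [Real.rpow_one]
    rw [Real.rpow_neg (by positivity), Real.rpow_neg (by positivity), inv_mul_eq_div,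
      le_div_iff₀ (by positivity), inv_mul_le_iff₀ (by positivity)]
    exact e1
  have h5 : R * (1 + ‖ξ‖) = 1 + ‖η‖ := by rw [hR]; field_simp
  have h6 : 0 ≤ ν ^ (-(1 - s)) := by positivity
  calc gw m₁ N ξ ≤ (2 * μ ^ (-(1 - s))) * (1 + ‖ξ‖) :=
        mul_le_mul h1 (jap_le ξ) (jap_pos ξ).le (by positivity)
    _ ≤ (2 * (ν ^ (-(1 - s)) * (2 * R))) * (1 + ‖ξ‖) := by gcongr
    _ = 4 * ν ^ (-(1 - s)) * (R * (1 + ‖ξ‖)) := by ring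
    _ = 4 * ν ^ (-(1 - s)) * (1 + ‖η‖) := by rw [h5]
    _ ≤ 4 * ν ^ (-(1 - s)) * (2 * jap η) := by gcongr; exact one_add_norm_le η
    _ = 16 * ((1 / 2 * ν ^ (-(1 - s))) * jap η) := by ring
    _ ≤ 16 * gw m₁ N η := by
        rw [gw]
        have := mul_le_mul_of_nonneg_right h2 (jap_pos η).le
        linarith

lemma jap_le_three {ξ η : Rn 2} (h : ‖ξ‖ ≤ 3 * ‖η‖) : jap ξ ≤ 3 * jap η := by
  have : jap ξ ^ 2 ≤ (3 * jap η) ^ 2 := by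
    rw [mul_pow, jap_sq, jap_sq]; nlinarith [norm_nonneg ξ]
  exact (sq_le_sq₀ (jap_pos ξ).le (by linarith [jap_pos η])).1 this

lemma gw_le_three (hs0 : 0 < s) (hs1 : s < 1) (hm : IsAdmissibleMultiplier 2 s m₁)
    (hN : 1 ≤ N) {ξ η : Rn 2} (h : ‖ξ‖ ≤ 3 * ‖η‖) : gw m₁ N ξ ≤ 48 * gw m₁ N η := by
  have e : ‖(3 : ℝ) • η‖ = 3 * ‖η‖ := by rw [norm_smul]; norm_num
  have h1 := gw_le_of_norm_le hs0 hs1 hm hN (ξ := ξ) (η := (3 : ℝ) • η) (by rw [e]; exact h)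
  have h2 : gw m₁ N ((3:ℝ) • η) ≤ 3 * gw m₁ N η := by
    have h3 : mN m₁ N ((3:ℝ) • η) ≤ mN m₁ N η := by
      refine hm.2.2.2.1 _ _ ?_
      rw [norm_smul, norm_smul, e]
      exact mul_le_mul_of_nonneg_left (by linarith [norm_nonneg η]) (norm_nonneg _)
    calc gw m₁ N ((3:ℝ) • η) ≤ mN m₁ N η * (3 * jap η) :=
          mul_le_mul h3 (jap_le_three e.le) (jap_pos _).le (mN_pos hm η).le
      _ = _ := by rw [gw]; ring
  linarith

/-- Relative Lipschitz bound for the multiplier. -/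
lemma exists_mult_sub_le (hs0 : 0 < s) (hs1 : s < 1) (hm : IsAdmissibleMultiplier 2 s m₁) :
    ∃ C : ℝ, 0 ≤ C ∧ ∀ ξ η : Rn 2, ‖ξ - η‖ ≤ ‖ξ‖ / 2 →
      ‖ξ‖ * |m₁ ξ - m₁ η| ≤ C * (m₁ ξ * ‖ξ - η‖) := by
  obtain ⟨K, hK⟩ := (hm.1.contDiffOn (s := Metric.closedBall 0 6)).exists_lipschitzOnWith
    (by simp) (convex_closedBall _ _) (isCompact_closedBall _ _)
  refine ⟨max 2 (32 * K), by positivity, fun ξ η h => ?_⟩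
  have hpos := (hm.2.1 ξ).1
  have hd := norm_nonneg (ξ - η)
  have hn1 : ‖η‖ ≤ ‖ξ‖ + ‖ξ - η‖ := by
    have := norm_sub_norm_le η ξ
    rw [norm_sub_rev] at this; linarith
  have hn2 : ‖ξ‖ ≤ ‖η‖ + ‖ξ - η‖ := by
    have := norm_sub_norm_le ξ η; linarith
  by_cases h2 : 2 ≤ ‖ξ‖ ∧ 2 ≤ ‖η‖
  · have hx : 0 < ‖ξ‖ := by linarith [h2.1]
    have hy : 0 < ‖η‖ := by linarith [h2.2]
    rw [hm.2.2.2.2.2 ξ h2.1, hm.2.2.2.2.2 η h2.2]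
    set x := ‖η‖ / ‖ξ‖ with hxd
    have hx0 : 0 < x := by positivity
    have hη : ‖η‖ = x * ‖ξ‖ := by rw [hxd]; field_simp
    have hxh : 1 / 2 ≤ x := by rw [hxd, le_div_iff₀ hx]; linarith
    have key : |1 - x ^ (-(1 - s))| ≤ 2 * |1 - x| := by
      rcases le_total 1 x with h1 | h1
      · have e1 : x ^ (-(1 - s)) ≤ 1 := Real.rpow_le_one_of_one_le_of_nonpos h1 (by linarith)
        have e2 : x ^ (-1 : ℝ) ≤ x ^ (-(1 - s)) :=
          Real.rpow_le_rpow_of_exponent_le h1 (by linarith)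
        rw [Real.rpow_neg_one] at e2
        have e3 : 1 - x⁻¹ ≤ x - 1 := by
          have : x * x⁻¹ = 1 := mul_inv_cancel₀ hx0.ne'
          have : 0 < x⁻¹ := by positivity
          nlinarith
        rw [abs_of_nonneg (by linarith), abs_of_nonpos (by linarith)]; linarith
      · have e1 : 1 ≤ x ^ (-(1 - s)) :=
          Real.one_le_rpow_of_pos_of_le_one_of_nonpos hx0 h1 (by linarith)
        have e2 : x ^ (-(1 - s)) ≤ x ^ (-1 : ℝ) :=
          Real.rpow_le_rpow_of_exponent_ge hx0 h1 (by linarith)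
        rw [Real.rpow_neg_one] at e2
        have e3 : x⁻¹ - 1 ≤ 2 * (1 - x) := by
          have : x * x⁻¹ = 1 := mul_inv_cancel₀ hx0.ne'
          have h5 : x⁻¹ ≤ 2 := by
            rw [inv_le_comm₀ hx0 (by norm_num)]; linarith
          nlinarith
        rw [abs_of_nonpos (by linarith), abs_of_nonneg (by linarith)]; linarith
    have e1 : ‖η‖ ^ (-(1 - s)) = x ^ (-(1 - s)) * ‖ξ‖ ^ (-(1 - s)) := by
      rw [hη, Real.mul_rpow hx0.le hx.le]
    have e2 : |1 - x| * ‖ξ‖ ≤ ‖ξ - η‖ := by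
      calc |1 - x| * ‖ξ‖ = |(1 - x) * ‖ξ‖| := by rw [abs_mul, abs_norm]
        _ = |‖ξ‖ - ‖η‖| := by rw [hη]; congr 1; ring
        _ ≤ _ := abs_norm_sub_norm_le ξ η
    have hp0 : 0 < ‖ξ‖ ^ (-(1 - s)) := by positivity
    rw [e1, show ‖ξ‖ ^ (-(1 - s)) - x ^ (-(1 - s)) * ‖ξ‖ ^ (-(1 - s)) =
      (1 - x ^ (-(1 - s))) * ‖ξ‖ ^ (-(1 - s)) by ring, abs_mul, abs_of_pos hp0]
    calc ‖ξ‖ * (|1 - x ^ (-(1 - s))| * ‖ξ‖ ^ (-(1 - s)))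
        ≤ ‖ξ‖ * ((2 * |1 - x|) * ‖ξ‖ ^ (-(1 - s))) := by gcongr
      _ = 2 * (‖ξ‖ ^ (-(1 - s)) * (|1 - x| * ‖ξ‖)) := by ring
      _ ≤ 2 * (‖ξ‖ ^ (-(1 - s)) * ‖ξ - η‖) := by gcongr
      _ ≤ _ := by gcongr; exact le_max_left _ _
  · have hx4 : ‖ξ‖ ≤ 4 := by
      by_contra hc
      exact h2 ⟨by linarith, by linarith⟩
    have h3 : |m₁ ξ - m₁ η| ≤ K * ‖ξ - η‖ := by
      have := hK.dist_le_mul ξ (by simp; linarith) η (by simp; linarith)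
      rwa [dist_eq_norm, dist_eq_norm, Real.norm_eq_abs] at this
    have h4 : 1 / 8 ≤ m₁ ξ := by
      have e1 := (mult_bounds hs0 hs1 hm ξ).1
      have e2 : (4:ℝ) ^ (-1 : ℝ) ≤ (max 1 ‖ξ‖) ^ (-(1 - s)) := by
        calc (4:ℝ) ^ (-1 : ℝ) ≤ 4 ^ (-(1 - s)) :=
              Real.rpow_le_rpow_of_exponent_le (by norm_num) (by linarith)
          _ ≤ _ := Real.rpow_le_rpow_of_nonpos (by positivity) (max_le (by norm_num) hx4)
              (by linarith)
      rw [show (4:ℝ) ^ (-1 : ℝ) = 1 / 4 by rw [Real.rpow_neg_one]; norm_num] at e2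
      linarith
    calc ‖ξ‖ * |m₁ ξ - m₁ η| ≤ 4 * (K * ‖ξ - η‖) := by gcongr
      _ = (32 * K) * (1 / 8 * ‖ξ - η‖) := by ring
      _ ≤ max 2 (32 * K) * (m₁ ξ * ‖ξ - η‖) := by
          gcongr
          exact le_max_right _ _

lemma exists_mN_sub_le (hs0 : 0 < s) (hs1 : s < 1) (hm : IsAdmissibleMultiplier 2 s m₁) :
    ∃ C : ℝ, 0 ≤ C ∧ ∀ N : ℝ, 1 ≤ N → ∀ ξ η : Rn 2, ‖ξ - η‖ ≤ ‖ξ‖ / 2 →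
      ‖ξ‖ * |mN m₁ N ξ - mN m₁ N η| ≤ C * (mN m₁ N ξ * ‖ξ - η‖) := by
  obtain ⟨C, hC0, hC⟩ := exists_mult_sub_le hs0 hs1 hm
  refine ⟨C, hC0, fun N hN ξ η h => ?_⟩
  have hN0 : 0 < N := by linarith
  have h1 := hC (N⁻¹ • ξ) (N⁻¹ • η)
  rw [← smul_sub, norm_smul, norm_smul, Real.norm_of_nonneg (by positivity)] at h1
  have h2 := h1 (by rw [mul_div_assoc]; gcongr)
  have h3 := mul_le_mul_of_nonneg_left h2 hN0.le
  calc _ = N * (N⁻¹ * ‖ξ‖ * |m₁ (N⁻¹ • ξ) - m₁ (N⁻¹ • η)|) := by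
        simp only [mN]; field_simp
    _ ≤ _ := h3
    _ = _ := by simp only [mN]; field_simp

/-- The commutator of the multiplier with a product vanishes at low frequency. -/
lemma mN_comm_eq_zero (hm : IsAdmissibleMultiplier 2 s m₁) (hN : 1 ≤ N) {ξ p q r : Rn 2}
    (hq : ‖q‖ ≤ ‖p‖) (hr : ‖r‖ ≤ ‖p‖) (hξ : ‖ξ‖ ≤ 3 * ‖p‖) (hp : ‖p‖ < N / 3) :
    mN m₁ N ξ - mN m₁ N p * mN m₁ N q * mN m₁ N r = 0 := by
  rw [mN_eq_one hm hN (ξ := ξ) (by linarith), mN_eq_one hm hN (ξ := p) (by linarith),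
    mN_eq_one hm hN (ξ := q) (by linarith), mN_eq_one hm hN (ξ := r) (by linarith)]
  ring

/-- Either the second largest frequency exceeds `N`, or the commutator is controlled by the
relative size of that frequency. -/
lemma exists_mN_comm_le (hs0 : 0 < s) (hs1 : s < 1) (hm : IsAdmissibleMultiplier 2 s m₁) :
    ∃ C : ℝ, 0 ≤ C ∧ ∀ N : ℝ, 1 ≤ N → ∀ ξ p q r : Rn 2, ‖q‖ ≤ ‖p‖ → ‖r‖ ≤ ‖q‖ →
      ‖p - ξ‖ ≤ ‖q‖ + ‖r‖ → ‖q‖ ≤ N →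
      ‖p‖ * |mN m₁ N ξ - mN m₁ N p * mN m₁ N q * mN m₁ N r| ≤ C * (mN m₁ N p * ‖q‖) := by
  obtain ⟨C, hC0, hC⟩ := exists_mN_sub_le hs0 hs1 hm
  refine ⟨max (2 * C) 32, by positivity, fun N hN ξ p q r hqp hrq hd hqN => ?_⟩
  have hN0 : 0 < N := by linarith
  have hmp := mN_pos (N := N) hm p
  rw [mN_eq_one hm hN hqN, mN_eq_one hm hN (hrq.trans hqN), mul_one, mul_one]
  by_cases h : ‖p - ξ‖ ≤ ‖p‖ / 2
  · rw [abs_sub_comm]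
    calc _ ≤ C * (mN m₁ N p * ‖p - ξ‖) := hC N hN p ξ h
      _ ≤ C * (mN m₁ N p * (2 * ‖q‖)) := by gcongr; linarith
      _ = 2 * C * (mN m₁ N p * ‖q‖) := by ring
      _ ≤ _ := by gcongr; exact le_max_left _ _
  · have hp4 : ‖p‖ ≤ 4 * ‖q‖ := by linarith
    have h4 : 1 / 8 ≤ mN m₁ N p := by
      have e1 := (mN_bounds hs0 hs1 hm hN p).1
      have e2 : (4:ℝ) ^ (-1 : ℝ) ≤ (max 1 (‖p‖ / N)) ^ (-(1 - s)) := by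
        calc (4:ℝ) ^ (-1 : ℝ) ≤ 4 ^ (-(1 - s)) :=
              Real.rpow_le_rpow_of_exponent_le (by norm_num) (by linarith)
          _ ≤ _ := Real.rpow_le_rpow_of_nonpos (by positivity) (max_le (by norm_num)
              (by rw [div_le_iff₀ hN0]; linarith)) (by linarith)
      rw [show (4:ℝ) ^ (-1 : ℝ) = 1 / 4 by rw [Real.rpow_neg_one]; norm_num] at e2
      linarith
    have h5 : |mN m₁ N ξ - mN m₁ N p| ≤ 1 := by
      rw [abs_le]
      constructor <;> linarith [mN_pos (N := N) hm ξ, mN_le_one (N := N) hm ξ,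
        mN_le_one (N := N) hm p]
    calc _ ≤ (4 * ‖q‖) * 1 := by gcongr
      _ = 32 * (1 / 8 * ‖q‖) := by ring
      _ ≤ max (2 * C) 32 * (mN m₁ N p * ‖q‖) := by
          gcongr
          exact le_max_right _ _

end Multiplier

section Multiplier

variable {s : ℝ} {m₁ : Rn 2 → ℝ} {N : ℝ}

lemma half_le_rpow_mul_gw (hs0 : 0 < s) (hs1 : s < 1) (hm : IsAdmissibleMultiplier 2 s m₁)
    (hN : 1 ≤ N) {p : ℝ} (hp : p ≤ s) (ξ : Rn 2) : 1 / 2 ≤ jap ξ ^ (-p) * gw m₁ N ξ := by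
  have h := gw_lower hs0 hs1 hm hN hp ξ
  have hj : 0 < jap ξ ^ p := Real.rpow_pos_of_pos (jap_pos ξ) p
  rw [Real.rpow_neg (jap_pos ξ).le, inv_mul_eq_div, le_div_iff₀ hj]
  exact h

lemma le_rpow_mul_gw_of_le (hs0 : 0 < s) (hs1 : s < 1) (hm : IsAdmissibleMultiplier 2 s m₁)
    (hN : 1 ≤ N) {p : ℝ} (hp : p ≤ s) {ξ : Rn 2} (hξ : N ≤ ‖ξ‖) :
    1 / 2 * N ^ (1 - p) ≤ jap ξ ^ (-p) * gw m₁ N ξ := by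
  have h := gw_lower_of_le hs0 hs1 hm hN hp (hξ.trans (norm_le_jap ξ))
  have hj : 0 < jap ξ ^ p := Real.rpow_pos_of_pos (jap_pos ξ) p
  rw [Real.rpow_neg (jap_pos ξ).le, inv_mul_eq_div, le_div_iff₀ hj]
  linarith

lemma abs_mN_comm_le_one (hm : IsAdmissibleMultiplier 2 s m₁) (ξ p q r : Rn 2) :
    |mN m₁ N ξ - mN m₁ N p * mN m₁ N q * mN m₁ N r| ≤ 1 := by
  have h1 := mN_pos (N := N) hm ξ
  have h2 := mN_le_one (N := N) hm ξ
  have h3 : 0 < mN m₁ N p * mN m₁ N q * mN m₁ N r :=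
    mul_pos (mul_pos (mN_pos hm p) (mN_pos hm q)) (mN_pos hm r)
  have h4 : mN m₁ N p * mN m₁ N q * mN m₁ N r ≤ 1 :=
    mul_le_one₀ (mul_le_one₀ (mN_le_one hm p) (mN_pos hm q).le (mN_le_one hm q))
      (mN_pos hm r).le (mN_le_one hm r)
  rw [abs_le]; constructor <;> linarith

lemma norm_le_three_of_sub {ξ p q r : Rn 2} (hq : ‖q‖ ≤ ‖p‖) (hr : ‖r‖ ≤ ‖p‖)
    (hd : ‖p - ξ‖ ≤ ‖q‖ + ‖r‖) : ‖ξ‖ ≤ 3 * ‖p‖ := by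
  have := norm_sub_norm_le ξ p
  rw [norm_sub_rev] at this; linarith

lemma exists_comm_trilinear_le (hs0 : 0 < s) (hs1 : s < 1) (hm : IsAdmissibleMultiplier 2 s m₁)
    {κ : ℝ} (hκ : 0 ≤ κ) (hκs : 1 / 2 + κ ≤ s) :
    ∃ C : ℝ, 0 ≤ C ∧ ∀ N : ℝ, 1 ≤ N → ∀ ξ p q r : Rn 2, ‖q‖ ≤ ‖p‖ → ‖r‖ ≤ ‖p‖ →
      ‖p - ξ‖ ≤ ‖q‖ + ‖r‖ →
      |mN m₁ N ξ - mN m₁ N p * mN m₁ N q * mN m₁ N r| ≤ C * (N ^ (-(3 / 2 - κ)) * jap ξ *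
        (jap q ^ (-(1 / 2 + κ)) * jap r ^ (-(1 / 2 + κ)) *
          (gw m₁ N p * gw m₁ N q * gw m₁ N r))) := by
  obtain ⟨C, hC0, hC⟩ := exists_mN_comm_le hs0 hs1 hm
  suffices ∀ N : ℝ, 1 ≤ N → ∀ ξ p q r : Rn 2, ‖q‖ ≤ ‖p‖ → ‖r‖ ≤ ‖q‖ →
      ‖p - ξ‖ ≤ ‖q‖ + ‖r‖ →
      |mN m₁ N ξ - mN m₁ N p * mN m₁ N q * mN m₁ N r| ≤ (36 * C + 12) * (N ^ (-(3 / 2 - κ)) *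
        jap ξ * (jap q ^ (-(1 / 2 + κ)) * jap r ^ (-(1 / 2 + κ)) *
          (gw m₁ N p * gw m₁ N q * gw m₁ N r))) by
    refine ⟨36 * C + 12, by positivity, fun N hN ξ p q r hq hr hd => ?_⟩
    rcases le_total ‖r‖ ‖q‖ with h | h
    · exact this N hN ξ p q r hq h hd
    · have := this N hN ξ p r q hr h (by linarith)
      convert this using 2
      · ring
      · ring
  intro N hN ξ p q r hq hr hd
  have hN0 : 0 < N := by linarith
  have gp := gw_pos (N := N) hm p
  have gq := gw_pos (N := N) hm q
  have gr := gw_pos (N := N) hm r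
  have jq : 0 < jap q ^ (-(1 / 2 + κ)) := Real.rpow_pos_of_pos (jap_pos q) _
  have jr : 0 < jap r ^ (-(1 / 2 + κ)) := Real.rpow_pos_of_pos (jap_pos r) _
  have jξ := one_le_jap ξ
  have hNp : 0 < N ^ (-(3 / 2 - κ)) := by positivity
  by_cases hp : ‖p‖ < N / 3
  · rw [mN_comm_eq_zero hm hN hq (hr.trans hq) (norm_le_three_of_sub hq (hr.trans hq) hd) hp,
      abs_zero]
    positivity
  rw [not_lt] at hp
  have hr' := half_le_rpow_mul_gw hs0 hs1 hm hN hκs r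
  set X := N ^ (-(3 / 2 - κ)) with hX
  have red : ∀ A : ℝ, A ≤ X * (gw m₁ N p * (jap q ^ (-(1 / 2 + κ)) * gw m₁ N q)) →
      1 / 2 * A ≤ X * jap ξ * (jap q ^ (-(1 / 2 + κ)) * jap r ^ (-(1 / 2 + κ)) *
          (gw m₁ N p * gw m₁ N q * gw m₁ N r)) := by
    intro A hA
    set Z := X * (gw m₁ N p * (jap q ^ (-(1 / 2 + κ)) * gw m₁ N q))
    have hZ : 0 < Z := by positivity
    calc 1 / 2 * A ≤ 1 / 2 * Z := by linarith
      _ ≤ (jap r ^ (-(1 / 2 + κ)) * gw m₁ N r) * Z := by gcongr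
      _ ≤ jap ξ * ((jap r ^ (-(1 / 2 + κ)) * gw m₁ N r) * Z) :=
          le_mul_of_one_le_left (by positivity) jξ
      _ = _ := by simp only [Z]; ring
  have hp0 : 0 < ‖p‖ := by linarith
  rcases le_total ‖q‖ N with hqN | hqN
  · have h1 := hC N hN ξ p q r hq hr hd hqN
    have hmp := mN_pos (N := N) hm p
    have e1 : jap q ^ (1 / 2 + κ) ≤ 2 * N ^ (1 / 2 + κ) := by
      calc jap q ^ (1 / 2 + κ) ≤ (2 * N) ^ (1 / 2 + κ) :=
            Real.rpow_le_rpow (jap_pos q).le (by linarith [jap_le q]) (by linarith)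
        _ = 2 ^ (1 / 2 + κ) * N ^ (1 / 2 + κ) := Real.mul_rpow (by norm_num) hN0.le
        _ ≤ 2 ^ (1 : ℝ) * N ^ (1 / 2 + κ) := by
            have := Real.rpow_le_rpow_of_exponent_le (by norm_num : (1:ℝ) ≤ 2)
              (by linarith : 1 / 2 + κ ≤ 1)
            gcongr
        _ = _ := by rw [Real.rpow_one]
    have e2 : N ^ (1 / 2 + κ) = X * N ^ 2 := by
      rw [hX, ← Real.rpow_natCast, ← Real.rpow_add hN0]; congr 1; push_cast; ring
    have e3 : N ^ 2 ≤ 9 * ‖p‖ ^ 2 := by nlinarith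
    have e4 : ‖q‖ ≤ (jap q ^ (-(1 / 2 + κ)) * jap q) * (18 * (X * ‖p‖ ^ 2)) := by
      calc ‖q‖ ≤ jap q := norm_le_jap q
        _ = (jap q ^ (-(1 / 2 + κ)) * jap q) * jap q ^ (1 / 2 + κ) := by
            rw [mul_right_comm, ← Real.rpow_add (jap_pos q)]; simp
        _ ≤ (jap q ^ (-(1 / 2 + κ)) * jap q) * (18 * (X * ‖p‖ ^ 2)) := by
            have := jap_pos q
            gcongr
            calc _ ≤ _ := e1
              _ = 2 * (X * N ^ 2) := by rw [e2]
              _ ≤ 2 * (X * (9 * ‖p‖ ^ 2)) := by gcongr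
              _ = _ := by ring
    have e5 : 1 / 18 * (mN m₁ N p * ‖q‖ / ‖p‖) ≤
        X * (gw m₁ N p * (jap q ^ (-(1 / 2 + κ)) * gw m₁ N q)) := by
      have hgq : gw m₁ N q = jap q := by rw [gw, mN_eq_one hm hN hqN, one_mul]
      have hj := jap_pos q
      have hgp : mN m₁ N p * ‖p‖ ≤ gw m₁ N p := by
        rw [gw]; gcongr; exact norm_le_jap p
      rw [hgq]
      calc 1 / 18 * (mN m₁ N p * ‖q‖ / ‖p‖)
          ≤ 1 / 18 * (mN m₁ N p * ((jap q ^ (-(1 / 2 + κ)) * jap q) *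
            (18 * (X * ‖p‖ ^ 2))) / ‖p‖) := by gcongr
        _ = X * ((mN m₁ N p * ‖p‖) * (jap q ^ (-(1 / 2 + κ)) * jap q)) := by field_simp
        _ ≤ _ := by gcongr
    have e6 := red _ e5
    have e7 : |mN m₁ N ξ - mN m₁ N p * mN m₁ N q * mN m₁ N r| ≤ C * (mN m₁ N p * ‖q‖ / ‖p‖) := by
      rw [mul_div_assoc', le_div_iff₀ hp0]; linarith
    set Y := X * jap ξ * (jap q ^ (-(1 / 2 + κ)) * jap r ^ (-(1 / 2 + κ)) *
          (gw m₁ N p * gw m₁ N q * gw m₁ N r))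
    have hY : 0 < Y := by positivity
    calc _ ≤ _ := e7
      _ ≤ C * (36 * Y) := by gcongr; linarith
      _ ≤ (36 * C + 12) * Y := by nlinarith
  · have h1 := le_rpow_mul_gw_of_le hs0 hs1 hm hN hκs hqN
    have h2 := gw_lower_third hs0 hs1 hm hN hp
    have e1 : 1 = X * (N * N ^ (1 - (1 / 2 + κ))) := by
      rw [hX]
      nth_rewrite 2 [← Real.rpow_one N]
      rw [← Real.rpow_add hN0, ← Real.rpow_add hN0]
      ring_nf; simp
    have e5 : 1 / 6 ≤ X * (gw m₁ N p * (jap q ^ (-(1 / 2 + κ)) * gw m₁ N q)) := by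
      calc (1 / 6 : ℝ) = 1 / 6 * (X * (N * N ^ (1 - (1 / 2 + κ)))) := by rw [← e1]; norm_num
        _ = X * ((N / 3) * (1 / 2 * N ^ (1 - (1 / 2 + κ)))) := by ring
        _ ≤ _ := by gcongr
    have e6 := red _ e5
    set Y := X * jap ξ * (jap q ^ (-(1 / 2 + κ)) * jap r ^ (-(1 / 2 + κ)) *
          (gw m₁ N p * gw m₁ N q * gw m₁ N r))
    calc _ ≤ 1 := abs_mN_comm_le_one hm ξ p q r
      _ ≤ 12 * Y := by linarith
      _ ≤ _ := by gcongr; linarith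

lemma exists_comm_quartic_le (hs : 1 / 2 ≤ s) (hs1 : s < 1) (hm : IsAdmissibleMultiplier 2 s m₁) :
    ∃ C : ℝ, 0 ≤ C ∧ ∀ N : ℝ, 1 ≤ N → ∀ ξ p q r : Rn 2, ‖q‖ ≤ ‖p‖ → ‖r‖ ≤ ‖p‖ →
      ‖p - ξ‖ ≤ ‖q‖ + ‖r‖ →
      jap ξ * |mN m₁ N ξ - mN m₁ N p * mN m₁ N q * mN m₁ N r| ≤
        C * (N ^ (-(1 / 2 : ℝ)) * (jap q ^ (-(1 / 2 : ℝ)) * jap r ^ (-(1 / 2 : ℝ)) *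
          (gw m₁ N p * gw m₁ N q * gw m₁ N r))) := by
  have hs0 : 0 < s := by linarith
  obtain ⟨C, hC0, hC⟩ := exists_mN_comm_le hs0 hs1 hm
  suffices ∀ N : ℝ, 1 ≤ N → ∀ ξ p q r : Rn 2, ‖q‖ ≤ ‖p‖ → ‖r‖ ≤ ‖q‖ →
      ‖p - ξ‖ ≤ ‖q‖ + ‖r‖ →
      jap ξ * |mN m₁ N ξ - mN m₁ N p * mN m₁ N q * mN m₁ N r| ≤
        (48 * C + 204) * (N ^ (-(1 / 2 : ℝ)) * (jap q ^ (-(1 / 2 : ℝ)) * jap r ^ (-(1 / 2 : ℝ)) *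
          (gw m₁ N p * gw m₁ N q * gw m₁ N r))) by
    refine ⟨48 * C + 204, by positivity, fun N hN ξ p q r hq hr hd => ?_⟩
    rcases le_total ‖r‖ ‖q‖ with h | h
    · exact this N hN ξ p q r hq h hd
    · have := this N hN ξ p r q hr h (by linarith)
      convert this using 2
      · congr 2; ring
      · ring
  intro N hN ξ p q r hq hr hd
  have hN0 : 0 < N := by linarith
  have gp := gw_pos (N := N) hm p
  have gq := gw_pos (N := N) hm q
  have gr := gw_pos (N := N) hm r
  have jq : 0 < jap q ^ (-(1 / 2 : ℝ)) := Real.rpow_pos_of_pos (jap_pos q) _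
  have jr : 0 < jap r ^ (-(1 / 2 : ℝ)) := Real.rpow_pos_of_pos (jap_pos r) _
  have jξ := jap_pos ξ
  have h3 := norm_le_three_of_sub hq (hr.trans hq) hd
  by_cases hp : ‖p‖ < N / 3
  · rw [mN_comm_eq_zero hm hN hq (hr.trans hq) h3 hp, abs_zero, mul_zero]
    positivity
  rw [not_lt] at hp
  have hr' := half_le_rpow_mul_gw hs0 hs1 hm hN hs r
  set X := N ^ (-(1 / 2 : ℝ)) with hX
  have hXp : 0 < X := by positivity
  have red : ∀ A : ℝ, A ≤ X * (gw m₁ N p * (jap q ^ (-(1 / 2 : ℝ)) * gw m₁ N q)) →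
      1 / 2 * A ≤ X * (jap q ^ (-(1 / 2 : ℝ)) * jap r ^ (-(1 / 2 : ℝ)) *
          (gw m₁ N p * gw m₁ N q * gw m₁ N r)) := by
    intro A hA
    set Z := X * (gw m₁ N p * (jap q ^ (-(1 / 2 : ℝ)) * gw m₁ N q))
    have hZ : 0 < Z := by positivity
    calc 1 / 2 * A ≤ 1 / 2 * Z := by linarith
      _ ≤ (jap r ^ (-(1 / 2 : ℝ)) * gw m₁ N r) * Z := by gcongr
      _ = _ := by simp only [Z]; ring
  have hp0 : 0 < ‖p‖ := by linarith
  have hj3 := jap_le_three h3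
  have hjp := jap_pos p
  have hXN : X * N ^ (1 / 2 : ℝ) = 1 := by rw [hX, ← Real.rpow_add hN0]; simp
  rcases le_total ‖q‖ N with hqN | hqN
  · have h1 := hC N hN ξ p q r hq hr hd hqN
    have hmp := mN_pos (N := N) hm p
    have hj := jap_pos q
    have hgq : gw m₁ N q = jap q := by rw [gw, mN_eq_one hm hN hqN, one_mul]
    have e1 : jap q ^ (1 / 2 : ℝ) ≤ jap p ^ (1 / 2 : ℝ) :=
      Real.rpow_le_rpow hj.le (jap_mono hq) (by norm_num)
    have e2 : N ^ (1 / 2 : ℝ) ≤ 2 * jap p ^ (1 / 2 : ℝ) := by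
      calc N ^ (1 / 2 : ℝ) ≤ (4 * jap p) ^ (1 / 2 : ℝ) :=
            Real.rpow_le_rpow hN0.le (by linarith [norm_le_jap p]) (by norm_num)
        _ = 4 ^ (1 / 2 : ℝ) * jap p ^ (1 / 2 : ℝ) := Real.mul_rpow (by norm_num) hjp.le
        _ = _ := by
            congr 1
            rw [show (4:ℝ) = 2 ^ (2:ℝ) by norm_num, ← Real.rpow_mul (by norm_num)]; norm_num
    have e3 : ∀ ζ : Rn 2, jap ζ ^ (1 / 2 : ℝ) * jap ζ ^ (1 / 2 : ℝ) = jap ζ := fun ζ => by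
      rw [← Real.rpow_add (jap_pos ζ)]; norm_num
    have e3' : jap q ^ (-(1 / 2 : ℝ)) * jap q = jap q ^ (1 / 2 : ℝ) := by
      rw [← Real.rpow_add_one hj.ne']; norm_num
    have hjq' : 0 < jap q ^ (1 / 2 : ℝ) := Real.rpow_pos_of_pos hj _
    have e5 : 1 / 2 * (mN m₁ N p * ‖q‖) ≤
        X * (gw m₁ N p * (jap q ^ (-(1 / 2 : ℝ)) * gw m₁ N q)) := by
      rw [hgq, e3', gw]
      calc 1 / 2 * (mN m₁ N p * ‖q‖) ≤ 1 / 2 * (mN m₁ N p *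
            (jap q ^ (1 / 2 : ℝ) * jap q ^ (1 / 2 : ℝ))) := by
            rw [e3]; gcongr; exact norm_le_jap q
        _ ≤ 1 / 2 * (mN m₁ N p * (jap p ^ (1 / 2 : ℝ) * jap q ^ (1 / 2 : ℝ))) := by gcongr
        _ = 1 / 2 * (mN m₁ N p * ((X * N ^ (1 / 2 : ℝ)) * jap p ^ (1 / 2 : ℝ) *
              jap q ^ (1 / 2 : ℝ))) := by rw [hXN, one_mul]
        _ ≤ 1 / 2 * (mN m₁ N p * ((X * (2 * jap p ^ (1 / 2 : ℝ))) * jap p ^ (1 / 2 : ℝ) *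
              jap q ^ (1 / 2 : ℝ))) := by gcongr
        _ = X * (mN m₁ N p * (jap p ^ (1 / 2 : ℝ) * jap p ^ (1 / 2 : ℝ)) *
              jap q ^ (1 / 2 : ℝ)) := by ring
        _ = _ := by rw [e3]
    have e6 := red _ e5
    have e8 : jap p ≤ 4 * ‖p‖ := by linarith [jap_le p]
    set Y := X * (jap q ^ (-(1 / 2 : ℝ)) * jap r ^ (-(1 / 2 : ℝ)) *
          (gw m₁ N p * gw m₁ N q * gw m₁ N r))
    have hY : 0 < Y := by positivity
    calc _ ≤ (12 * ‖p‖) * |mN m₁ N ξ - mN m₁ N p * mN m₁ N q * mN m₁ N r| := by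
          gcongr; linarith
      _ = 12 * (‖p‖ * |mN m₁ N ξ - mN m₁ N p * mN m₁ N q * mN m₁ N r|) := by ring
      _ ≤ 12 * (C * (mN m₁ N p * ‖q‖)) := by gcongr
      _ ≤ 12 * (C * (4 * Y)) :=
          mul_le_mul_of_nonneg_left (mul_le_mul_of_nonneg_left (by linarith) hC0) (by norm_num)
      _ ≤ (48 * C + 204) * Y := by nlinarith
  · have h1 := le_rpow_mul_gw_of_le hs0 hs1 hm hN hs hqN
    have e5 : 1 / 2 * gw m₁ N p ≤ X * (gw m₁ N p * (jap q ^ (-(1 / 2 : ℝ)) * gw m₁ N q)) := by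
      calc 1 / 2 * gw m₁ N p = 1 / 2 * gw m₁ N p * (X * N ^ (1 / 2 : ℝ)) := by rw [hXN, mul_one]
        _ = X * (gw m₁ N p * (1 / 2 * N ^ (1 - 1 / 2 : ℝ))) := by norm_num; ring
        _ ≤ _ := by gcongr
    have e6 := red _ e5
    set Y := X * (jap q ^ (-(1 / 2 : ℝ)) * jap r ^ (-(1 / 2 : ℝ)) *
          (gw m₁ N p * gw m₁ N q * gw m₁ N r))
    have hY : 0 < Y := by positivity
    have a1 := mN_pos (N := N) hm p
    have a2 := mN_pos (N := N) hm q
    have a3 := mN_pos (N := N) hm r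
    have e7 : |mN m₁ N ξ - mN m₁ N p * mN m₁ N q * mN m₁ N r| ≤ mN m₁ N ξ + mN m₁ N p := by
      have h5 : mN m₁ N p * mN m₁ N q * mN m₁ N r ≤ mN m₁ N p := by
        rw [mul_assoc]
        exact mul_le_of_le_one_right a1.le
          (mul_le_one₀ (mN_le_one hm q) a3.le (mN_le_one hm r))
      have h6 : 0 < mN m₁ N p * mN m₁ N q * mN m₁ N r := by positivity
      have h7 := mN_pos (N := N) hm ξ
      rw [abs_le]; constructor <;> linarith
    calc _ ≤ jap ξ * (mN m₁ N ξ + mN m₁ N p) := by gcongr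
      _ = gw m₁ N ξ + jap ξ * mN m₁ N p := by rw [gw]; ring
      _ ≤ 48 * gw m₁ N p + 3 * jap p * mN m₁ N p := by
          gcongr
          exact gw_le_three hs0 hs1 hm hN h3
      _ = 51 * gw m₁ N p := by rw [gw]; ring
      _ ≤ 204 * Y := by linarith
      _ ≤ _ := by gcongr; linarith

end Multiplier

section Interaction

variable {s : ℝ} {m₁ : Rn 2 → ℝ} {N : ℝ}

/-- Sum over pairs of input frequencies of the weights `⟨ξⱼ⟩^{-σ} ⟨ξₖ⟩^{-σ}`. -/
def pairWeight (σ : ℝ) (ξ₁ ξ₂ ξ₃ : Rn 2) : ℝ :=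
  jap ξ₁ ^ (-σ) * jap ξ₂ ^ (-σ) + jap ξ₁ ^ (-σ) * jap ξ₃ ^ (-σ) + jap ξ₂ ^ (-σ) * jap ξ₃ ^ (-σ)

lemma jap_neg (ξ : Rn 2) : jap (-ξ) = jap ξ := by simp [jap]

lemma jap_rpow_pos (ξ : Rn 2) (p : ℝ) : 0 < jap ξ ^ p := Real.rpow_pos_of_pos (jap_pos ξ) p

lemma pairWeight_pos (σ : ℝ) (ξ₁ ξ₂ ξ₃ : Rn 2) : 0 < pairWeight σ ξ₁ ξ₂ ξ₃ := by
  have h₁ := jap_rpow_pos ξ₁ (-σ)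
  have h₂ := jap_rpow_pos ξ₂ (-σ)
  have h₃ := jap_rpow_pos ξ₃ (-σ)
  unfold pairWeight; positivity

lemma le_pairWeight (σ : ℝ) (ξ₁ ξ₂ ξ₃ : Rn 2) :
    jap ξ₁ ^ (-σ) * jap ξ₂ ^ (-σ) ≤ pairWeight σ ξ₁ ξ₂ ξ₃ ∧
    jap ξ₁ ^ (-σ) * jap ξ₃ ^ (-σ) ≤ pairWeight σ ξ₁ ξ₂ ξ₃ ∧
    jap ξ₂ ^ (-σ) * jap ξ₃ ^ (-σ) ≤ pairWeight σ ξ₁ ξ₂ ξ₃ := by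
  have h₁ := jap_rpow_pos ξ₁ (-σ)
  have h₂ := jap_rpow_pos ξ₂ (-σ)
  have h₃ := jap_rpow_pos ξ₃ (-σ)
  have h₁₂ := mul_pos h₁ h₂
  have h₁₃ := mul_pos h₁ h₃
  have h₂₃ := mul_pos h₂ h₃
  unfold pairWeight
  refine ⟨?_, ?_, ?_⟩ <;> linarith

/-- One of the three inputs of the interaction `ξ₄ = ξ₁ - ξ₂ + ξ₃` dominates the others. -/
lemma dominant_input {ξ₁ ξ₂ ξ₃ ξ₄ : Rn 2} (h : ξ₄ = ξ₁ - ξ₂ + ξ₃) :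
    (‖ξ₂‖ ≤ ‖ξ₁‖ ∧ ‖ξ₃‖ ≤ ‖ξ₁‖ ∧ ‖ξ₁ - ξ₄‖ ≤ ‖ξ₂‖ + ‖ξ₃‖) ∨
    (‖ξ₁‖ ≤ ‖ξ₂‖ ∧ ‖ξ₃‖ ≤ ‖ξ₂‖ ∧ ‖ξ₂ - (-ξ₄)‖ ≤ ‖ξ₁‖ + ‖ξ₃‖) ∨
    (‖ξ₁‖ ≤ ‖ξ₃‖ ∧ ‖ξ₂‖ ≤ ‖ξ₃‖ ∧ ‖ξ₃ - ξ₄‖ ≤ ‖ξ₁‖ + ‖ξ₂‖) := by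
  have h₁ : ‖ξ₁ - ξ₄‖ ≤ ‖ξ₂‖ + ‖ξ₃‖ := by
    rw [show ξ₁ - ξ₄ = ξ₂ - ξ₃ by rw [h]; abel]; exact norm_sub_le _ _
  have h₂ : ‖ξ₂ - (-ξ₄)‖ ≤ ‖ξ₁‖ + ‖ξ₃‖ := by
    rw [show ξ₂ - (-ξ₄) = ξ₁ + ξ₃ by rw [h]; abel]; exact norm_add_le _ _
  have h₃ : ‖ξ₃ - ξ₄‖ ≤ ‖ξ₁‖ + ‖ξ₂‖ := by
    rw [show ξ₃ - ξ₄ = ξ₂ - ξ₁ by rw [h]; abel, add_comm ‖ξ₁‖]; exact norm_sub_le _ _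
  rcases le_total ‖ξ₁‖ ‖ξ₂‖ with h12 | h12 <;> rcases le_total ‖ξ₁‖ ‖ξ₃‖ with h13 | h13 <;>
    rcases le_total ‖ξ₂‖ ‖ξ₃‖ with h23 | h23
  all_goals first
    | exact Or.inl ⟨by linarith, by linarith, h₁⟩
    | exact Or.inr (Or.inl ⟨by linarith, by linarith, h₂⟩)
    | exact Or.inr (Or.inr ⟨by linarith, by linarith, h₃⟩)

lemma gw_neg (hm : IsAdmissibleMultiplier 2 s m₁) (ξ : Rn 2) : gw m₁ N (-ξ) = gw m₁ N ξ :=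
  gw_congr hm (norm_neg ξ)

lemma mN_neg (hm : IsAdmissibleMultiplier 2 s m₁) (ξ : Rn 2) : mN m₁ N (-ξ) = mN m₁ N ξ :=
  mN_congr hm (norm_neg ξ)

lemma gw_le_pair (hs0 : 0 < s) (hs1 : s < 1) (hm : IsAdmissibleMultiplier 2 s m₁) (hN : 1 ≤ N)
    {σ : ℝ} (hσ : σ ≤ s) {ξ p q r : Rn 2} (hq : ‖q‖ ≤ ‖p‖) (hr : ‖r‖ ≤ ‖p‖)
    (hd : ‖p - ξ‖ ≤ ‖q‖ + ‖r‖) :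
    gw m₁ N ξ ≤ 192 * (jap q ^ (-σ) * jap r ^ (-σ) * (gw m₁ N p * gw m₁ N q * gw m₁ N r)) := by
  have h1 := gw_le_three hs0 hs1 hm hN (norm_le_three_of_sub hq hr hd)
  have h2 := half_le_rpow_mul_gw hs0 hs1 hm hN hσ q
  have h3 := half_le_rpow_mul_gw hs0 hs1 hm hN hσ r
  have h4 := gw_pos (N := N) hm p
  have h5 : 1 / 2 * (1 / 2) ≤ (jap q ^ (-σ) * gw m₁ N q) * (jap r ^ (-σ) * gw m₁ N r) := by
    gcongr
  calc gw m₁ N ξ ≤ 192 * (gw m₁ N p * (1 / 2 * (1 / 2))) := by linarith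
    _ ≤ 192 * (gw m₁ N p * ((jap q ^ (-σ) * gw m₁ N q) * (jap r ^ (-σ) * gw m₁ N r))) := by gcongr
    _ = _ := by ring

lemma gw_le_pairWeight (hs0 : 0 < s) (hs1 : s < 1) (hm : IsAdmissibleMultiplier 2 s m₁)
    (hN : 1 ≤ N) {σ : ℝ} (hσ : σ ≤ s) {ξ₁ ξ₂ ξ₃ ξ₄ : Rn 2} (h : ξ₄ = ξ₁ - ξ₂ + ξ₃) :
    gw m₁ N ξ₄ ≤ 192 * (pairWeight σ ξ₁ ξ₂ ξ₃ * (gw m₁ N ξ₁ * gw m₁ N ξ₂ * gw m₁ N ξ₃)) := by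
  have g₁ := gw_pos (N := N) hm ξ₁
  have g₂ := gw_pos (N := N) hm ξ₂
  have g₃ := gw_pos (N := N) hm ξ₃
  obtain ⟨w₁₂, w₁₃, w₂₃⟩ := le_pairWeight σ ξ₁ ξ₂ ξ₃
  rcases dominant_input h with ⟨h1, h2, h3⟩ | ⟨h1, h2, h3⟩ | ⟨h1, h2, h3⟩
  · refine (gw_le_pair hs0 hs1 hm hN hσ h1 h2 h3).trans ?_
    gcongr
  · rw [← gw_neg hm]
    refine (gw_le_pair hs0 hs1 hm hN hσ h1 h2 h3).trans ?_
    rw [mul_comm (gw m₁ N ξ₂)]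
    gcongr
  · refine (gw_le_pair hs0 hs1 hm hN hσ h1 h2 h3).trans ?_
    rw [mul_assoc (gw m₁ N ξ₃), mul_comm (gw m₁ N ξ₃)]
    gcongr

lemma exists_comm_pairWeight_le (hs0 : 0 < s) (hs1 : s < 1) (hm : IsAdmissibleMultiplier 2 s m₁)
    {κ : ℝ} (hκ : 0 ≤ κ) (hκs : 1 / 2 + κ ≤ s) :
    ∃ C : ℝ, 0 ≤ C ∧ ∀ N : ℝ, 1 ≤ N → ∀ ξ₁ ξ₂ ξ₃ ξ₄ : Rn 2, ξ₄ = ξ₁ - ξ₂ + ξ₃ →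
      (jap ξ₄)⁻¹ * |mN m₁ N ξ₄ - mN m₁ N ξ₁ * mN m₁ N ξ₂ * mN m₁ N ξ₃| ≤
        C * N ^ (-(3 / 2 - κ)) * (pairWeight (1 / 2 + κ) ξ₁ ξ₂ ξ₃ *
          (gw m₁ N ξ₁ * gw m₁ N ξ₂ * gw m₁ N ξ₃)) := by
  obtain ⟨C, hC0, hC⟩ := exists_comm_trilinear_le hs0 hs1 hm hκ hκs
  refine ⟨C, hC0, fun N hN ξ₁ ξ₂ ξ₃ ξ₄ h => ?_⟩
  have g₁ := gw_pos (N := N) hm ξ₁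
  have g₂ := gw_pos (N := N) hm ξ₂
  have g₃ := gw_pos (N := N) hm ξ₃
  have hj := jap_pos ξ₄
  have hX : 0 < N ^ (-(3 / 2 - κ)) := Real.rpow_pos_of_pos (by linarith) _
  obtain ⟨w₁₂, w₁₃, w₂₃⟩ := le_pairWeight (1 / 2 + κ) ξ₁ ξ₂ ξ₃
  rw [inv_mul_le_iff₀ hj]
  rcases dominant_input h with ⟨h1, h2, h3⟩ | ⟨h1, h2, h3⟩ | ⟨h1, h2, h3⟩
  · refine (hC N hN _ _ _ _ h1 h2 h3).trans ?_
    calc _ ≤ C * (N ^ (-(3 / 2 - κ)) * jap ξ₄ * (pairWeight (1 / 2 + κ) ξ₁ ξ₂ ξ₃ *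
            (gw m₁ N ξ₁ * gw m₁ N ξ₂ * gw m₁ N ξ₃))) := by gcongr
      _ = _ := by ring
  · have := hC N hN _ _ _ _ h1 h2 h3
    rw [mN_neg hm, jap_neg, mul_comm (mN m₁ N ξ₂), mul_comm (gw m₁ N ξ₂)] at this
    refine this.trans ?_
    calc _ ≤ C * (N ^ (-(3 / 2 - κ)) * jap ξ₄ * (pairWeight (1 / 2 + κ) ξ₁ ξ₂ ξ₃ *
            (gw m₁ N ξ₁ * gw m₁ N ξ₂ * gw m₁ N ξ₃))) := by gcongr
      _ = _ := by ring
  · have := hC N hN _ _ _ _ h1 h2 h3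
    rw [mul_assoc (gw m₁ N ξ₃), mul_comm (gw m₁ N ξ₃), mul_assoc (mN m₁ N ξ₃),
      mul_comm (mN m₁ N ξ₃)] at this
    refine this.trans ?_
    calc _ ≤ C * (N ^ (-(3 / 2 - κ)) * jap ξ₄ * (pairWeight (1 / 2 + κ) ξ₁ ξ₂ ξ₃ *
            (gw m₁ N ξ₁ * gw m₁ N ξ₂ * gw m₁ N ξ₃))) := by gcongr
      _ = _ := by ring

/-- The smaller of the Japanese brackets of `ξ` and `ξ + b`. -/
def minJap (b ξ : Rn 2) : ℝ := min (jap ξ) (jap (ξ + b))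

lemma minJap_pos (b ξ : Rn 2) : 0 < minJap b ξ := lt_min (jap_pos _) (jap_pos _)

lemma exists_comm_minJap_le (hs : 1 / 2 ≤ s) (hs1 : s < 1) (hm : IsAdmissibleMultiplier 2 s m₁) :
    ∃ C : ℝ, 0 ≤ C ∧ ∀ N : ℝ, 1 ≤ N → ∀ b ξ₃ ξ₄ : Rn 2, ‖ξ₄ - ξ₃‖ ≤ ‖b‖ →
      ‖ξ₄‖ ^ 2 * mN m₁ N ξ₄ *
          |mN m₁ N ξ₄ - mN m₁ N (ξ₄ + b) * mN m₁ N (ξ₃ + b) * mN m₁ N ξ₃| ≤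
        C * N ^ (-(1 / 2 : ℝ)) * (minJap b ξ₄ ^ (-(1 / 2 : ℝ)) * minJap b ξ₃ ^ (-(1 / 2 : ℝ)) *
          (gw m₁ N (ξ₄ + b) * gw m₁ N (ξ₃ + b) * gw m₁ N ξ₃ * gw m₁ N ξ₄)) := by
  obtain ⟨C, hC0, hC⟩ := exists_comm_quartic_le hs hs1 hm
  refine ⟨2 * C, by positivity, fun N hN b ξ₃ ξ₄ hab => ?_⟩
  set ξ₁ := ξ₄ + b with h₁
  set ξ₂ := ξ₃ + b with h₂
  have h : ξ₄ = ξ₁ - ξ₂ + ξ₃ := by rw [h₁, h₂]; abel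
  have g₁ := gw_pos (N := N) hm ξ₁
  have g₂ := gw_pos (N := N) hm ξ₂
  have g₃ := gw_pos (N := N) hm ξ₃
  have g₄ := gw_pos (N := N) hm ξ₄
  have hX : 0 < N ^ (-(1 / 2 : ℝ)) := Real.rpow_pos_of_pos (by linarith) _
  have s14 := minJap_pos b ξ₄
  have s23 := minJap_pos b ξ₃
  have s14' : minJap b ξ₄ ≤ jap ξ₁ := min_le_right _ _
  have s23' : minJap b ξ₃ ≤ jap ξ₂ := min_le_right _ _
  have s23'' : minJap b ξ₃ ≤ jap ξ₃ := min_le_left _ _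
  set G := gw m₁ N ξ₁ * gw m₁ N ξ₂ * gw m₁ N ξ₃ with hG
  have hG0 : 0 < G := by positivity
  set S := minJap b ξ₄ ^ (-(1 / 2 : ℝ)) * minJap b ξ₃ ^ (-(1 / 2 : ℝ))
  have hS0 : 0 < S := mul_pos (Real.rpow_pos_of_pos s14 _) (Real.rpow_pos_of_pos s23 _)
  have anti : ∀ {x y : ℝ}, 0 < x → x ≤ y → y ^ (-(1 / 2 : ℝ)) ≤ x ^ (-(1 / 2 : ℝ)) :=
    fun hx hxy => Real.rpow_le_rpow_of_nonpos hx hxy (by norm_num)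
  have anti3 : ∀ {x y : ℝ}, 0 < x → 0 < y → x ≤ 3 * y →
      y ^ (-(1 / 2 : ℝ)) ≤ 2 * x ^ (-(1 / 2 : ℝ)) := by
    intro x y hx hy hxy
    have h1 : y ^ (-(1 / 2 : ℝ)) ≤ (x / 4) ^ (-(1 / 2 : ℝ)) := anti (by positivity) (by linarith)
    rw [Real.div_rpow hx.le (by norm_num)] at h1
    have h2 : (4 : ℝ) ^ (-(1 / 2 : ℝ)) = 1 / 2 := by
      rw [show (4 : ℝ) = 2 ^ (2 : ℝ) by norm_num, ← Real.rpow_mul (by norm_num)]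
      norm_num [Real.rpow_neg_one]
    rw [h2] at h1; linarith
  have key : jap ξ₄ * |mN m₁ N ξ₄ - mN m₁ N ξ₁ * mN m₁ N ξ₂ * mN m₁ N ξ₃| ≤
      C * (N ^ (-(1 / 2 : ℝ)) * (2 * S * G)) := by
    rcases dominant_input h with ⟨h1, h2, h3⟩ | ⟨h1, h2, h3⟩ | ⟨h1, h2, h3⟩
    · refine (hC N hN _ _ _ _ h1 h2 h3).trans ?_
      rw [← hG]
      have e1 : ‖ξ₁‖ ≤ 3 * max ‖ξ₂‖ ‖ξ₃‖ := by
        have e2 : ‖ξ₁‖ ≤ ‖ξ₂‖ + ‖ξ₄ - ξ₃‖ := by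
          have : ξ₁ = ξ₂ + (ξ₄ - ξ₃) := by rw [h₁, h₂]; abel
          rw [this]; exact norm_add_le _ _
        have e3 : ‖b‖ ≤ ‖ξ₂‖ + ‖ξ₃‖ := by
          have : b = ξ₂ - ξ₃ := by rw [h₂]; abel
          rw [this]; exact norm_sub_le _ _
        linarith [le_max_left ‖ξ₂‖ ‖ξ₃‖, le_max_right ‖ξ₂‖ ‖ξ₃‖]
      have e4 : jap ξ₂ ^ (-(1 / 2 : ℝ)) * jap ξ₃ ^ (-(1 / 2 : ℝ)) ≤ 2 * S := by
        rcases le_total ‖ξ₂‖ ‖ξ₃‖ with h23 | h23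
        · rw [max_eq_right h23] at e1
          have e5 := anti3 s14 (jap_pos _) (s14'.trans (jap_le_three e1))
          have e6 := anti s23 s23'
          calc _ ≤ minJap b ξ₃ ^ (-(1 / 2 : ℝ)) * (2 * minJap b ξ₄ ^ (-(1 / 2 : ℝ))) :=
                mul_le_mul e6 e5 (jap_rpow_pos _ _).le (Real.rpow_pos_of_pos s23 _).le
            _ = 2 * S := by ring
        · rw [max_eq_left h23] at e1
          have e5 := anti3 s14 (jap_pos _) (s14'.trans (jap_le_three e1))
          have e6 := anti s23 s23''
          calc _ ≤ (2 * minJap b ξ₄ ^ (-(1 / 2 : ℝ))) * minJap b ξ₃ ^ (-(1 / 2 : ℝ)) :=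
                mul_le_mul e5 e6 (jap_rpow_pos _ _).le
                  (mul_pos two_pos (Real.rpow_pos_of_pos s14 _)).le
            _ = 2 * S := by ring
      gcongr
    · have := hC N hN _ _ _ _ h1 h2 h3
      rw [mN_neg hm, jap_neg, mul_comm (mN m₁ N ξ₂), mul_comm (gw m₁ N ξ₂), ← hG] at this
      refine this.trans ?_
      have e4 : jap ξ₁ ^ (-(1 / 2 : ℝ)) * jap ξ₃ ^ (-(1 / 2 : ℝ)) ≤ S :=
        mul_le_mul (anti s14 s14') (anti s23 s23'') (jap_rpow_pos _ _).le
          (Real.rpow_pos_of_pos s14 _).le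
      have e5 : S ≤ 2 * S := by linarith
      have e6 := e4.trans e5
      gcongr
    · have := hC N hN _ _ _ _ h1 h2 h3
      rw [mul_assoc (gw m₁ N ξ₃), mul_comm (gw m₁ N ξ₃), mul_assoc (mN m₁ N ξ₃),
        mul_comm (mN m₁ N ξ₃), ← hG] at this
      refine this.trans ?_
      have e4 : jap ξ₁ ^ (-(1 / 2 : ℝ)) * jap ξ₂ ^ (-(1 / 2 : ℝ)) ≤ S :=
        mul_le_mul (anti s14 s14') (anti s23 s23') (jap_rpow_pos _ _).le
          (Real.rpow_pos_of_pos s14 _).le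
      have e5 : S ≤ 2 * S := by linarith
      have e6 := e4.trans e5
      gcongr
  have m4 := mN_pos (N := N) hm ξ₄
  have n4 := norm_le_jap ξ₄
  calc _ ≤ jap ξ₄ ^ 2 * mN m₁ N ξ₄ *
          |mN m₁ N ξ₄ - mN m₁ N ξ₁ * mN m₁ N ξ₂ * mN m₁ N ξ₃| := by gcongr
    _ = gw m₁ N ξ₄ * (jap ξ₄ * |mN m₁ N ξ₄ - mN m₁ N ξ₁ * mN m₁ N ξ₂ * mN m₁ N ξ₃|) := by
        rw [gw]; ring
    _ ≤ gw m₁ N ξ₄ * (C * (N ^ (-(1 / 2 : ℝ)) * (2 * S * G))) := by gcongr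
    _ = _ := by ring

lemma comm_eq_zero (hm : IsAdmissibleMultiplier 2 s m₁) (hN : 1 ≤ N) {b ξ₃ ξ₄ : Rn 2}
    (h₁ : ‖ξ₄ + b‖ < N / 3) (h₂ : ‖ξ₃ + b‖ < N / 3) (h₃ : ‖ξ₃‖ < N / 3) (h₄ : ‖ξ₄‖ < N / 3) :
    mN m₁ N ξ₄ - mN m₁ N (ξ₄ + b) * mN m₁ N (ξ₃ + b) * mN m₁ N ξ₃ = 0 := by
  rw [mN_eq_one hm hN (ξ := ξ₄) (by linarith), mN_eq_one hm hN (ξ := ξ₄ + b) (by linarith),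
    mN_eq_one hm hN (ξ := ξ₃ + b) (by linarith), mN_eq_one hm hN (ξ := ξ₃) (by linarith)]
  ring

end Interaction

section Oscillation

/-- `f` is continuous on `[0,T]`, differentiable inside with integrable derivative, and
`|f(0)|` plus its total variation is at most `β`. -/
def VarLE (T : ℝ) (f : ℝ → ℂ) (β : ℝ) : Prop :=
  ContinuousOn f (Icc 0 T) ∧ ∃ f' : ℝ → ℂ, (∀ t ∈ Ioo 0 T, HasDerivAt f (f' t) t) ∧
    IntervalIntegrable f' volume 0 T ∧ ‖f 0‖ + ∫ t in (0 : ℝ)..T, ‖f' t‖ ≤ β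

variable {T : ℝ} {f h : ℝ → ℂ} {β γ : ℝ}

lemma VarLE.restrict (hf : VarLE T f β) {t : ℝ} (ht : t ∈ Icc 0 T) : VarLE t f β := by
  obtain ⟨hc, f', h1, h2, h3⟩ := hf
  refine ⟨hc.mono (Icc_subset_Icc_right ht.2), f', fun x hx => h1 x ⟨hx.1, hx.2.trans_le ht.2⟩,
    h2.mono_set (uIcc_subset_uIcc_left ?_), le_trans ?_ h3⟩
  · rw [uIcc_of_le (ht.1.trans ht.2)]; exact ht
  · gcongr 1
    exact intervalIntegral.integral_mono_interval le_rfl ht.1 ht.2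
      (Filter.Eventually.of_forall fun x => norm_nonneg _) h2.norm

lemma VarLE.norm_le (hf : VarLE T f β) {t : ℝ} (ht : t ∈ Icc 0 T) : ‖f t‖ ≤ β := by
  obtain ⟨hc, f', h1, h2, h3⟩ := hf.restrict ht
  have h4 := intervalIntegral.integral_eq_sub_of_hasDerivAt_of_le ht.1 hc h1 h2
  have h5 : f t = f 0 + ∫ x in (0 : ℝ)..t, f' x := by rw [h4]; ring
  rw [h5]
  exact (norm_add_le _ _).trans
    (le_trans (by gcongr; exact intervalIntegral.norm_integral_le_integral_norm ht.1) h3)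

lemma VarLE.nonneg (hT : 0 ≤ T) (hf : VarLE T f β) : 0 ≤ β :=
  (norm_nonneg _).trans (hf.norm_le ⟨le_rfl, hT⟩)

lemma VarLE.conj (hf : VarLE T f β) : VarLE T (fun t => (starRingEnd ℂ) (f t)) β := by
  obtain ⟨hc, f', h1, h2, h3⟩ := hf
  refine ⟨Complex.continuous_conj.comp_continuousOn hc, fun t => (starRingEnd ℂ) (f' t),
    fun t ht => ?_, ?_, ?_⟩
  · exact (Complex.conjCLE.toContinuousLinearMap.hasFDerivAt.comp_hasDerivAt t (h1 t ht))
  · exact ⟨(Complex.conjLIE.toContinuousLinearEquiv.toContinuousLinearMap).integrable_comp h2.1,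
      (Complex.conjLIE.toContinuousLinearEquiv.toContinuousLinearMap).integrable_comp h2.2⟩
  · simpa using h3

lemma VarLE.mul (hT : 0 ≤ T) (hf : VarLE T f β) (hh : VarLE T h γ) :
    VarLE T (fun t => f t * h t) (2 * (β * γ)) := by
  have hβ := hf.nonneg hT
  have hγ := hh.nonneg hT
  have nf : ∀ t ∈ Icc 0 T, ‖f t‖ ≤ β := fun t ht => hf.norm_le ht
  have nh : ∀ t ∈ Icc 0 T, ‖h t‖ ≤ γ := fun t ht => hh.norm_le ht
  obtain ⟨hc, f', h1, h2, h3⟩ := hf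
  obtain ⟨kc, h', k1, k2, k3⟩ := hh
  have hcu : ContinuousOn f (uIcc 0 T) := by rwa [uIcc_of_le hT]
  have kcu : ContinuousOn h (uIcc 0 T) := by rwa [uIcc_of_le hT]
  have i1 : IntervalIntegrable (fun t => f' t * h t) volume 0 T := h2.mul_continuousOn kcu
  have i2 : IntervalIntegrable (fun t => f t * h' t) volume 0 T := k2.continuousOn_mul hcu
  refine ⟨hc.mul kc, fun t => f' t * h t + f t * h' t, fun t ht => (h1 t ht).mul (k1 t ht),
    i1.add i2, ?_⟩
  have e1 : ∫ t in (0 : ℝ)..T, ‖f' t * h t + f t * h' t‖ ≤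
      ∫ t in (0 : ℝ)..T, (γ * ‖f' t‖ + β * ‖h' t‖) := by
    refine intervalIntegral.integral_mono_on hT (i1.add i2).norm
      ((h2.norm.const_mul _).add (k2.norm.const_mul _)) fun t ht => ?_
    refine (norm_add_le _ _).trans ?_
    rw [norm_mul, norm_mul, mul_comm]
    exact add_le_add (mul_le_mul_of_nonneg_right (nh t ht) (norm_nonneg _))
      (mul_le_mul_of_nonneg_right (nf t ht) (norm_nonneg _))
  rw [intervalIntegral.integral_add (h2.norm.const_mul _) (k2.norm.const_mul _),
    intervalIntegral.integral_const_mul, intervalIntegral.integral_const_mul] at e1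
  rw [norm_mul]
  have p1 : 0 ≤ ∫ t in (0 : ℝ)..T, ‖f' t‖ :=
    intervalIntegral.integral_nonneg hT fun t _ => norm_nonneg _
  have p2 : 0 ≤ ∫ t in (0 : ℝ)..T, ‖h' t‖ :=
    intervalIntegral.integral_nonneg hT fun t _ => norm_nonneg _
  have q1 : ‖f 0‖ * ‖h 0‖ ≤ ‖f 0‖ * γ :=
    mul_le_mul_of_nonneg_left (nh 0 ⟨le_rfl, hT⟩) (norm_nonneg _)
  have q2 : (‖f 0‖ + ∫ t in (0 : ℝ)..T, ‖f' t‖) * γ ≤ β * γ := mul_le_mul_of_nonneg_right h3 hγ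
  have q3 : β * (∫ t in (0 : ℝ)..T, ‖h' t‖) ≤ β * γ :=
    mul_le_mul_of_nonneg_left (by linarith [norm_nonneg (h 0)]) hβ
  nlinarith

lemma VarLE.integral_le_const (hT : 0 ≤ T) (hf : VarLE T f β) (ω : ℝ) :
    ‖∫ t in (0 : ℝ)..T, cexp (I * (ω * t : ℝ)) * f t‖ ≤ T * β := by
  have := intervalIntegral.norm_integral_le_of_norm_le_const (a := 0) (b := T) (C := β)
    (f := fun t => cexp (I * (ω * t : ℝ)) * f t) fun t ht => by
      rw [uIoc_of_le hT] at ht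
      rw [norm_mul, mul_comm I, Complex.norm_exp_ofReal_mul_I, one_mul]
      exact hf.norm_le ⟨ht.1.le, ht.2⟩
  rwa [sub_zero, abs_of_nonneg hT, mul_comm] at this

lemma VarLE.integral_le_div (hT : 0 ≤ T) (hf : VarLE T f β) {ω : ℝ} (hω : ω ≠ 0) :
    ‖∫ t in (0 : ℝ)..T, cexp (I * (ω * t : ℝ)) * f t‖ ≤ 2 * β / |ω| := by
  have nT := hf.norm_le ⟨hT, le_rfl⟩
  obtain ⟨hc, f', h1, h2, h3⟩ := hf
  have hI : I * (ω : ℂ) ≠ 0 := mul_ne_zero I_ne_zero (by exact_mod_cast hω)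
  have ne : ∀ t : ℝ, ‖cexp (I * (ω * t : ℝ))‖ = 1 := fun t => by
    rw [mul_comm I, Complex.norm_exp_ofReal_mul_I]
  have de : ∀ t : ℝ, HasDerivAt (fun t : ℝ => cexp (I * (ω * t : ℝ)))
      (I * ω * cexp (I * (ω * t : ℝ))) t := by
    intro t
    have e1 : HasDerivAt (fun t : ℝ => I * ((ω * t : ℝ) : ℂ)) (I * ω) t := by
      have := (((hasDerivAt_id t).const_mul ω).ofReal_comp).const_mul I
      simpa using this
    simpa [mul_comm] using e1.cexp
  have ce : Continuous fun t : ℝ => cexp (I * (ω * t : ℝ)) := by fun_prop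
  have i1 : IntervalIntegrable (fun t => cexp (I * (ω * t : ℝ)) * f t) volume 0 T :=
    (ce.continuousOn.mul (by rwa [uIcc_of_le hT])).intervalIntegrable
  have i2 : IntervalIntegrable (fun t => cexp (I * (ω * t : ℝ)) * f' t) volume 0 T :=
    h2.continuousOn_mul ce.continuousOn
  have i3 : IntervalIntegrable (fun t => I * ω * (cexp (I * (ω * t : ℝ)) * f t)) volume 0 T :=
    i1.const_mul _
  have key := intervalIntegral.integral_eq_sub_of_hasDerivAt_of_le hT
    (f := fun t => cexp (I * (ω * t : ℝ)) * f t)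
    (f' := fun t => I * ω * (cexp (I * (ω * t : ℝ)) * f t) + cexp (I * (ω * t : ℝ)) * f' t)
    (ce.continuousOn.mul hc)
    (fun t ht => by
      refine HasDerivAt.congr_deriv ((de t).mul (h1 t ht)) ?_
      ring) (i3.add i2)
  rw [intervalIntegral.integral_add i3 i2, intervalIntegral.integral_const_mul] at key
  have n1 : ‖∫ t in (0 : ℝ)..T, cexp (I * (ω * t : ℝ)) * f' t‖ ≤ ∫ t in (0 : ℝ)..T, ‖f' t‖ := by
    refine (intervalIntegral.norm_integral_le_integral_norm hT).trans (le_of_eq ?_)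
    congr 1; ext t; rw [norm_mul, ne, one_mul]
  have n2 : ‖I * (ω : ℂ)‖ = |ω| := by simp
  have n3 : |ω| * ‖∫ t in (0 : ℝ)..T, cexp (I * (ω * t : ℝ)) * f t‖ ≤ 2 * β := by
    rw [← n2, ← norm_mul, eq_sub_of_add_eq key]
    refine (norm_sub_le _ _).trans ((add_le_add (norm_sub_le _ _) n1).trans ?_)
    rw [norm_mul, norm_mul, ne, ne]
    linarith
  rwa [le_div_iff₀ (abs_pos.2 hω), mul_comm]

lemma VarLE.enorm_integral_le (hT : 0 ≤ T) (hf : VarLE T f β) (ω : ℝ) {θ : ℝ} (hθ : 0 < θ)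
    (hθ1 : θ < 1) : ‖∫ t in (0 : ℝ)..T, cexp (I * (ω * t : ℝ)) * f t‖ₑ ≤
      ENNReal.ofReal (2 * T ^ θ * β) * ‖ω‖ₑ ^ (θ - 1) := by
  have hβ := hf.nonneg hT
  rcases hT.eq_or_lt with rfl | hT'
  · simp
  rcases hβ.eq_or_lt with rfl | hβ'
  · have := hf.integral_le_const hT ω
    rw [mul_zero] at this
    rw [norm_le_zero_iff.1 this]; simp
  rcases eq_or_ne ω 0 with rfl | hω
  · rw [enorm_zero, ENNReal.zero_rpow_of_neg (by linarith), ENNReal.mul_top]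
    · exact le_top
    · have : 0 < T ^ θ := Real.rpow_pos_of_pos hT' _
      simpa using by positivity
  have hω' := abs_pos.2 hω
  rw [← ofReal_norm, ← ofReal_norm, Real.norm_eq_abs,
    ENNReal.ofReal_rpow_of_pos hω', ← ENNReal.ofReal_mul (by positivity)]
  apply ENNReal.ofReal_le_ofReal
  set J := ‖∫ t in (0 : ℝ)..T, cexp (I * (ω * t : ℝ)) * f t‖
  have hJ : 0 ≤ J := norm_nonneg _
  have j1 : J ≤ T * β := hf.integral_le_const hT ω
  have j2 : J ≤ 2 * β / |ω| := hf.integral_le_div hT hω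
  have j3 : J = J ^ θ * J ^ (1 - θ) := by
    rcases hJ.eq_or_lt with h0 | h0
    · rw [← h0, Real.zero_rpow hθ.ne', zero_mul]
    · rw [← Real.rpow_add h0]; simp
  have j4 : J ^ θ ≤ T ^ θ * β ^ θ := by
    rw [← Real.mul_rpow hT hβ]; exact Real.rpow_le_rpow hJ j1 hθ.le
  have j5 : J ^ (1 - θ) ≤ 2 * β ^ (1 - θ) * |ω| ^ (θ - 1) := by
    refine (Real.rpow_le_rpow hJ j2 (by linarith)).trans ?_
    rw [Real.div_rpow (by positivity) hω'.le, Real.mul_rpow two_pos.le hβ,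
      show θ - 1 = -(1 - θ) by ring, Real.rpow_neg hω'.le, div_eq_mul_inv]
    gcongr
    calc (2 : ℝ) ^ (1 - θ) ≤ 2 ^ (1 : ℝ) := Real.rpow_le_rpow_of_exponent_le (by norm_num)
          (by linarith)
      _ = 2 := by norm_num
  calc J = J ^ θ * J ^ (1 - θ) := j3
    _ ≤ (T ^ θ * β ^ θ) * (2 * β ^ (1 - θ) * |ω| ^ (θ - 1)) := by gcongr
    _ = 2 * T ^ θ * (β ^ θ * β ^ (1 - θ)) * |ω| ^ (θ - 1) := by ring
    _ = _ := by rw [← Real.rpow_add hβ']; simp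

end Oscillation

section OscillatoryFubini

variable {X : Type*} {T θ : ℝ} {M Ψ β : X → ℝ} {f : ℝ → X → ℂ}

/-- The oscillating integrand with amplitude `M f` and phase `Ψ`. -/
def oscTerm (M Ψ : X → ℝ) (f : ℝ → X → ℂ) (t : ℝ) (x : X) : ℂ :=
  (M x : ℂ) * (cexp (I * (Ψ x * t : ℝ)) * f t x)

lemma norm_oscTerm_le (hv : ∀ x, VarLE T (fun t => f t x) (β x)) {t : ℝ} (ht : t ∈ Icc 0 T)
    (x : X) : ‖oscTerm M Ψ f t x‖ ≤ |M x| * β x := by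
  rw [oscTerm, norm_mul, norm_mul, mul_comm I, Complex.norm_exp_ofReal_mul_I, one_mul,
    Complex.norm_real, Real.norm_eq_abs]
  exact mul_le_mul_of_nonneg_left ((hv x).norm_le ht) (abs_nonneg _)

variable [MeasurableSpace X] {μ : Measure X} [SFinite μ]

lemma measurable_oscTerm (hM : Measurable M) (hΨ : Measurable Ψ)
    (hf : Measurable fun p : ℝ × X => f p.1 p.2) :
    Measurable fun p : ℝ × X => oscTerm M Ψ f p.1 p.2 := by
  unfold oscTerm
  fun_prop

lemma integrable_oscTerm (hM : Measurable M) (hΨ : Measurable Ψ)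
    (hf : Measurable fun p : ℝ × X => f p.1 p.2)
    (hv : ∀ x, VarLE T (fun t => f t x) (β x)) (hi : Integrable (fun x => |M x| * β x) μ) :
    Integrable (fun p : ℝ × X => oscTerm M Ψ f p.1 p.2)
      ((volume.restrict (Ioc 0 T)).prod μ) := by
  refine Integrable.mono' (hi.comp_snd (volume.restrict (Ioc (0 : ℝ) T)))
    (measurable_oscTerm hM hΨ hf).aestronglyMeasurable ?_
  have h1 : ∀ᵐ p ∂((volume.restrict (Ioc (0 : ℝ) T)).prod μ), p.1 ∈ Ioc (0 : ℝ) T :=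
    Measure.quasiMeasurePreserving_fst.ae (ae_restrict_mem measurableSet_Ioc)
  filter_upwards [h1] with p hp
  exact norm_oscTerm_le hv ⟨hp.1.le, hp.2⟩ p.2

lemma enorm_integral_oscTerm_le (hT : 0 ≤ T) (hθ : 0 < θ) (hθ1 : θ < 1) (hM : Measurable M)
    (hΨ : Measurable Ψ) (hf : Measurable fun p : ℝ × X => f p.1 p.2)
    (hv : ∀ x, VarLE T (fun t => f t x) (β x)) (hi : Integrable (fun x => |M x| * β x) μ) :
    ‖∫ t in Ioc 0 T, ∫ x, oscTerm M Ψ f t x ∂μ‖ₑ ≤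
      ENNReal.ofReal (2 * T ^ θ) * ∫⁻ x, ENNReal.ofReal (|M x| * β x) * ‖Ψ x‖ₑ ^ (θ - 1) ∂μ := by
  rw [integral_integral_swap (integrable_oscTerm hM hΨ hf hv hi)]
  refine (enorm_integral_le_lintegral_enorm _).trans ?_
  rw [← lintegral_const_mul' _ _ ENNReal.ofReal_ne_top]
  refine lintegral_mono fun x => ?_
  have h1 : ∫ t in Ioc 0 T, oscTerm M Ψ f t x =
      (M x : ℂ) * ∫ t in (0 : ℝ)..T, cexp (I * (Ψ x * t : ℝ)) * f t x := by
    rw [intervalIntegral.integral_of_le hT, ← integral_const_mul]; rfl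
  rw [h1, enorm_mul]
  have hβ := (hv x).nonneg hT
  have hTθ : 0 ≤ T ^ θ := Real.rpow_nonneg hT θ
  have h2 : ‖(M x : ℂ)‖ₑ = ENNReal.ofReal |M x| := by
    rw [← ofReal_norm, Complex.norm_real, Real.norm_eq_abs]
  calc _ ≤ ENNReal.ofReal |M x| * (ENNReal.ofReal (2 * T ^ θ * β x) * ‖Ψ x‖ₑ ^ (θ - 1)) := by
        rw [h2]; gcongr; exact (hv x).enorm_integral_le hT _ hθ hθ1
    _ = _ := by
        rw [← mul_assoc, ← mul_assoc, ← ENNReal.ofReal_mul (abs_nonneg _),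
          ← ENNReal.ofReal_mul (by positivity)]
        congr 2; ring

lemma ennreal_mul_le_sq_add_sq (a b : ℝ≥0∞) : a * b ≤ a ^ 2 + b ^ 2 := by
  rcases le_total a b with h | h
  · exact (mul_le_mul' h le_rfl).trans (by rw [← sq]; exact le_add_self)
  · exact (mul_le_mul' le_rfl h).trans (by rw [← sq]; exact le_self_add)

lemma ennreal_mul_mul_le (a b c d : ℝ≥0∞) :
    a * b * (c * d) ≤ a ^ 2 * d ^ 2 + c ^ 2 * b ^ 2 := by
  calc a * b * (c * d) = (a * d) * (c * b) := by ring
    _ ≤ (a * d) ^ 2 + (c * b) ^ 2 := ennreal_mul_le_sq_add_sq _ _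
    _ = _ := by rw [mul_pow, mul_pow]

lemma lintegral_symmetric_kernel_le {w P : X → ℝ≥0∞} {K : X → X → ℝ≥0∞} (hw : Measurable w)
    (hP : Measurable P) (hK : Measurable fun p : X × X => K p.1 p.2)
    (hs : ∀ x y, K x y = K y x) {S : ℝ≥0∞} (hS : ∀ y, ∫⁻ x, w x ^ 2 * K x y ∂μ ≤ S) :
    ∫⁻ p, w p.1 * P p.1 * (w p.2 * P p.2) * K p.1 p.2 ∂(μ.prod μ) ≤ 2 * S * ∫⁻ x, P x ^ 2 ∂μ := by
  have hK1 : ∀ y, Measurable fun x => K x y := fun y => hK.comp (measurable_id.prodMk measurable_const)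
  have hK2 : ∀ x, Measurable fun y => K x y := fun x => hK.comp (measurable_const.prodMk measurable_id)
  have m1 : Measurable fun p : X × X => w p.1 ^ 2 * P p.2 ^ 2 * K p.1 p.2 := by fun_prop
  have m2 : Measurable fun p : X × X => w p.2 ^ 2 * P p.1 ^ 2 * K p.1 p.2 := by fun_prop
  have h1 : ∫⁻ p, w p.1 ^ 2 * P p.2 ^ 2 * K p.1 p.2 ∂(μ.prod μ) ≤ S * ∫⁻ x, P x ^ 2 ∂μ := by
    rw [lintegral_prod_symm _ m1.aemeasurable, ← lintegral_const_mul _ (hP.pow_const 2)]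
    refine lintegral_mono fun y => ?_
    calc ∫⁻ x, w x ^ 2 * P y ^ 2 * K x y ∂μ = ∫⁻ x, P y ^ 2 * (w x ^ 2 * K x y) ∂μ := by
          congr 1; ext x; ring
      _ = P y ^ 2 * ∫⁻ x, w x ^ 2 * K x y ∂μ :=
          lintegral_const_mul _ ((hw.pow_const 2).mul (hK1 y))
      _ ≤ P y ^ 2 * S := by gcongr; exact hS y
      _ = _ := mul_comm _ _
  have h2 : ∫⁻ p, w p.2 ^ 2 * P p.1 ^ 2 * K p.1 p.2 ∂(μ.prod μ) ≤ S * ∫⁻ x, P x ^ 2 ∂μ := by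
    rw [lintegral_prod _ m2.aemeasurable, ← lintegral_const_mul _ (hP.pow_const 2)]
    refine lintegral_mono fun y => ?_
    calc ∫⁻ x, w x ^ 2 * P y ^ 2 * K y x ∂μ = ∫⁻ x, P y ^ 2 * (w x ^ 2 * K x y) ∂μ := by
          congr 1; ext x; rw [hs y x]; ring
      _ = P y ^ 2 * ∫⁻ x, w x ^ 2 * K x y ∂μ :=
          lintegral_const_mul _ ((hw.pow_const 2).mul (hK1 y))
      _ ≤ P y ^ 2 * S := by gcongr; exact hS y
      _ = _ := mul_comm _ _
  calc _ ≤ ∫⁻ p, (w p.1 ^ 2 * P p.2 ^ 2 * K p.1 p.2 + w p.2 ^ 2 * P p.1 ^ 2 * K p.1 p.2)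
          ∂(μ.prod μ) := by
        refine lintegral_mono fun p => ?_
        rw [← add_mul]
        exact mul_le_mul' (ennreal_mul_mul_le _ _ _ _) le_rfl
    _ = _ := lintegral_add_left m1 _
    _ ≤ S * (∫⁻ x, P x ^ 2 ∂μ) + S * ∫⁻ x, P x ^ 2 ∂μ := add_le_add h1 h2
    _ = _ := by ring

lemma lintegral_sq_oscTerm_le (hT : 0 ≤ T) (hθ : 0 < θ) (hθ1 : θ < 1) (hM : Measurable M)
    (hΨ : Measurable Ψ) (hf : Measurable fun p : ℝ × X => f p.1 p.2)
    (hv : ∀ x, VarLE T (fun t => f t x) (β x)) (hi : Integrable (fun x => |M x| * β x) μ)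
    {w P : X → ℝ≥0∞} (hw : Measurable w) (hP : Measurable P)
    (hwP : ∀ x, ENNReal.ofReal (|M x| * β x) ≤ w x * P x) {S : ℝ≥0∞}
    (hS : ∀ τ : ℝ, ∫⁻ x, w x ^ 2 * ‖Ψ x - τ‖ₑ ^ (θ - 1) ∂μ ≤ S) :
    ∫⁻ t in Ioc 0 T, ‖∫ x, oscTerm M Ψ f t x ∂μ‖ₑ ^ 2 ≤
      ENNReal.ofReal (8 * T ^ θ) * S * ∫⁻ x, P x ^ 2 ∂μ := by
  have hTθ : 0 ≤ T ^ θ := Real.rpow_nonneg hT θ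
  have hβ0 : ∀ x, 0 ≤ β x := fun x => (hv x).nonneg hT
  set G : ℝ → ℂ := fun t => ∫ x, oscTerm M Ψ f t x ∂μ with hG
  set M₂ : X × X → ℝ := fun p => M p.1 * M p.2
  set Ψ₂ : X × X → ℝ := fun p => Ψ p.1 - Ψ p.2
  set β₂ : X × X → ℝ := fun p => 2 * (β p.1 * β p.2)
  set f₂ : ℝ → X × X → ℂ := fun t p => f t p.1 * (starRingEnd ℂ) (f t p.2)
  have hosc : ∀ t, ∫ p, oscTerm M₂ Ψ₂ f₂ t p ∂(μ.prod μ) = G t * (starRingEnd ℂ) (G t) := by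
    intro t
    rw [hG]
    simp only
    rw [← integral_conj, ← integral_prod_mul]
    congr 1; ext p
    simp only [oscTerm, M₂, Ψ₂, f₂, map_mul, Complex.conj_ofReal, ← Complex.exp_conj, Complex.conj_I]
    have : cexp (I * ((Ψ p.1 - Ψ p.2) * t : ℝ)) =
        cexp (I * (Ψ p.1 * t : ℝ)) * cexp (-I * (Ψ p.2 * t : ℝ)) := by
      rw [← Complex.exp_add]; congr 1; push_cast; ring
    rw [this]; push_cast; ring
  have hf1 : Measurable fun p : ℝ × (X × X) => f p.1 p.2.1 :=
    hf.comp (measurable_fst.prodMk (measurable_fst.comp measurable_snd))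
  have hf2 : Measurable fun p : ℝ × (X × X) => f p.1 p.2.2 :=
    hf.comp (measurable_fst.prodMk (measurable_snd.comp measurable_snd))
  have hmain := enorm_integral_oscTerm_le (μ := μ.prod μ) (M := M₂) (Ψ := Ψ₂) (f := f₂) (β := β₂)
    hT hθ hθ1 (by fun_prop) (by fun_prop)
    (hf1.mul (Complex.continuous_conj.measurable.comp hf2))
    (fun p => (hv p.1).mul hT (hv p.2).conj) (by
      have := (hi.mul_prod hi).const_mul 2
      refine this.congr (Filter.Eventually.of_forall fun p => ?_)
      simp only [M₂, β₂, abs_mul]; ring)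
  have hGm : AEStronglyMeasurable G (volume.restrict (Ioc 0 T)) :=
    (integrable_oscTerm hM hΨ hf hv hi).aestronglyMeasurable.integral_prod_right'
  have hGb : ∀ t ∈ Ioc 0 T, ‖G t‖ ≤ ∫ x, |M x| * β x ∂μ := fun t ht =>
    norm_integral_le_of_norm_le hi
      (Filter.Eventually.of_forall fun x => norm_oscTerm_le hv ⟨ht.1.le, ht.2⟩ x)
  have hGi : Integrable (fun t => ‖G t‖ ^ 2) (volume.restrict (Ioc 0 T)) := by
    refine Integrable.mono' (integrable_const ((∫ x, |M x| * β x ∂μ) ^ 2))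
      (hGm.norm.pow 2) ?_
    filter_upwards [ae_restrict_mem measurableSet_Ioc] with t ht
    rw [norm_pow, norm_norm]
    exact pow_le_pow_left₀ (norm_nonneg _) (hGb t ht) 2
  have hleft : ∫⁻ t in Ioc 0 T, ‖G t‖ₑ ^ 2 =
      ‖∫ t in Ioc 0 T, ∫ p, oscTerm M₂ Ψ₂ f₂ t p ∂(μ.prod μ)‖ₑ := by
    simp_rw [hosc, Complex.mul_conj, Complex.normSq_eq_norm_sq]
    rw [integral_complex_ofReal, ← ofReal_norm, Complex.norm_real, Real.norm_of_nonneg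
      (integral_nonneg fun t => by positivity), ofReal_integral_eq_lintegral_ofReal hGi
      (Filter.Eventually.of_forall fun t => by positivity)]
    congr 1; ext t
    rw [ENNReal.ofReal_pow (norm_nonneg _), ofReal_norm]
  rw [hleft]
  refine hmain.trans ?_
  have hK : Measurable fun p : X × X => ‖Ψ p.1 - Ψ p.2‖ₑ ^ (θ - 1) :=
    (measurable_enorm_rpow (θ - 1)).comp ((hΨ.comp measurable_fst).sub (hΨ.comp measurable_snd))
  have hsym := lintegral_symmetric_kernel_le (μ := μ) (K := fun x y => ‖Ψ x - Ψ y‖ₑ ^ (θ - 1))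
    hw hP hK (fun x y => by rw [enorm_sub_rev]) (fun y => hS (Ψ y))
  calc _ ≤ ENNReal.ofReal (2 * T ^ θ) * ∫⁻ p, 2 * (w p.1 * P p.1 * (w p.2 * P p.2) *
          ‖Ψ p.1 - Ψ p.2‖ₑ ^ (θ - 1)) ∂(μ.prod μ) := by
        refine mul_le_mul' le_rfl (lintegral_mono fun p => ?_)
        have : |M₂ p| * β₂ p = 2 * ((|M p.1| * β p.1) * (|M p.2| * β p.2)) := by
          simp only [M₂, β₂, abs_mul]; ring
        rw [this, ← two_mul_ofReal, ENNReal.ofReal_mul (mul_nonneg (abs_nonneg _) (hβ0 _)),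
          mul_assoc]
        exact mul_le_mul' le_rfl (mul_le_mul' (mul_le_mul' (hwP _) (hwP _)) le_rfl)
    _ = ENNReal.ofReal (2 * T ^ θ) * (2 * ∫⁻ p, w p.1 * P p.1 * (w p.2 * P p.2) *
          ‖Ψ p.1 - Ψ p.2‖ₑ ^ (θ - 1) ∂(μ.prod μ)) := by
        rw [lintegral_const_mul' _ _ (by norm_num)]
    _ ≤ ENNReal.ofReal (2 * T ^ θ) * (2 * (2 * S * ∫⁻ x, P x ^ 2 ∂μ)) := by gcongr
    _ = (2 * (2 * ENNReal.ofReal (2 * T ^ θ))) * S * ∫⁻ x, P x ^ 2 ∂μ := by ring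
    _ = _ := by rw [two_mul_ofReal, two_mul_ofReal]; congr 3; ring

end OscillatoryFubini

section Trilinear

/-- The free Schrödinger symbol. -/
def lam (ξ : Rn 2) : ℝ := 4 * Real.pi ^ 2 * ‖ξ‖ ^ 2

lemma continuous_lam : Continuous lam := by unfold lam; fun_prop

lemma lam_nonneg (ξ : Rn 2) : 0 ≤ lam ξ := by unfold lam; positivity

/-- The third input frequency of the interaction with output `ξ` and first two inputs `x`. -/
def third (ξ : Rn 2) (x : Rn 2 × Rn 2) : Rn 2 := ξ - x.1 + x.2

@[fun_prop]
lemma continuous_third (ξ : Rn 2) : Continuous (third ξ) := by unfold third; fun_prop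

/-- The phase of the trilinear interaction. -/
def triPhase (ξ : Rn 2) (x : Rn 2 × Rn 2) : ℝ := -(lam x.1 - lam x.2 + lam (third ξ x))

lemma measurable_triPhase (ξ : Rn 2) : Measurable (triPhase ξ) := by
  have := continuous_lam
  unfold triPhase
  exact (by fun_prop : Continuous _).measurable

lemma lintegral_reflect (ξ : Rn 2) {F : Rn 2 × Rn 2 → ℝ≥0∞} (hF : Measurable F) :
    ∫⁻ x, F (third ξ x, x.2) = ∫⁻ x, F x := by
  have h1 : Measurable fun x : Rn 2 × Rn 2 => F (third ξ x, x.2) :=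
    hF.comp ((continuous_third ξ).prodMk continuous_snd).measurable
  rw [Measure.volume_eq_prod, lintegral_prod_symm _ h1.aemeasurable,
    lintegral_prod_symm _ hF.aemeasurable]
  congr 1; ext y
  rw [← lintegral_sub_left_eq_self (fun x => F (x, y)) (ξ + y)]
  congr 1; ext x
  simp only [third]
  congr 2; abel

lemma enorm_neg_mul_rpow_le {θ : ℝ} (hθ1 : θ < 1) (x : ℝ) :
    ‖-(8 * Real.pi ^ 2) * x‖ₑ ^ (θ - 1) ≤ ‖x‖ₑ ^ (θ - 1) := by
  refine ennreal_rpow_anti ?_ (by linarith)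
  rw [enorm_mul]
  refine le_mul_of_one_le_left' ?_
  rw [← ofReal_norm, ← ENNReal.ofReal_one]
  apply ENNReal.ofReal_le_ofReal
  rw [norm_neg, Real.norm_of_nonneg (by positivity)]
  nlinarith [Real.pi_gt_three]

lemma ofReal_pairWeight_sq_le (κ : ℝ) (ξ₁ ξ₂ ξ₃ : Rn 2) :
    ENNReal.ofReal (pairWeight (1 / 2 + κ) ξ₁ ξ₂ ξ₃) ^ 2 ≤
      3 * (ENNReal.ofReal (jap ξ₁ ^ (-(1 + 2 * κ))) * ENNReal.ofReal (jap ξ₂ ^ (-(1 + 2 * κ))) +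
        ENNReal.ofReal (jap ξ₁ ^ (-(1 + 2 * κ))) * ENNReal.ofReal (jap ξ₃ ^ (-(1 + 2 * κ))) +
        ENNReal.ofReal (jap ξ₃ ^ (-(1 + 2 * κ))) * ENNReal.ofReal (jap ξ₂ ^ (-(1 + 2 * κ)))) := by
  have h1 := (jap_rpow_pos ξ₁ (-(1 + 2 * κ))).le
  have h2 := (jap_rpow_pos ξ₂ (-(1 + 2 * κ))).le
  have h3 := (jap_rpow_pos ξ₃ (-(1 + 2 * κ))).le
  have e : ∀ η : Rn 2, jap η ^ (-(1 + 2 * κ)) = (jap η ^ (-(1 / 2 + κ))) ^ 2 := fun η => by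
    rw [← Real.rpow_natCast, ← Real.rpow_mul (jap_pos η).le]; congr 1; push_cast; ring
  rw [← ENNReal.ofReal_pow (pairWeight_pos _ _ _ _).le, ← ENNReal.ofReal_mul h1,
    ← ENNReal.ofReal_mul h1, ← ENNReal.ofReal_mul h3, ← ENNReal.ofReal_add (by positivity)
    (by positivity), ← ENNReal.ofReal_add (by positivity) (by positivity),
    show (3 : ℝ≥0∞) = ENNReal.ofReal 3 by simp, ← ENNReal.ofReal_mul (by norm_num)]
  apply ENNReal.ofReal_le_ofReal
  rw [e, e, e, pairWeight]
  set a := jap ξ₁ ^ (-(1 / 2 + κ))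
  set b := jap ξ₂ ^ (-(1 / 2 + κ))
  set c := jap ξ₃ ^ (-(1 / 2 + κ))
  nlinarith [sq_nonneg (a * b - a * c), sq_nonneg (a * b - b * c), sq_nonneg (a * c - b * c)]

lemma exists_lintegral_pairWeight_le {θ κ : ℝ} (hθ : 0 < θ) (hθκ : θ < κ) (hκ : κ < 1) :
    ∃ C : ℝ≥0, ∀ (ξ : Rn 2) (τ : ℝ),
      ∫⁻ x : Rn 2 × Rn 2, ENNReal.ofReal (pairWeight (1 / 2 + κ) x.1 x.2 (third ξ x)) ^ 2 *
        ‖triPhase ξ x - τ‖ₑ ^ (θ - 1) ≤ C := by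
  obtain ⟨C, hC⟩ := exists_lintegral_jap_jap_kernel_le hθ hθκ hκ
  refine ⟨9 * C, fun ξ τ => ?_⟩
  set J : Rn 2 → ℝ≥0∞ := fun η => ENNReal.ofReal (jap η ^ (-(1 + 2 * κ))) with hJ
  have mJ : Measurable J := measurable_jap_rpow _
  have mK : Measurable fun x => ‖triPhase ξ x - τ‖ₑ ^ (θ - 1) :=
    (measurable_enorm_rpow _).comp ((measurable_triPhase ξ).sub_const τ)
  have m3 : Measurable fun x => J (third ξ x) := mJ.comp (continuous_third ξ).measurable
  have m1 : Measurable fun x : Rn 2 × Rn 2 => J x.1 := mJ.comp measurable_fst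
  have m2 : Measurable fun x : Rn 2 × Rn 2 => J x.2 := mJ.comp measurable_snd
  have m12 : Measurable fun x : Rn 2 × Rn 2 => J x.1 * J x.2 * ‖triPhase ξ x - τ‖ₑ ^ (θ - 1) :=
    (m1.mul m2).mul mK
  have m13 : Measurable fun x : Rn 2 × Rn 2 => J x.1 * J (third ξ x) * ‖triPhase ξ x - τ‖ₑ ^ (θ - 1) :=
    (m1.mul m3).mul mK
  have m32 : Measurable fun x : Rn 2 × Rn 2 => J (third ξ x) * J x.2 * ‖triPhase ξ x - τ‖ₑ ^ (θ - 1) :=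
    (m3.mul m2).mul mK
  have i12 : ∫⁻ x : Rn 2 × Rn 2, J x.1 * J x.2 * ‖triPhase ξ x - τ‖ₑ ^ (θ - 1) ≤ C := by
    rw [Measure.volume_eq_prod, lintegral_prod _ m12.aemeasurable]
    refine le_trans (lintegral_mono fun η => lintegral_mono fun ζ => ?_)
      (hC ξ fun η => (‖η‖ ^ 2 + ‖ξ - η‖ ^ 2 + τ / (4 * Real.pi ^ 2)) / 2)
    refine mul_le_mul' le_rfl (le_trans (le_of_eq ?_) (enorm_neg_mul_rpow_le (by linarith) _))
    congr 2
    simp only [triPhase, lam, third]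
    rw [@norm_add_sq_real]
    have := Real.pi_pos
    field_simp; ring
  have i13 : ∫⁻ x : Rn 2 × Rn 2, J x.1 * J (third ξ x) * ‖triPhase ξ x - τ‖ₑ ^ (θ - 1) ≤ C := by
    rw [Measure.volume_eq_prod, lintegral_prod _ m13.aemeasurable]
    refine le_trans (lintegral_mono fun η => ?_)
      (hC ξ fun η => (‖η‖ ^ 2 - ‖η - ξ‖ ^ 2 + τ / (4 * Real.pi ^ 2)) / 2)
    rw [← lintegral_add_right_eq_self _ (η - ξ)]
    refine lintegral_mono fun ζ => ?_
    have e : third ξ (η, ζ + (η - ξ)) = ζ := by simp only [third]; abel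
    simp only [e]
    refine mul_le_mul' le_rfl (le_trans (le_of_eq ?_) (enorm_neg_mul_rpow_le (by linarith) _))
    congr 2
    simp only [triPhase, lam, e]
    rw [@norm_add_sq_real, ← neg_sub ξ η, inner_neg_right, norm_neg, real_inner_comm]
    have := Real.pi_pos
    field_simp; ring
  have i32 : ∫⁻ x : Rn 2 × Rn 2, J (third ξ x) * J x.2 * ‖triPhase ξ x - τ‖ₑ ^ (θ - 1) ≤ C := by
    refine le_trans (le_of_eq ?_) i12
    rw [← lintegral_reflect ξ m12]
    congr 1; ext x
    have e : third ξ (third ξ x, x.2) = x.1 := by simp only [third]; abel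
    simp only [triPhase, e]
    congr 3; ring
  calc _ ≤ ∫⁻ x : Rn 2 × Rn 2, 3 * (J x.1 * J x.2 * ‖triPhase ξ x - τ‖ₑ ^ (θ - 1) +
          J x.1 * J (third ξ x) * ‖triPhase ξ x - τ‖ₑ ^ (θ - 1) +
          J (third ξ x) * J x.2 * ‖triPhase ξ x - τ‖ₑ ^ (θ - 1)) := by
        refine lintegral_mono fun x => ?_
        rw [← add_mul, ← add_mul, ← mul_assoc]
        exact mul_le_mul' (ofReal_pairWeight_sq_le κ _ _ _) le_rfl
    _ ≤ 3 * (C + C + C) := by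
        rw [lintegral_const_mul' _ _ (by norm_num), lintegral_add_right _ m32,
          lintegral_add_right _ m13]
        gcongr
    _ = _ := by push_cast; ring

lemma lintegral_third_pow {p : Rn 2 → ℝ≥0∞} (hp : Measurable p) :
    ∫⁻ ξ, ∫⁻ x : Rn 2 × Rn 2, p x.1 * p x.2 * p (third ξ x) = (∫⁻ ξ, p ξ) ^ 3 := by
  have hc : Continuous fun z : Rn 2 × (Rn 2 × Rn 2) => third z.1 z.2 := by unfold third; fun_prop
  have hm : Measurable fun z : Rn 2 × (Rn 2 × Rn 2) => p z.2.1 * p z.2.2 * p (third z.1 z.2) := by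
    have := hp.comp hc.measurable
    simp only [Function.comp_def] at this
    fun_prop
  rw [lintegral_lintegral_swap hm.aemeasurable]
  have h1 : ∀ x : Rn 2 × Rn 2, ∫⁻ ξ, p x.1 * p x.2 * p (third ξ x) =
      p x.1 * p x.2 * ∫⁻ ξ, p ξ := by
    intro x
    have h2 : (fun ξ => third ξ x) = fun ξ => ξ + (x.2 - x.1) := by ext1 ξ; simp only [third]; abel
    have h3 : Measurable fun ξ => p (third ξ x) :=
      hp.comp (by unfold third; fun_prop)
    have h4 : ∫⁻ ξ, p (third ξ x) = ∫⁻ ξ, p ξ := by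
      simp only [congrFun h2]
      exact lintegral_add_right_eq_self _ _
    rw [← h4]
    exact lintegral_const_mul _ h3
  simp_rw [h1]
  have h5 : Measurable fun x : Rn 2 × Rn 2 => p x.1 * p x.2 := by fun_prop
  rw [lintegral_mul_const _ h5, Measure.volume_eq_prod, lintegral_prod _ h5.aemeasurable]
  simp only [lintegral_const_mul _ hp]
  rw [lintegral_mul_const _ hp]; ring

end Trilinear

section Quartic

/-- The parallelogram with vertices `η, η + b, ζ, ζ + b` has its short side `η - ζ`, and reaches
frequencies of size `N / 3`. -/
def Active (N : ℝ) (b η ζ : Rn 2) : Prop :=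
  ‖η - ζ‖ ≤ ‖b‖ ∧ (N / 3 ≤ ‖η‖ ∨ N / 3 ≤ ‖η + b‖ ∨ N / 3 ≤ ‖ζ‖ ∨ N / 3 ≤ ‖ζ + b‖)

lemma Active.symm {N : ℝ} {b η ζ : Rn 2} (h : Active N b η ζ) : Active N b ζ η := by
  obtain ⟨h1, h2⟩ := h
  refine ⟨by rwa [norm_sub_rev], by tauto⟩

lemma isClosed_active (N : ℝ) : IsClosed {z : Rn 2 × Rn 2 × Rn 2 | Active N z.1 z.2.1 z.2.2} := by
  have h0 : IsClosed {z : Rn 2 × Rn 2 × Rn 2 | ‖z.2.1 - z.2.2‖ ≤ ‖z.1‖} :=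
    isClosed_le (by fun_prop) (by fun_prop)
  have h1 : IsClosed {z : Rn 2 × Rn 2 × Rn 2 | N / 3 ≤ ‖z.2.1‖} :=
    isClosed_le (by fun_prop) (by fun_prop)
  have h2 : IsClosed {z : Rn 2 × Rn 2 × Rn 2 | N / 3 ≤ ‖z.2.1 + z.1‖} :=
    isClosed_le (by fun_prop) (by fun_prop)
  have h3 : IsClosed {z : Rn 2 × Rn 2 × Rn 2 | N / 3 ≤ ‖z.2.2‖} :=
    isClosed_le (by fun_prop) (by fun_prop)
  have h4 : IsClosed {z : Rn 2 × Rn 2 × Rn 2 | N / 3 ≤ ‖z.2.2 + z.1‖} :=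
    isClosed_le (by fun_prop) (by fun_prop)
  exact h0.inter (h1.union (h2.union (h3.union h4)))

open Classical in
/-- The resonance kernel restricted to active parallelograms. -/
@[irreducible]
def actKernel (θ N : ℝ) (b η ζ : Rn 2) : ℝ≥0∞ :=
  if Active N b η ζ then ‖⟪b, η - ζ⟫‖ₑ ^ (θ - 1) else 0

lemma actKernel_symm (θ N : ℝ) (b η ζ : Rn 2) : actKernel θ N b η ζ = actKernel θ N b ζ η := by
  unfold actKernel
  rw [show Active N b η ζ ↔ Active N b ζ η from ⟨Active.symm, Active.symm⟩, ← neg_sub ζ η,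
    inner_neg_right, enorm_neg]

lemma measurable_actKernel (θ N : ℝ) :
    Measurable fun z : Rn 2 × Rn 2 × Rn 2 => actKernel θ N z.1 z.2.1 z.2.2 := by
  unfold actKernel
  refine Measurable.ite (isClosed_active N).measurableSet ?_ measurable_const
  refine (measurable_enorm_rpow (θ - 1)).comp (Continuous.measurable ?_)
  fun_prop

lemma measurable_actKernel_slice (θ N : ℝ) (b : Rn 2) :
    Measurable fun p : Rn 2 × Rn 2 => actKernel θ N b p.1 p.2 := by
  have h : Measurable fun p : Rn 2 × Rn 2 => (b, p) := measurable_const.prodMk measurable_id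
  exact Measurable.comp (g := fun z : Rn 2 × Rn 2 × Rn 2 => actKernel θ N z.1 z.2.1 z.2.2)
    (measurable_actKernel θ N) h

lemma minJap_inv_le (b ξ : Rn 2) : (minJap b ξ)⁻¹ ≤ (jap ξ)⁻¹ + (jap (ξ + b))⁻¹ := by
  have h1 := inv_pos.2 (jap_pos ξ)
  have h2 := inv_pos.2 (jap_pos (ξ + b))
  rcases min_choice (jap ξ) (jap (ξ + b)) with h | h <;> rw [minJap, h] <;> linarith

lemma exists_lintegral_minJap_kernel_le {θ : ℝ} (hθ : 0 < θ) (hθ3 : θ < 1 / 3) :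
    ∃ C : ℝ, 0 ≤ C ∧ ∀ N : ℝ, 1 ≤ N → ∀ b η : Rn 2,
      ∫⁻ ζ, ENNReal.ofReal (minJap b ζ)⁻¹ * actKernel θ N b η ζ ≤
        ENNReal.ofReal (C * N ^ (-(1 - 3 * θ))) := by
  have hθ1 : θ < 1 := by linarith
  refine ⟨6400 / θ ^ 2 + 64 / θ, by positivity, fun N hN b η => ?_⟩
  have hN0 : 0 < N := by linarith
  have hX : 0 < N ^ (-(1 - 3 * θ)) := Real.rpow_pos_of_pos hN0 _
  rw [← lintegral_sub_left_eq_self _ η]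
  have e0 : ∀ a : Rn 2, η - (η - a) = a := fun a => by abel
  by_cases hb : b = 0
  · subst hb
    have : ∀ᵐ a : Rn 2, a ≠ 0 := by
      simp [ae_iff]
    rw [lintegral_congr_ae (g := fun _ => 0)]
    · simp
    · filter_upwards [this] with a ha
      have : ¬ Active N 0 η (η - a) := fun h => ha (by simpa [e0] using h.1)
      simp [actKernel, this]
  set D : Set (Rn 2) := {a | ‖a‖ ≤ ‖b‖} with hD
  have hDm : MeasurableSet D := (isClosed_le continuous_norm continuous_const).measurableSet
  have hbp := norm_pos_iff.2 hb
  have mK : Measurable fun a : Rn 2 => ‖⟪b, a⟫‖ₑ ^ (θ - 1) := by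
    simpa using measurable_kernel b 0 (θ - 1)
  rcases le_or_gt (N / 100) ‖b‖ with hbN | hbN
  · have hpt : ∀ a, ENNReal.ofReal (minJap b (η - a))⁻¹ * actKernel θ N b η (η - a) ≤
        D.indicator (fun a => ENNReal.ofReal (jap (η - a))⁻¹ * ‖⟪b, a⟫‖ₑ ^ (θ - 1) +
          ENNReal.ofReal (jap (η + b - a))⁻¹ * ‖⟪b, a⟫‖ₑ ^ (θ - 1)) a := by
      intro a
      by_cases h : Active N b η (η - a)
      · have ha : a ∈ D := by have := h.1; rw [e0] at this; exact this
        rw [indicator_of_mem ha, actKernel, if_pos h, e0, ← add_mul,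
          ← ENNReal.ofReal_add (inv_pos.2 (jap_pos _)).le (inv_pos.2 (jap_pos _)).le]
        gcongr
        have := minJap_inv_le b (η - a)
        rwa [show η - a + b = η + b - a by abel] at this
      · simp [actKernel, h]
    have m1 : Measurable fun a => ENNReal.ofReal (jap (η - a))⁻¹ * ‖⟪b, a⟫‖ₑ ^ (θ - 1) := by
      refine Measurable.mul ?_ mK
      have := continuous_jap.measurable
      fun_prop
    refine (lintegral_mono hpt).trans ?_
    rw [lintegral_indicator hDm, lintegral_add_left m1]
    refine (add_le_add (lintegral_ball_jap_inv_kernel_le hθ hθ1 hb η)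
      (lintegral_ball_jap_inv_kernel_le hθ hθ1 hb (η + b))).trans ?_
    rw [← ENNReal.ofReal_add (by positivity) (by positivity)]
    apply ENNReal.ofReal_le_ofReal
    have h1 : ‖b‖ ^ (3 * θ - 1) ≤ 100 * N ^ (-(1 - 3 * θ)) := by
      calc ‖b‖ ^ (3 * θ - 1) ≤ (N / 100) ^ (3 * θ - 1) :=
            Real.rpow_le_rpow_of_nonpos (by positivity) hbN (by linarith)
        _ = (100 : ℝ) ^ (1 - 3 * θ) * N ^ (3 * θ - 1) := by
            rw [Real.div_rpow hN0.le (by norm_num), show 1 - 3 * θ = -(3 * θ - 1) by ring,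
              Real.rpow_neg (by norm_num), div_eq_inv_mul]
        _ ≤ (100 : ℝ) ^ (1 : ℝ) * N ^ (3 * θ - 1) := by
            gcongr
            · norm_num
            · linarith
        _ = _ := by rw [Real.rpow_one]; congr 2; ring
    calc _ = 64 / θ ^ 2 * ‖b‖ ^ (3 * θ - 1) := by ring
      _ ≤ 64 / θ ^ 2 * (100 * N ^ (-(1 - 3 * θ))) := by gcongr
      _ = (6400 / θ ^ 2 + 0) * N ^ (-(1 - 3 * θ)) := by ring
      _ ≤ _ := by gcongr; positivity
  · have hpt : ∀ a, ENNReal.ofReal (minJap b (η - a))⁻¹ * actKernel θ N b η (η - a) ≤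
        D.indicator (fun a => ENNReal.ofReal (4 / N) * ‖⟪b, a⟫‖ₑ ^ (θ - 1)) a := by
      intro a
      by_cases h : Active N b η (η - a)
      · have ha : a ∈ D := by have := h.1; rw [e0] at this; exact this
        rw [indicator_of_mem ha, actKernel, if_pos h, e0]
        gcongr
        have ha' : ‖a‖ ≤ ‖b‖ := ha
        have key : N / 4 ≤ minJap b (η - a) := by
          have t1 : ‖η‖ ≤ ‖η - a‖ + ‖a‖ := by simpa using norm_add_le (η - a) a
          have t2 : ‖η + b‖ ≤ ‖η - a‖ + ‖a‖ + ‖b‖ := (norm_add_le _ _).trans (by linarith)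
          have t3 : ‖η - a + b‖ ≤ ‖η - a‖ + ‖b‖ := norm_add_le _ _
          have t4 : ‖η - a‖ ≤ ‖η - a + b‖ + ‖b‖ := by simpa using norm_sub_le (η - a + b) b
          have t5 : N / 4 ≤ ‖η - a‖ ∧ N / 4 ≤ ‖η - a + b‖ := by
            rcases h.2 with h | h | h | h <;> constructor <;> linarith
          exact le_min (t5.1.trans (norm_le_jap _)) (t5.2.trans (norm_le_jap _))
        calc (minJap b (η - a))⁻¹ ≤ (N / 4)⁻¹ := inv_anti₀ (by positivity) key
          _ = 4 / N := by rw [inv_div]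
      · simp [actKernel, h]
    refine (lintegral_mono hpt).trans ?_
    rw [lintegral_indicator hDm, lintegral_const_mul _ mK]
    refine (mul_le_mul' le_rfl (lintegral_ball_kernel_le' hθ hθ1 hb)).trans ?_
    rw [← ENNReal.ofReal_mul (by positivity)]
    apply ENNReal.ofReal_le_ofReal
    have h1 : ‖b‖ ^ (2 * θ) ≤ N ^ (3 * θ) :=
      (Real.rpow_le_rpow hbp.le (by linarith) (by linarith)).trans
        (Real.rpow_le_rpow_of_exponent_le hN (by linarith))
    have h2 : N ^ (3 * θ) / N = N ^ (-(1 - 3 * θ)) := by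
      rw [show -(1 - 3 * θ) = 3 * θ - 1 by ring, Real.rpow_sub hN0, Real.rpow_one]
    calc _ ≤ 4 / N * (16 / θ * N ^ (3 * θ)) := by gcongr
      _ = 64 / θ * (N ^ (3 * θ) / N) := by ring
      _ = (0 + 64 / θ) * N ^ (-(1 - 3 * θ)) := by rw [h2, zero_add]
      _ ≤ _ := by gcongr; positivity

lemma lintegral_mul_translate_sq {B : Rn 2 → ℝ≥0∞} (hB : Measurable B) :
    ∫⁻ b, ∫⁻ η, (B η * B (η + b)) ^ 2 = (∫⁻ ξ, B ξ ^ 2) ^ 2 := by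
  have hm : Measurable fun z : Rn 2 × Rn 2 => (B z.2 * B (z.2 + z.1)) ^ 2 := by fun_prop
  rw [lintegral_lintegral_swap hm.aemeasurable]
  have h : ∀ η, ∫⁻ b, (B η * B (η + b)) ^ 2 = B η ^ 2 * ∫⁻ ξ, B ξ ^ 2 := fun η => by
    rw [← lintegral_add_left_eq_self (fun ξ => B ξ ^ 2) η,
      ← lintegral_const_mul _ (by fun_prop)]
    simp_rw [mul_pow]
  simp_rw [h]
  rw [lintegral_mul_const _ (hB.pow_const 2)]; ring

lemma lintegral_parallelogram_slice_le {θ N : ℝ} {B : Rn 2 → ℝ≥0∞} (hB : Measurable B) (b : Rn 2)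
    {S : ℝ≥0∞} (hS : ∀ η, ∫⁻ ζ, ENNReal.ofReal (minJap b ζ)⁻¹ * actKernel θ N b η ζ ≤ S) :
    ∫⁻ η, ∫⁻ ζ, ENNReal.ofReal (minJap b η ^ (-(1 / 2 : ℝ))) * (B η * B (η + b)) *
        (ENNReal.ofReal (minJap b ζ ^ (-(1 / 2 : ℝ))) * (B ζ * B (ζ + b))) * actKernel θ N b η ζ ≤
      2 * S * ∫⁻ η, (B η * B (η + b)) ^ 2 := by
  have hK : Measurable fun p : Rn 2 × Rn 2 => actKernel θ N b p.1 p.2 :=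
    measurable_actKernel_slice θ N b
  have hw : Measurable fun η => ENNReal.ofReal (minJap b η ^ (-(1 / 2 : ℝ))) := by
    have hc : Continuous fun η => minJap b η := by
      have := continuous_jap
      unfold minJap
      fun_prop
    exact (hc.measurable.pow_const _).ennreal_ofReal
  have hP : Measurable fun η => B η * B (η + b) := by fun_prop
  have hS' : ∀ ζ, ∫⁻ η, ENNReal.ofReal (minJap b η ^ (-(1 / 2 : ℝ))) ^ 2 * actKernel θ N b η ζ ≤
      S := by
    intro ζ
    refine le_trans (le_of_eq (lintegral_congr fun η => ?_)) (hS ζ)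
    rw [actKernel_symm, ← ENNReal.ofReal_pow (Real.rpow_pos_of_pos (minJap_pos b η) _).le,
      ← Real.rpow_natCast, ← Real.rpow_mul (minJap_pos b η).le]
    norm_num [Real.rpow_neg_one]
  have key := lintegral_symmetric_kernel_le (μ := (volume : Measure (Rn 2))) hw hP hK
    (actKernel_symm θ N b) hS'
  have h1 := hw.comp (measurable_fst : Measurable (Prod.fst : Rn 2 × Rn 2 → Rn 2))
  have h2 := hw.comp (measurable_snd : Measurable (Prod.snd : Rn 2 × Rn 2 → Rn 2))
  have h3 := hP.comp (measurable_fst : Measurable (Prod.fst : Rn 2 × Rn 2 → Rn 2))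
  have h4 := hP.comp (measurable_snd : Measurable (Prod.snd : Rn 2 × Rn 2 → Rn 2))
  have hm : Measurable fun p : Rn 2 × Rn 2 =>
      ENNReal.ofReal (minJap b p.1 ^ (-(1 / 2 : ℝ))) * (B p.1 * B (p.1 + b)) *
        (ENNReal.ofReal (minJap b p.2 ^ (-(1 / 2 : ℝ))) * (B p.2 * B (p.2 + b))) *
        actKernel θ N b p.1 p.2 := ((h1.mul h3).mul (h2.mul h4)).mul hK
  rwa [lintegral_prod _ hm.aemeasurable] at key

/-- The quadrilinear resonance form, in the coordinates given by parallelograms. -/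
lemma exists_lintegral_parallelogram_le {θ : ℝ} (hθ : 0 < θ) (hθ3 : θ < 1 / 3) :
    ∃ C : ℝ, 0 ≤ C ∧ ∀ N : ℝ, 1 ≤ N → ∀ B : Rn 2 → ℝ≥0∞, Measurable B →
      ∫⁻ b, ∫⁻ η, ∫⁻ ζ, ENNReal.ofReal (minJap b η ^ (-(1 / 2 : ℝ))) * (B η * B (η + b)) *
        (ENNReal.ofReal (minJap b ζ ^ (-(1 / 2 : ℝ))) * (B ζ * B (ζ + b))) * actKernel θ N b η ζ ≤
        ENNReal.ofReal (C * N ^ (-(1 - 3 * θ))) * (∫⁻ ξ, B ξ ^ 2) ^ 2 := by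
  obtain ⟨C, hC0, hC⟩ := exists_lintegral_minJap_kernel_le hθ hθ3
  refine ⟨2 * C, by positivity, fun N hN B hB => ?_⟩
  refine (lintegral_mono fun b => lintegral_parallelogram_slice_le hB b (hC N hN b)).trans ?_
  rw [lintegral_const_mul' _ _ (ENNReal.mul_ne_top ENNReal.ofNat_ne_top ENNReal.ofReal_ne_top),
    lintegral_mul_translate_sq hB, two_mul_ofReal, mul_assoc]

end Quartic

section QuarticForm

variable {s N : ℝ} {m₁ : Rn 2 → ℝ}

/-- The multiplier of the quartic term of the energy increment. -/
def quarWeight (m₁ : Rn 2 → ℝ) (N : ℝ) (ξ : Rn 2) (x : Rn 2 × Rn 2) : ℝ :=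
  lam ξ * mN m₁ N ξ * |mN m₁ N ξ - mN m₁ N x.1 * mN m₁ N x.2 * mN m₁ N (third ξ x)|

/-- The integrand of the quartic form with frequency envelope `β`. -/
def quarTerm (m₁ : Rn 2 → ℝ) (N θ : ℝ) (β : Rn 2 → ℝ) (ξ : Rn 2) (x : Rn 2 × Rn 2) : ℝ≥0∞ :=
  ENNReal.ofReal (quarWeight m₁ N ξ x * (β ξ * (β x.1 * β x.2 * β (third ξ x)))) *
    ‖lam ξ + triPhase ξ x‖ₑ ^ (θ - 1)

lemma third_third (ξ : Rn 2) (x : Rn 2 × Rn 2) : third ξ (third ξ x, x.2) = x.1 := by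
  simp only [third]; abel

lemma quarTerm_reflect (m₁ : Rn 2 → ℝ) (N θ : ℝ) (β : Rn 2 → ℝ) (ξ : Rn 2) (x : Rn 2 × Rn 2) :
    quarTerm m₁ N θ β ξ (third ξ x, x.2) = quarTerm m₁ N θ β ξ x := by
  unfold quarTerm quarWeight triPhase
  rw [third_third]
  have e1 : lam ξ + -(lam (third ξ x) - lam x.2 + lam x.1) =
      lam ξ + -(lam x.1 - lam x.2 + lam (third ξ x)) := by ring
  have e2 : mN m₁ N (third ξ x) * mN m₁ N x.2 * mN m₁ N x.1 =
      mN m₁ N x.1 * mN m₁ N x.2 * mN m₁ N (third ξ x) := by ring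
  have e3 : β (third ξ x) * β x.2 * β x.1 = β x.1 * β x.2 * β (third ξ x) := by ring
  dsimp only
  rw [e1, e2, e3]

lemma measurable_third_prod : Measurable fun z : Rn 2 × (Rn 2 × Rn 2) => third z.1 z.2 := by
  have : Continuous fun z : Rn 2 × (Rn 2 × Rn 2) => third z.1 z.2 := by unfold third; fun_prop
  exact this.measurable

lemma measurable_quarTerm (hm : IsAdmissibleMultiplier 2 s m₁) (θ : ℝ) {β : Rn 2 → ℝ}
    (hβ : Measurable β) (ξ : Rn 2) : Measurable (quarTerm m₁ N θ β ξ) := by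
  have h1 : Measurable (mN m₁ N) := (continuous_mN hm).measurable
  have h2 : Measurable (third ξ) := (continuous_third ξ).measurable
  have h3 := measurable_triPhase ξ
  have h4 : Measurable fun x => quarWeight m₁ N ξ x := by
    unfold quarWeight
    have h5 := h1.comp h2
    simp only [Function.comp_def] at h5
    have : Measurable fun x : Rn 2 × Rn 2 =>
        mN m₁ N ξ - mN m₁ N x.1 * mN m₁ N x.2 * mN m₁ N (third ξ x) := by fun_prop
    exact (continuous_abs.measurable.comp this).const_mul _
  have h6 := hβ.comp h2
  simp only [Function.comp_def] at h6
  have h7 : Measurable fun x => β ξ * (β x.1 * β x.2 * β (third ξ x)) := by fun_prop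
  exact (h4.mul h7).ennreal_ofReal.mul ((measurable_enorm_rpow (θ - 1)).comp (h3.const_add _))

/-- The region where the first side of the parallelogram is the short one. -/
def shortSide (ξ : Rn 2) : Set (Rn 2 × Rn 2) := {x | ‖x.1 - x.2‖ ≤ ‖ξ - x.1‖}

lemma measurableSet_shortSide (ξ : Rn 2) : MeasurableSet (shortSide ξ) :=
  (isClosed_le (by fun_prop) (by fun_prop)).measurableSet

lemma lintegral_quarTerm_le (hm : IsAdmissibleMultiplier 2 s m₁) (θ : ℝ) {β : Rn 2 → ℝ}
    (hβ : Measurable β) (ξ : Rn 2) :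
    ∫⁻ x, quarTerm m₁ N θ β ξ x ≤ 2 * ∫⁻ x, (shortSide ξ).indicator (quarTerm m₁ N θ β ξ) x := by
  have hq := (measurable_quarTerm (N := N) hm θ hβ ξ).indicator (measurableSet_shortSide ξ)
  have h := lintegral_reflect ξ hq
  rw [two_mul]
  nth_rewrite 2 [← h]
  rw [← lintegral_add_left hq]
  refine lintegral_mono fun x => ?_
  by_cases hx : x ∈ shortSide ξ
  · rw [indicator_of_mem hx]; exact le_self_add
  · have : (third ξ x, x.2) ∈ shortSide ξ := by
      simp only [shortSide, mem_ofPred_eq, not_le] at hx ⊢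
      have e1 : third ξ x - x.2 = ξ - x.1 := by simp only [third]; abel
      have e2 : ξ - third ξ x = x.1 - x.2 := by simp only [third]; abel
      rw [e1, e2]; exact hx.le
    rw [indicator_of_mem this, quarTerm_reflect]
    exact le_add_self

lemma quarTerm_translate (θ : ℝ) (β : Rn 2 → ℝ) (η b ζ : Rn 2) :
    quarTerm m₁ N θ β η (η + b, ζ + b) =
      ENNReal.ofReal (4 * Real.pi ^ 2 * (‖η‖ ^ 2 * mN m₁ N η *
        |mN m₁ N η - mN m₁ N (η + b) * mN m₁ N (ζ + b) * mN m₁ N ζ|) *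
        (β η * (β (η + b) * β (ζ + b) * β ζ))) *
      ‖-(8 * Real.pi ^ 2) * ⟪b, η - ζ⟫‖ₑ ^ (θ - 1) := by
  have e : third η (η + b, ζ + b) = ζ := by simp only [third]; abel
  have e2 : lam η + triPhase η (η + b, ζ + b) = -(8 * Real.pi ^ 2) * ⟪b, η - ζ⟫ := by
    unfold triPhase lam
    rw [e, norm_add_sq_real, norm_add_sq_real, inner_sub_right, real_inner_comm b η,
      real_inner_comm b ζ]
    ring
  unfold quarTerm
  rw [e2]
  unfold quarWeight
  rw [e]
  congr 3
  unfold lam; ring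

/-- The integrand of the form in parallelogram coordinates. -/
@[irreducible]
def paraTerm (N θ : ℝ) (B : Rn 2 → ℝ≥0∞) (b η ζ : Rn 2) : ℝ≥0∞ :=
  ENNReal.ofReal (minJap b η ^ (-(1 / 2 : ℝ))) * (B η * B (η + b)) *
    (ENNReal.ofReal (minJap b ζ ^ (-(1 / 2 : ℝ))) * (B ζ * B (ζ + b))) * actKernel θ N b η ζ

lemma exists_indicator_quarTerm_le (hs : 1 / 2 ≤ s) (hs1 : s < 1)
    (hm : IsAdmissibleMultiplier 2 s m₁) {θ : ℝ} (hθ1 : θ < 1) :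
    ∃ C : ℝ, 0 ≤ C ∧ ∀ N : ℝ, 1 ≤ N → ∀ β : Rn 2 → ℝ, (∀ ξ, 0 ≤ β ξ) → ∀ η b ζ : Rn 2,
      (shortSide η).indicator (quarTerm m₁ N θ β η) (η + b, ζ + b) ≤
        ENNReal.ofReal (C * N ^ (-(1 / 2 : ℝ))) *
          paraTerm N θ (fun ξ => ENNReal.ofReal (gw m₁ N ξ * β ξ)) b η ζ := by
  obtain ⟨C, hC0, hC⟩ := exists_comm_minJap_le hs hs1 hm
  refine ⟨4 * Real.pi ^ 2 * C, by positivity, fun N hN β hβ η b ζ => ?_⟩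
  by_cases hx : (η + b, ζ + b) ∈ shortSide η
  swap
  · rw [indicator_of_notMem hx]; exact zero_le
  have hx' : ‖η - ζ‖ ≤ ‖b‖ := by
    simpa [shortSide] using hx
  rw [indicator_of_mem hx, quarTerm_translate]
  by_cases hA : Active N b η ζ
  swap
  · have : mN m₁ N η - mN m₁ N (η + b) * mN m₁ N (ζ + b) * mN m₁ N ζ = 0 := by
      simp only [Active, not_and_or, not_or, not_le] at hA
      rcases hA with h | ⟨h1, h2, h3, h4⟩
      · exact absurd hx' (not_le.2 h)
      · exact comm_eq_zero hm hN h2 h4 h3 h1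
    rw [this]; simp
  have hg := fun ξ => (gw_pos (N := N) hm ξ).le
  have p1 := Real.rpow_pos_of_pos (minJap_pos b η) (-(1 / 2 : ℝ))
  have p2 := Real.rpow_pos_of_pos (minJap_pos b ζ) (-(1 / 2 : ℝ))
  have hK : actKernel θ N b η ζ = ‖⟪b, η - ζ⟫‖ₑ ^ (θ - 1) := by unfold actKernel; rw [if_pos hA]
  have hgb := fun ξ => mul_nonneg (hg ξ) (hβ ξ)
  have hNp : 0 ≤ N ^ (-(1 / 2 : ℝ)) := Real.rpow_nonneg (by linarith) _
  unfold paraTerm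
  beta_reduce
  rw [hK, ← mul_assoc (ENNReal.ofReal (4 * Real.pi ^ 2 * C * N ^ (-(1 / 2 : ℝ))))]
  refine mul_le_mul' ?_ (enorm_neg_mul_rpow_le hθ1 _)
  rw [← ENNReal.ofReal_mul (hgb _), ← ENNReal.ofReal_mul (hgb _), ← ENNReal.ofReal_mul p1.le,
    ← ENNReal.ofReal_mul p2.le,
    ← ENNReal.ofReal_mul (mul_nonneg p1.le (mul_nonneg (hgb _) (hgb _))),
    ← ENNReal.ofReal_mul (by positivity)]
  apply ENNReal.ofReal_le_ofReal
  have h4 : 0 ≤ β η * (β (η + b) * β (ζ + b) * β ζ) :=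
    mul_nonneg (hβ _) (mul_nonneg (mul_nonneg (hβ _) (hβ _)) (hβ _))
  calc _ ≤ 4 * Real.pi ^ 2 * (C * N ^ (-(1 / 2 : ℝ)) * (minJap b η ^ (-(1 / 2 : ℝ)) *
          minJap b ζ ^ (-(1 / 2 : ℝ)) *
          (gw m₁ N (η + b) * gw m₁ N (ζ + b) * gw m₁ N ζ * gw m₁ N η))) *
          (β η * (β (η + b) * β (ζ + b) * β ζ)) := by
        refine mul_le_mul_of_nonneg_right ?_ h4
        exact mul_le_mul_of_nonneg_left (hC N hN b ζ η hx') (by positivity)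
    _ = _ := by ring

lemma lintegral_prod_translate (η : Rn 2) {F : Rn 2 × Rn 2 → ℝ≥0∞} (hF : Measurable F) :
    ∫⁻ x, F x = ∫⁻ b, ∫⁻ ζ, F (η + b, ζ + b) := by
  rw [Measure.volume_eq_prod, lintegral_prod _ hF.aemeasurable,
    ← lintegral_add_left_eq_self _ η]
  congr 1; ext b
  rw [← lintegral_add_right_eq_self _ b]

lemma measurable_paraTerm (N θ : ℝ) {B : Rn 2 → ℝ≥0∞} (hB : Measurable B) :
    Measurable fun z : Rn 2 × Rn 2 × Rn 2 => paraTerm N θ B z.1 z.2.1 z.2.2 := by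
  have h0 := measurable_actKernel θ N
  have hj : Continuous fun z : Rn 2 × Rn 2 => minJap z.1 z.2 := by
    have := continuous_jap
    unfold minJap
    fun_prop
  have h1 : Measurable fun z : Rn 2 × Rn 2 × Rn 2 =>
      ENNReal.ofReal (minJap z.1 z.2.1 ^ (-(1 / 2 : ℝ))) := by
    have := hj.measurable.comp (by fun_prop : Measurable fun z : Rn 2 × Rn 2 × Rn 2 => (z.1, z.2.1))
    exact (Measurable.pow_const this _).ennreal_ofReal
  have h2 : Measurable fun z : Rn 2 × Rn 2 × Rn 2 =>
      ENNReal.ofReal (minJap z.1 z.2.2 ^ (-(1 / 2 : ℝ))) := by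
    have := hj.measurable.comp (by fun_prop : Measurable fun z : Rn 2 × Rn 2 × Rn 2 => (z.1, z.2.2))
    exact (Measurable.pow_const this _).ennreal_ofReal
  have h3 : Measurable fun z : Rn 2 × Rn 2 × Rn 2 => B z.2.1 * B (z.2.1 + z.1) := by fun_prop
  have h4 : Measurable fun z : Rn 2 × Rn 2 × Rn 2 => B z.2.2 * B (z.2.2 + z.1) := by fun_prop
  unfold paraTerm
  exact ((h1.mul h3).mul (h2.mul h4)).mul h0

/-- The quartic form gains `N ^ (-(3 / 2 - 3 θ))`. -/
lemma exists_lintegral_quarTerm_le (hs : 1 / 2 ≤ s) (hs1 : s < 1)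
    (hm : IsAdmissibleMultiplier 2 s m₁) {θ : ℝ} (hθ : 0 < θ) (hθ3 : θ < 1 / 3) :
    ∃ C : ℝ, 0 ≤ C ∧ ∀ N : ℝ, 1 ≤ N → ∀ β : Rn 2 → ℝ, (∀ ξ, 0 ≤ β ξ) → Measurable β →
      ∫⁻ ξ, ∫⁻ x, quarTerm m₁ N θ β ξ x ≤ ENNReal.ofReal (C * N ^ (-(3 / 2 - 3 * θ))) *
        (∫⁻ ξ, ENNReal.ofReal (gw m₁ N ξ * β ξ) ^ 2) ^ 2 := by
  obtain ⟨C₁, hC₁0, hC₁⟩ := exists_indicator_quarTerm_le hs hs1 hm (by linarith : θ < 1)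
  obtain ⟨C₂, hC₂0, hC₂⟩ := exists_lintegral_parallelogram_le hθ hθ3
  refine ⟨2 * C₁ * C₂, by positivity, fun N hN β hβ hβm => ?_⟩
  have hN0 : 0 < N := by linarith
  set B : Rn 2 → ℝ≥0∞ := fun ξ => ENNReal.ofReal (gw m₁ N ξ * β ξ) with hB
  have hBm : Measurable B := ((continuous_gw hm).measurable.mul hβm).ennreal_ofReal
  have hpm := measurable_paraTerm N θ hBm
  have hsl : Measurable fun z : Rn 2 × Rn 2 => ∫⁻ ζ, paraTerm N θ B z.2 z.1 ζ := by
    have : Measurable fun w : (Rn 2 × Rn 2) × Rn 2 => paraTerm N θ B w.1.2 w.1.1 w.2 :=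
      Measurable.comp (g := fun z : Rn 2 × Rn 2 × Rn 2 => paraTerm N θ B z.1 z.2.1 z.2.2) hpm
        (by fun_prop : Measurable fun w : (Rn 2 × Rn 2) × Rn 2 => (w.1.2, w.1.1, w.2))
    exact this.lintegral_prod_right'
  have step : ∀ ξ, ∫⁻ x, quarTerm m₁ N θ β ξ x ≤
      2 * ENNReal.ofReal (C₁ * N ^ (-(1 / 2 : ℝ))) * ∫⁻ b, ∫⁻ ζ, paraTerm N θ B b ξ ζ := by
    intro ξ
    refine (lintegral_quarTerm_le hm θ hβm ξ).trans ?_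
    rw [mul_assoc]
    refine mul_le_mul' le_rfl ?_
    rw [lintegral_prod_translate ξ ((measurable_quarTerm hm θ hβm ξ).indicator
      (measurableSet_shortSide ξ)), ← lintegral_const_mul' _ _ ENNReal.ofReal_ne_top]
    refine lintegral_mono fun b => ?_
    rw [← lintegral_const_mul' _ _ ENNReal.ofReal_ne_top]
    exact lintegral_mono fun ζ => hC₁ N hN β hβ ξ b ζ
  refine (lintegral_mono step).trans ?_
  rw [lintegral_const_mul' _ _ (ENNReal.mul_ne_top ENNReal.ofNat_ne_top ENNReal.ofReal_ne_top),
    lintegral_lintegral_swap hsl.aemeasurable]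
  have hp := hC₂ N hN B hBm
  have hu : ∀ b η ζ, paraTerm N θ B b η ζ = _ := fun b η ζ => by rw [paraTerm]
  simp only [← hu] at hp
  refine (mul_le_mul' le_rfl hp).trans (le_of_eq ?_)
  rw [← mul_assoc, two_mul_ofReal, ← ENNReal.ofReal_mul (by positivity)]
  congr 2
  rw [show -(3 / 2 - 3 * θ) = -(1 / 2 : ℝ) + -(1 - 3 * θ) by ring, Real.rpow_add hN0]
  ring

end QuarticForm

section TrilinearForm

variable {s N T θ κ : ℝ} {m₁ : Rn 2 → ℝ} {v : ℝ → Rn 2 → ℂ} {β : Rn 2 → ℝ}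

/-- The trilinear form with multiplier `M` and output frequency `ξ`. -/
def triForm (M : Rn 2 × Rn 2 → ℝ) (v : Rn 2 → ℂ) (ξ : Rn 2) : ℂ :=
  ∫ x : Rn 2 × Rn 2, (M x : ℂ) * (v x.1 * (starRingEnd ℂ) (v x.2) * v (third ξ x))

/-- `β` is a rapidly decaying envelope for the variation of the interaction profile of `v`. -/
structure Profile (T : ℝ) (v : ℝ → Rn 2 → ℂ) (β : Rn 2 → ℝ) : Prop where
  meas : Measurable fun p : ℝ × Rn 2 => v p.1 p.2
  meas_env : Measurable β
  var : ∀ ξ, VarLE T (fun t => cexp (I * (lam ξ * t : ℝ)) * v t ξ) (β ξ)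
  decay : ∃ C : ℝ, ∀ ξ, jap ξ ^ 6 * β ξ ≤ C

/-- The product of three interaction profiles. -/
def triProfile (v : ℝ → Rn 2 → ℂ) (ξ : Rn 2) (t : ℝ) (x : Rn 2 × Rn 2) : ℂ :=
  cexp (I * (lam x.1 * t : ℝ)) * v t x.1 * (starRingEnd ℂ) (cexp (I * (lam x.2 * t : ℝ)) * v t x.2) *
    (cexp (I * (lam (third ξ x) * t : ℝ)) * v t (third ξ x))

/-- The envelope of a product of three interaction profiles. -/
def triEnv (β : Rn 2 → ℝ) (ξ : Rn 2) (x : Rn 2 × Rn 2) : ℝ :=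
  2 * (2 * (β x.1 * β x.2) * β (third ξ x))

lemma Profile.env_nonneg (hv : Profile T v β) (hT : 0 ≤ T) (ξ : Rn 2) : 0 ≤ β ξ :=
  (hv.var ξ).nonneg hT

lemma integrable_jap_inv_pow {k : ℕ} (hk : 3 ≤ k) : Integrable fun ξ : Rn 2 => (jap ξ ^ k)⁻¹ := by
  have h := integrable_one_add_norm (E := Rn 2) (μ := volume) (r := 3) (by simp; norm_num)
  refine Integrable.mono' (h.const_mul 8) ?_ (Filter.Eventually.of_forall fun ξ => ?_)
  · exact ((continuous_jap.pow k).inv₀ fun ξ => (pow_pos (jap_pos ξ) k).ne').aestronglyMeasurable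
  · have h1 := one_add_norm_le ξ
    have h0 : (0 : ℝ) < 1 + ‖ξ‖ := by positivity
    rw [Real.norm_of_nonneg (inv_nonneg.2 (pow_nonneg (jap_pos ξ).le k)), Real.rpow_neg h0.le]
    have e : (1 + ‖ξ‖) ^ (3 : ℝ) = (1 + ‖ξ‖) ^ 3 := by norm_cast
    rw [e, ← div_eq_mul_inv, le_div_iff₀ (by positivity), inv_mul_le_iff₀ (pow_pos (jap_pos ξ) k)]
    calc (1 + ‖ξ‖) ^ 3 ≤ (2 * jap ξ) ^ 3 := by gcongr
      _ = jap ξ ^ 3 * 8 := by ring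
      _ ≤ jap ξ ^ k * 8 := by
        gcongr
        exact one_le_jap ξ

lemma Profile.integrable_jap_mul (hv : Profile T v β) (hT : 0 ≤ T) {k : ℕ} (hk : k ≤ 3) :
    Integrable fun ξ => jap ξ ^ k * β ξ := by
  obtain ⟨C, hC⟩ := hv.decay
  refine Integrable.mono' ((integrable_jap_inv_pow le_rfl).const_mul C)
    ((continuous_jap.pow k).measurable.mul hv.meas_env).aestronglyMeasurable
    (Filter.Eventually.of_forall fun ξ => ?_)
  have h0 := hv.env_nonneg hT ξ
  have hj := jap_pos ξ
  rw [Real.norm_of_nonneg (by positivity), ← div_eq_mul_inv, le_div_iff₀ (by positivity)]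
  calc jap ξ ^ k * β ξ * jap ξ ^ 3 ≤ jap ξ ^ 3 * β ξ * jap ξ ^ 3 := by
        gcongr; exact one_le_jap ξ
    _ = jap ξ ^ 6 * β ξ := by ring
    _ ≤ C := hC ξ

lemma Profile.integrable_env (hv : Profile T v β) (hT : 0 ≤ T) : Integrable β := by
  simpa using hv.integrable_jap_mul hT (k := 0) (by norm_num)

lemma Profile.exists_env_le (hv : Profile T v β) (hT : 0 ≤ T) : ∃ C : ℝ, ∀ ξ, β ξ ≤ C := by
  obtain ⟨C, hC⟩ := hv.decay
  refine ⟨C, fun ξ => le_trans ?_ (hC ξ)⟩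
  exact le_mul_of_one_le_left (hv.env_nonneg hT ξ) (one_le_pow₀ (one_le_jap ξ))

lemma measurable_triEnv (hβ : Measurable β) (ξ : Rn 2) : Measurable (triEnv β ξ) := by
  have h := hβ.comp (continuous_third ξ).measurable
  simp only [Function.comp_def] at h
  unfold triEnv
  fun_prop

lemma Profile.integrable_triEnv (hv : Profile T v β) (hT : 0 ≤ T) (ξ : Rn 2) :
    Integrable (triEnv β ξ) := by
  obtain ⟨C, hC⟩ := hv.exists_env_le hT
  have h := (hv.integrable_env hT).mul_prod (hv.integrable_env hT)
  refine Integrable.mono' (h.const_mul (4 * C)) (measurable_triEnv hv.meas_env ξ).aestronglyMeasurable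
    (Filter.Eventually.of_forall fun x => ?_)
  have h1 := hv.env_nonneg hT x.1
  have h2 := hv.env_nonneg hT x.2
  have h3 := hv.env_nonneg hT (third ξ x)
  unfold triEnv
  rw [Real.norm_of_nonneg (by positivity)]
  calc _ = 4 * β (third ξ x) * (β x.1 * β x.2) := by ring
    _ ≤ _ := by gcongr; exact hC _

lemma Profile.varLE_triProfile (hv : Profile T v β) (hT : 0 ≤ T) (ξ : Rn 2) (x : Rn 2 × Rn 2) :
    VarLE T (fun t => triProfile v ξ t x) (triEnv β ξ x) :=
  ((hv.var x.1).mul hT (hv.var x.2).conj).mul hT (hv.var (third ξ x))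

lemma Profile.measurable_triProfile (hv : Profile T v β) (ξ : Rn 2) :
    Measurable fun p : ℝ × (Rn 2 × Rn 2) => triProfile v ξ p.1 p.2 := by
  have hl := continuous_lam.measurable
  have h : Measurable fun p : ℝ × Rn 2 => cexp (I * (lam p.2 * p.1 : ℝ)) * v p.1 p.2 := by
    have := hv.meas
    fun_prop
  have h3 := (continuous_third ξ).measurable
  have h1' := h.comp (by fun_prop : Measurable fun p : ℝ × (Rn 2 × Rn 2) => (p.1, p.2.1))
  have h2' := h.comp (by fun_prop : Measurable fun p : ℝ × (Rn 2 × Rn 2) => (p.1, p.2.2))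
  have h3' := h.comp (by fun_prop : Measurable fun p : ℝ × (Rn 2 × Rn 2) => (p.1, third ξ p.2))
  exact (h1'.mul (Complex.continuous_conj.measurable.comp h2')).mul h3'

lemma oscTerm_triProfile (M : Rn 2 × Rn 2 → ℝ) (v : ℝ → Rn 2 → ℂ) (ξ : Rn 2) (t : ℝ)
    (x : Rn 2 × Rn 2) : oscTerm M (triPhase ξ) (triProfile v ξ) t x =
      (M x : ℂ) * (v t x.1 * (starRingEnd ℂ) (v t x.2) * v t (third ξ x)) := by
  unfold oscTerm triProfile
  have h : cexp (I * (triPhase ξ x * t : ℝ)) * (cexp (I * (lam x.1 * t : ℝ)) *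
      cexp (-I * (lam x.2 * t : ℝ)) * cexp (I * (lam (third ξ x) * t : ℝ))) = 1 := by
    rw [← Complex.exp_add, ← Complex.exp_add, ← Complex.exp_add, Complex.exp_eq_one_iff]
    refine ⟨0, ?_⟩
    unfold triPhase
    push_cast; ring
  rw [map_mul, ← Complex.exp_conj, map_mul, Complex.conj_I, Complex.conj_ofReal]
  linear_combination ((M x : ℂ) * (v t x.1 * (starRingEnd ℂ) (v t x.2) * v t (third ξ x))) * h

lemma integral_oscTerm_triProfile (M : Rn 2 × Rn 2 → ℝ) (v : ℝ → Rn 2 → ℂ) (ξ : Rn 2) (t : ℝ) :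
    ∫ x, oscTerm M (triPhase ξ) (triProfile v ξ) t x = triForm M (v t) ξ := by
  simp_rw [oscTerm_triProfile]; rfl

lemma exists_lintegral_triForm_sq_le (hθ : 0 < θ) (hθκ : θ < κ) (hκ : κ < 1) :
    ∃ C : ℝ, 0 ≤ C ∧ ∀ {T : ℝ} {v : ℝ → Rn 2 → ℂ} {β g : Rn 2 → ℝ}, Profile T v β → 0 ≤ T →
      Measurable g → (∀ ξ, 0 ≤ g ξ) →
      ∀ {A : ℝ}, 0 ≤ A → ∀ {M : Rn 2 → Rn 2 × Rn 2 → ℝ}, (∀ ξ, Measurable (M ξ)) →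
      (∀ ξ, ∃ D : ℝ, ∀ x, |M ξ x| ≤ D) →
      (∀ ξ x, |M ξ x| ≤ A * (pairWeight (1 / 2 + κ) x.1 x.2 (third ξ x) *
        (g x.1 * g x.2 * g (third ξ x)))) →
      ∫⁻ ξ, ∫⁻ t in Ioc 0 T, ‖triForm (M ξ) (v t) ξ‖ₑ ^ 2 ≤
        ENNReal.ofReal (C * A ^ 2 * T ^ θ) * (∫⁻ ξ, ENNReal.ofReal (g ξ * β ξ) ^ 2) ^ 3 := by
  obtain ⟨C, hC⟩ := exists_lintegral_pairWeight_le hθ hθκ hκ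
  refine ⟨128 * C, by positivity, ?_⟩
  intro T v β g hv hT hg hg0 A hA M hM hD hMA
  have hTθ : 0 ≤ T ^ θ := Real.rpow_nonneg hT θ
  set p : Rn 2 → ℝ≥0∞ := fun ξ => ENNReal.ofReal (g ξ * β ξ) with hp
  have hpm : Measurable p := (hg.mul hv.meas_env).ennreal_ofReal
  have key : ∀ ξ, ∫⁻ t in Ioc 0 T, ‖triForm (M ξ) (v t) ξ‖ₑ ^ 2 ≤
      ENNReal.ofReal (128 * C * A ^ 2 * T ^ θ) *
        ∫⁻ x : Rn 2 × Rn 2, p x.1 ^ 2 * p x.2 ^ 2 * p (third ξ x) ^ 2 := by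
    intro ξ
    have hthird := (continuous_third ξ).measurable
    set w : Rn 2 × Rn 2 → ℝ≥0∞ :=
      fun x => ENNReal.ofReal (4 * A) * ENNReal.ofReal (pairWeight (1 / 2 + κ) x.1 x.2 (third ξ x))
    have hw : Measurable w := by
      have hj : Measurable fun η : Rn 2 => jap η ^ (-(1 / 2 + κ)) :=
        continuous_jap.measurable.pow_const _
      have hj3 := hj.comp hthird
      have hj1 := hj.comp (measurable_fst : Measurable (Prod.fst : Rn 2 × Rn 2 → Rn 2))
      have hj2 := hj.comp (measurable_snd : Measurable (Prod.snd : Rn 2 × Rn 2 → Rn 2))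
      simp only [Function.comp_def] at hj1 hj2 hj3
      have : Measurable fun x : Rn 2 × Rn 2 => pairWeight (1 / 2 + κ) x.1 x.2 (third ξ x) := by
        unfold pairWeight; fun_prop
      exact this.ennreal_ofReal.const_mul _
    have hP : Measurable fun x : Rn 2 × Rn 2 => p x.1 * p x.2 * p (third ξ x) := by
      have := hpm.comp hthird
      simp only [Function.comp_def] at this
      fun_prop
    have hβ := hv.env_nonneg hT
    obtain ⟨D, hD⟩ := hD ξ
    have hi : Integrable fun x => |M ξ x| * triEnv β ξ x := by
      refine Integrable.bdd_mul (hv.integrable_triEnv hT ξ)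
        (continuous_abs.measurable.comp (hM ξ)).aestronglyMeasurable
        (Filter.Eventually.of_forall fun x => ?_) (c := D)
      simpa using hD x
    have hwP : ∀ x, ENNReal.ofReal (|M ξ x| * triEnv β ξ x) ≤
        w x * (p x.1 * p x.2 * p (third ξ x)) := by
      intro x
      have hpw := (pairWeight_pos (1 / 2 + κ) x.1 x.2 (third ξ x)).le
      have hgb := fun ξ => mul_nonneg (hg0 ξ) (hβ ξ)
      simp only [w, p]
      rw [← ENNReal.ofReal_mul (by positivity), ← ENNReal.ofReal_mul (hgb _),
        ← ENNReal.ofReal_mul (mul_nonneg (hgb _) (hgb _)), ← ENNReal.ofReal_mul (by positivity)]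
      apply ENNReal.ofReal_le_ofReal
      have h0 : 0 ≤ triEnv β ξ x := by
        have h1 := hβ x.1
        have h2 := hβ x.2
        have h3 := hβ (third ξ x)
        unfold triEnv; positivity
      refine (mul_le_mul_of_nonneg_right (hMA ξ x) h0).trans (le_of_eq ?_)
      unfold triEnv; ring
    have hS : ∀ τ : ℝ, ∫⁻ x, w x ^ 2 * ‖triPhase ξ x - τ‖ₑ ^ (θ - 1) ≤
        ENNReal.ofReal (16 * A ^ 2 * C) := by
      intro τ
      simp only [w, mul_pow, mul_assoc]
      rw [lintegral_const_mul' _ _ (ENNReal.pow_ne_top ENNReal.ofReal_ne_top)]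
      refine (mul_le_mul' le_rfl (hC ξ τ)).trans (le_of_eq ?_)
      rw [← ENNReal.ofReal_coe_nnreal, ← ENNReal.ofReal_pow (by positivity),
        ← ENNReal.ofReal_mul (by positivity)]
      congr 1; ring
    have h := lintegral_sq_oscTerm_le hT hθ (hθκ.trans hκ) (hM ξ) (measurable_triPhase ξ)
      (hv.measurable_triProfile ξ) (hv.varLE_triProfile hT ξ) hi hw hP hwP hS
    simp only [integral_oscTerm_triProfile] at h
    refine h.trans (le_of_eq ?_)
    simp only [mul_pow]
    rw [← ENNReal.ofReal_mul (by positivity)]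
    congr 2; ring
  refine (lintegral_mono key).trans ?_
  rw [lintegral_const_mul' _ _ ENNReal.ofReal_ne_top,
    lintegral_third_pow (p := fun ξ => p ξ ^ 2) (by fun_prop)]

end TrilinearForm

section QuarticTerm

variable {s N T θ κ : ℝ} {m₁ : Rn 2 → ℝ} {v : ℝ → Rn 2 → ℂ} {β : Rn 2 → ℝ}

/-- The multiplier measuring the failure of `I_N` to commute with the cubic nonlinearity. -/
def commMult (m₁ : Rn 2 → ℝ) (N : ℝ) (ξ : Rn 2) (x : Rn 2 × Rn 2) : ℝ :=
  mN m₁ N ξ - mN m₁ N x.1 * mN m₁ N x.2 * mN m₁ N (third ξ x)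

lemma measurable_commMult_prod (hm : IsAdmissibleMultiplier 2 s m₁) :
    Measurable fun z : Rn 2 × (Rn 2 × Rn 2) => commMult m₁ N z.1 z.2 := by
  have h1 : Measurable (mN m₁ N) := (continuous_mN hm).measurable
  have h3 := h1.comp measurable_third_prod
  simp only [Function.comp_def] at h3
  unfold commMult
  fun_prop

lemma measurable_commMult (hm : IsAdmissibleMultiplier 2 s m₁) (ξ : Rn 2) :
    Measurable (commMult m₁ N ξ) :=
  Measurable.comp (g := fun z : Rn 2 × (Rn 2 × Rn 2) => commMult m₁ N z.1 z.2)
    (measurable_commMult_prod hm) (measurable_const.prodMk measurable_id)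

lemma abs_commMult_le_one (hm : IsAdmissibleMultiplier 2 s m₁) (ξ : Rn 2) (x : Rn 2 × Rn 2) :
    |commMult m₁ N ξ x| ≤ 1 := abs_mN_comm_le_one hm _ _ _ _

/-- The full multiplier of the quartic term. -/
def quarMult (m₁ : Rn 2 → ℝ) (N : ℝ) (z : Rn 2 × (Rn 2 × Rn 2)) : ℝ :=
  lam z.1 * mN m₁ N z.1 * commMult m₁ N z.1 z.2

/-- The product of the four interaction profiles. -/
def quarProfile (v : ℝ → Rn 2 → ℂ) (t : ℝ) (z : Rn 2 × (Rn 2 × Rn 2)) : ℂ :=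
  (starRingEnd ℂ) (cexp (I * (lam z.1 * t : ℝ)) * v t z.1) * triProfile v z.1 t z.2

lemma oscTerm_quarProfile (M : Rn 2 × (Rn 2 × Rn 2) → ℝ) (v : ℝ → Rn 2 → ℂ) (t : ℝ)
    (z : Rn 2 × (Rn 2 × Rn 2)) :
    oscTerm M (fun z => lam z.1 + triPhase z.1 z.2) (quarProfile v) t z =
      (M z : ℂ) * ((starRingEnd ℂ) (v t z.1) *
        (v t z.2.1 * (starRingEnd ℂ) (v t z.2.2) * v t (third z.1 z.2))) := by
  have h := oscTerm_triProfile (fun _ => 1) v z.1 t z.2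
  unfold oscTerm at h ⊢
  unfold quarProfile
  have e : cexp (I * ((lam z.1 + triPhase z.1 z.2) * t : ℝ)) * cexp (-I * (lam z.1 * t : ℝ)) =
      cexp (I * (triPhase z.1 z.2 * t : ℝ)) := by
    rw [← Complex.exp_add]; congr 1; push_cast; ring
  rw [map_mul, ← Complex.exp_conj, map_mul, Complex.conj_I, Complex.conj_ofReal]
  push_cast at h ⊢
  push_cast at e
  rw [one_mul, one_mul] at h
  rw [← h, ← e]; ring

lemma abs_quarMult_le (hm : IsAdmissibleMultiplier 2 s m₁) (z : Rn 2 × (Rn 2 × Rn 2)) :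
    |quarMult m₁ N z| ≤ lam z.1 := by
  unfold quarMult
  rw [abs_mul, abs_mul, abs_of_nonneg (lam_nonneg _), abs_of_nonneg (mN_pos hm _).le]
  have h1 := abs_commMult_le_one (N := N) hm z.1 z.2
  have h2 := mN_le_one (N := N) hm z.1
  have h3 := mN_pos (N := N) hm z.1
  calc _ ≤ lam z.1 * 1 * 1 := by
        have := lam_nonneg z.1
        gcongr
    _ = _ := by ring

lemma lam_le_jap_sq (ξ : Rn 2) : lam ξ ≤ 4 * Real.pi ^ 2 * jap ξ ^ 2 := by
  unfold lam
  have := norm_le_jap ξ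
  gcongr

lemma measurable_quarMult (hm : IsAdmissibleMultiplier 2 s m₁) : Measurable (quarMult m₁ N) := by
  have h1 := measurable_commMult_prod (N := N) hm
  have h2 : Measurable (mN m₁ N) := (continuous_mN hm).measurable
  have h3 := continuous_lam.measurable
  unfold quarMult
  fun_prop

lemma measurable_quarEnv (hβ : Measurable β) :
    Measurable fun z : Rn 2 × (Rn 2 × Rn 2) => 2 * (β z.1 * triEnv β z.1 z.2) := by
  have h2 := hβ.comp measurable_third_prod
  have h1 : Measurable fun z : Rn 2 × (Rn 2 × Rn 2) => 2 * (β z.2.1 * β z.2.2) := by fun_prop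
  exact ((hβ.comp measurable_fst).mul ((h1.mul h2).const_mul 2)).const_mul 2

lemma Profile.integrable_quarMult (hm : IsAdmissibleMultiplier 2 s m₁) (hv : Profile T v β)
    (hT : 0 ≤ T) :
    Integrable fun z : Rn 2 × (Rn 2 × Rn 2) =>
      |quarMult m₁ N z| * (2 * (β z.1 * triEnv β z.1 z.2)) := by
  obtain ⟨C, hC⟩ := hv.exists_env_le hT
  have hβ := hv.env_nonneg hT
  have h := (hv.integrable_jap_mul hT (k := 2) (by norm_num)).mul_prod
    ((hv.integrable_env hT).mul_prod (hv.integrable_env hT))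
  have hM := measurable_quarMult (N := N) hm
  refine Integrable.mono' (h.const_mul (32 * Real.pi ^ 2 * C))
    ((continuous_abs.measurable.comp hM).mul (measurable_quarEnv hv.meas_env)).aestronglyMeasurable
    (Filter.Eventually.of_forall fun z => ?_)
  have h0 := hβ z.1
  have h1 := hβ z.2.1
  have h2 := hβ z.2.2
  have h3 := hβ (third z.1 z.2)
  have h4 : 0 ≤ triEnv β z.1 z.2 := by unfold triEnv; positivity
  rw [Real.norm_of_nonneg (by positivity)]
  have h5 : triEnv β z.1 z.2 ≤ 4 * C * (β z.2.1 * β z.2.2) := by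
    unfold triEnv
    calc _ = 4 * β (third z.1 z.2) * (β z.2.1 * β z.2.2) := by ring
      _ ≤ _ := by gcongr; exact hC _
  calc _ ≤ (4 * Real.pi ^ 2 * jap z.1 ^ 2) * (2 * (β z.1 * (4 * C * (β z.2.1 * β z.2.2)))) := by
        have := (abs_quarMult_le (N := N) hm z).trans (lam_le_jap_sq z.1)
        gcongr
    _ = _ := by ring

lemma exists_enorm_quartic_le (hs : 1 / 2 ≤ s) (hs1 : s < 1) (hm : IsAdmissibleMultiplier 2 s m₁)
    (hθ : 0 < θ) (hθ3 : θ < 1 / 3) :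
    ∃ C : ℝ, 0 ≤ C ∧ ∀ N : ℝ, 1 ≤ N → ∀ {T : ℝ} {v : ℝ → Rn 2 → ℂ} {β : Rn 2 → ℝ},
      Profile T v β → 0 ≤ T →
      ‖∫ t in Ioc 0 T, ∫ ξ, ((lam ξ * mN m₁ N ξ : ℝ) : ℂ) *
        ((starRingEnd ℂ) (v t ξ) * triForm (commMult m₁ N ξ) (v t) ξ)‖ₑ ≤
      ENNReal.ofReal (C * T ^ θ * N ^ (-(3 / 2 - 3 * θ))) *
        (∫⁻ ξ, ENNReal.ofReal (gw m₁ N ξ * β ξ) ^ 2) ^ 2 := by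
  obtain ⟨C, hC0, hC⟩ := exists_lintegral_quarTerm_le hs hs1 hm hθ hθ3
  refine ⟨16 * C, by positivity, ?_⟩
  intro N hN T v β hv hT
  have hTθ : 0 ≤ T ^ θ := Real.rpow_nonneg hT θ
  have hN0 : 0 ≤ N ^ (-(3 / 2 - 3 * θ)) := Real.rpow_nonneg (by linarith) _
  have hM := measurable_quarMult (N := N) hm
  have hΨ : Measurable fun z : Rn 2 × (Rn 2 × Rn 2) => lam z.1 + triPhase z.1 z.2 := by
    have h3 := continuous_lam
    unfold triPhase third
    exact (by fun_prop : Continuous _).measurable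
  have hf : Measurable fun p : ℝ × (Rn 2 × (Rn 2 × Rn 2)) => quarProfile v p.1 p.2 := by
    have hl := continuous_lam.measurable
    have h : Measurable fun p : ℝ × Rn 2 => cexp (I * (lam p.2 * p.1 : ℝ)) * v p.1 p.2 := by
      have := hv.meas
      fun_prop
    have h3 : Continuous fun p : ℝ × (Rn 2 × (Rn 2 × Rn 2)) => third p.2.1 p.2.2 := by
      unfold third; fun_prop
    have h0' := h.comp (by fun_prop : Measurable fun p : ℝ × (Rn 2 × (Rn 2 × Rn 2)) => (p.1, p.2.1))
    have h1' := h.comp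
      (by fun_prop : Measurable fun p : ℝ × (Rn 2 × (Rn 2 × Rn 2)) => (p.1, p.2.2.1))
    have h2' := h.comp
      (by fun_prop : Measurable fun p : ℝ × (Rn 2 × (Rn 2 × Rn 2)) => (p.1, p.2.2.2))
    have h3' := h.comp (measurable_fst.prodMk h3.measurable)
    have hc := Complex.continuous_conj.measurable
    exact (hc.comp h0').mul ((h1'.mul (hc.comp h2')).mul h3')
  have hvar : ∀ z : Rn 2 × (Rn 2 × Rn 2),
      VarLE T (fun t => quarProfile v t z) (2 * (β z.1 * triEnv β z.1 z.2)) := fun z =>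
    (hv.var z.1).conj.mul hT (hv.varLE_triProfile hT z.1 z.2)
  have hi := hv.integrable_quarMult (N := N) hm hT
  have hmain := enorm_integral_oscTerm_le hT hθ (by linarith) hM hΨ hf hvar hi
  have hleft : ∀ t ∈ Ioc 0 T, ∫ z, oscTerm (quarMult m₁ N) (fun z => lam z.1 + triPhase z.1 z.2)
      (quarProfile v) t z = ∫ ξ, ((lam ξ * mN m₁ N ξ : ℝ) : ℂ) *
        ((starRingEnd ℂ) (v t ξ) * triForm (commMult m₁ N ξ) (v t) ξ) := by
    intro t ht
    have hit : Integrable fun z => oscTerm (quarMult m₁ N) (fun z => lam z.1 + triPhase z.1 z.2)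
        (quarProfile v) t z := by
      refine Integrable.mono' hi ((measurable_oscTerm hM hΨ hf).comp
        (measurable_const.prodMk measurable_id : Measurable fun z => (t, z))).aestronglyMeasurable
        (Filter.Eventually.of_forall fun z => norm_oscTerm_le hvar ⟨ht.1.le, ht.2⟩ z)
    rw [Measure.volume_eq_prod, integral_prod _ hit]
    congr 1; ext ξ
    unfold triForm
    rw [← integral_const_mul, ← integral_const_mul]
    congr 1; ext x
    rw [oscTerm_quarProfile]
    unfold quarMult
    push_cast; ring
  rw [← setIntegral_congr_fun measurableSet_Ioc hleft]
  refine hmain.trans ?_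
  have hright : ∫⁻ z : Rn 2 × (Rn 2 × Rn 2), ENNReal.ofReal (|quarMult m₁ N z| *
      (2 * (β z.1 * triEnv β z.1 z.2))) * ‖lam z.1 + triPhase z.1 z.2‖ₑ ^ (θ - 1) =
      ∫⁻ ξ, ∫⁻ x, ENNReal.ofReal 8 * quarTerm m₁ N θ β ξ x := by
    have hm1 : Measurable fun z : Rn 2 × (Rn 2 × Rn 2) => ENNReal.ofReal (|quarMult m₁ N z| *
      (2 * (β z.1 * triEnv β z.1 z.2))) :=
      ((continuous_abs.measurable.comp hM).mul (measurable_quarEnv hv.meas_env)).ennreal_ofReal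
    have hm2 : Measurable fun z : Rn 2 × (Rn 2 × Rn 2) => ENNReal.ofReal (|quarMult m₁ N z| *
      (2 * (β z.1 * triEnv β z.1 z.2))) * ‖lam z.1 + triPhase z.1 z.2‖ₑ ^ (θ - 1) :=
      hm1.mul ((measurable_enorm_rpow (θ - 1)).comp hΨ)
    rw [Measure.volume_eq_prod, lintegral_prod _ hm2.aemeasurable]
    refine lintegral_congr fun ξ => lintegral_congr fun x => ?_
    unfold quarTerm
    rw [← mul_assoc (ENNReal.ofReal 8), ← ENNReal.ofReal_mul (by norm_num)]
    congr 2
    have e : quarWeight m₁ N ξ x = |quarMult m₁ N (ξ, x)| := by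
      unfold quarWeight quarMult commMult
      rw [abs_mul, abs_mul, abs_of_nonneg (lam_nonneg _), abs_of_nonneg (mN_pos hm _).le]
    rw [e]
    unfold triEnv; ring
  rw [hright]
  simp only [lintegral_const_mul' _ _ ENNReal.ofReal_ne_top]
  refine (mul_le_mul' le_rfl (mul_le_mul' le_rfl
    (hC N hN β (hv.env_nonneg hT) hv.meas_env))).trans (le_of_eq ?_)
  rw [← mul_assoc, ← mul_assoc, ← ENNReal.ofReal_mul (by positivity),
    ← ENNReal.ofReal_mul (by positivity)]
  congr 2; ring

end QuarticTerm

section RapidFamily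

/-- A jointly continuous family of functions of the frequency, decaying faster than any
power uniformly in time. -/
structure RapidFamily (w : ℝ → Rn 2 → ℂ) : Prop where
  cont : Continuous fun p : ℝ × Rn 2 => w p.1 p.2
  decay : ∀ k : ℕ, ∃ C : ℝ, ∀ t ξ, jap ξ ^ k * ‖w t ξ‖ ≤ C

variable {s N T : ℝ} {m₁ : Rn 2 → ℝ} {w w' v : ℝ → Rn 2 → ℂ}

lemma RapidFamily.exists_norm_le (hw : RapidFamily w) (k : ℕ) :
    ∃ C : ℝ, 0 ≤ C ∧ ∀ t ξ, ‖w t ξ‖ ≤ C * (jap ξ ^ k)⁻¹ := by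
  obtain ⟨C, hC⟩ := hw.decay k
  refine ⟨C, le_trans (by have := jap_pos (0 : Rn 2); positivity) (hC 0 0), fun t ξ => ?_⟩
  rw [← div_eq_mul_inv, le_div_iff₀ (pow_pos (jap_pos ξ) k), mul_comm]
  exact hC t ξ

lemma RapidFamily.cont_time (hw : RapidFamily w) (ξ : Rn 2) : Continuous fun t => w t ξ :=
  hw.cont.comp (by fun_prop : Continuous fun t : ℝ => (t, ξ))

lemma RapidFamily.cont_space (hw : RapidFamily w) (t : ℝ) : Continuous (w t) :=
  hw.cont.comp (by fun_prop : Continuous fun ξ : Rn 2 => (t, ξ))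

lemma RapidFamily.add (hw : RapidFamily w) (hw' : RapidFamily w') :
    RapidFamily fun t ξ => w t ξ + w' t ξ := by
  refine ⟨hw.cont.add hw'.cont, fun k => ?_⟩
  obtain ⟨C, hC⟩ := hw.decay k
  obtain ⟨D, hD⟩ := hw'.decay k
  refine ⟨C + D, fun t ξ => ?_⟩
  have h := mul_le_mul_of_nonneg_left (norm_add_le (w t ξ) (w' t ξ)) (pow_pos (jap_pos ξ) k).le
  linarith [hC t ξ, hD t ξ]

lemma RapidFamily.mul {a : Rn 2 → ℂ} (hw : RapidFamily w) (ha : Continuous a) {D : ℝ} {j : ℕ}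
    (hD : ∀ ξ, ‖a ξ‖ ≤ D * jap ξ ^ j) : RapidFamily fun t ξ => a ξ * w t ξ := by
  refine ⟨(ha.comp continuous_snd).mul hw.cont, fun k => ?_⟩
  obtain ⟨C, hC⟩ := hw.decay (k + j)
  have hD0 : 0 ≤ D := by
    have h := (norm_nonneg _).trans (hD 0)
    exact nonneg_of_mul_nonneg_left h (pow_pos (jap_pos _) j)
  refine ⟨D * C, fun t ξ => ?_⟩
  have hj := jap_pos ξ
  rw [norm_mul]
  calc jap ξ ^ k * (‖a ξ‖ * ‖w t ξ‖) ≤ jap ξ ^ k * ((D * jap ξ ^ j) * ‖w t ξ‖) := by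
        gcongr; exact hD ξ
    _ = D * (jap ξ ^ (k + j) * ‖w t ξ‖) := by ring
    _ ≤ D * C := by gcongr; exact hC t ξ

lemma RapidFamily.mul_mN (hw : RapidFamily w) (hm : IsAdmissibleMultiplier 2 s m₁) (N : ℝ) :
    RapidFamily fun t ξ => (mN m₁ N ξ : ℂ) * w t ξ :=
  hw.mul (D := 1) (j := 0) (Complex.continuous_ofReal.comp (continuous_mN hm)) fun ξ => by
    simpa [abs_of_nonneg (mN_pos hm ξ).le] using mN_le_one hm ξ

lemma RapidFamily.mul_lam (hw : RapidFamily w) : RapidFamily fun t ξ => (lam ξ : ℂ) * w t ξ :=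
  hw.mul (D := 4 * Real.pi ^ 2) (j := 2) (Complex.continuous_ofReal.comp continuous_lam) fun ξ => by
    simpa [abs_of_nonneg (lam_nonneg ξ)] using lam_le_jap_sq ξ

lemma RapidFamily.const_mul (hw : RapidFamily w) (a : ℂ) : RapidFamily fun t ξ => a * w t ξ :=
  hw.mul (D := ‖a‖) (j := 0) continuous_const fun ξ => by simp

lemma jap_le_mul_jap_third (ξ : Rn 2) (x : Rn 2 × Rn 2) :
    jap ξ ≤ 8 * (jap x.1 * jap x.2 * jap (third ξ x)) := by
  have h1 := one_add_norm_le x.1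
  have h2 := one_add_norm_le x.2
  have h3 := one_add_norm_le (third ξ x)
  have e : ξ = x.1 - x.2 + third ξ x := by unfold third; abel
  have h4 : ‖ξ‖ ≤ ‖x.1‖ + ‖x.2‖ + ‖third ξ x‖ := by
    conv_lhs => rw [e]
    exact (norm_add_le _ _).trans (by gcongr; exact norm_sub_le _ _)
  have p1 := norm_nonneg x.1
  have p2 := norm_nonneg x.2
  have p3 := norm_nonneg (third ξ x)
  calc jap ξ ≤ 1 + ‖ξ‖ := jap_le ξ
    _ ≤ (1 + ‖x.1‖) * (1 + ‖x.2‖) * (1 + ‖third ξ x‖) := by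
        have := mul_nonneg p1 p2
        have := mul_nonneg p1 p3
        have := mul_nonneg p2 p3
        have := mul_nonneg (mul_nonneg p1 p2) p3
        nlinarith
    _ ≤ (2 * jap x.1) * (2 * jap x.2) * (2 * jap (third ξ x)) := by
        have j1 := jap_pos x.1
        have j2 := jap_pos x.2
        gcongr
    _ = _ := by ring

lemma RapidFamily.exists_norm_tri_le (hw : RapidFamily w) (k : ℕ) : ∃ D : ℝ, 0 ≤ D ∧
    ∀ t ξ (x : Rn 2 × Rn 2), jap ξ ^ k * ‖w t x.1 * (starRingEnd ℂ) (w t x.2) * w t (third ξ x)‖ ≤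
      D * ((jap x.1 ^ 3)⁻¹ * (jap x.2 ^ 3)⁻¹) := by
  obtain ⟨C, hC0, hC⟩ := hw.exists_norm_le (k + 3)
  obtain ⟨C', hC0', hC'⟩ := hw.exists_norm_le k
  refine ⟨8 ^ k * C * C * C', by positivity, fun t ξ x => ?_⟩
  have j1 := jap_pos x.1
  have j2 := jap_pos x.2
  have j3 := jap_pos (third ξ x)
  rw [norm_mul, norm_mul, RCLike.norm_conj]
  calc jap ξ ^ k * (‖w t x.1‖ * ‖w t x.2‖ * ‖w t (third ξ x)‖)
      ≤ (8 * (jap x.1 * jap x.2 * jap (third ξ x))) ^ k * ((C * (jap x.1 ^ (k + 3))⁻¹) *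
        (C * (jap x.2 ^ (k + 3))⁻¹) * (C' * (jap (third ξ x) ^ k)⁻¹)) := by
        gcongr
        · exact (jap_pos ξ).le
        · exact jap_le_mul_jap_third ξ x
        · exact hC _ _
        · exact hC _ _
        · exact hC' _ _
    _ = _ := by field_simp; ring

lemma integrable_jap_inv_prod :
    Integrable fun x : Rn 2 × Rn 2 => (jap x.1 ^ 3)⁻¹ * (jap x.2 ^ 3)⁻¹ :=
  (integrable_jap_inv_pow le_rfl).mul_prod (integrable_jap_inv_pow le_rfl)

lemma continuous_third_prod : Continuous fun z : Rn 2 × (Rn 2 × Rn 2) => third z.1 z.2 := by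
  unfold third; fun_prop

lemma RapidFamily.continuous_tri (hw : RapidFamily w) :
    Continuous fun q : (ℝ × Rn 2) × (Rn 2 × Rn 2) =>
      w q.1.1 q.2.1 * (starRingEnd ℂ) (w q.1.1 q.2.2) * w q.1.1 (third q.1.2 q.2) := by
  have h1 := hw.cont.comp
    (by fun_prop : Continuous fun q : (ℝ × Rn 2) × (Rn 2 × Rn 2) => (q.1.1, q.2.1))
  have h2 := hw.cont.comp
    (by fun_prop : Continuous fun q : (ℝ × Rn 2) × (Rn 2 × Rn 2) => (q.1.1, q.2.2))
  have h3' := continuous_third_prod.comp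
    (by fun_prop : Continuous fun q : (ℝ × Rn 2) × (Rn 2 × Rn 2) => (q.1.2, q.2))
  have h3 := hw.cont.comp
    ((by fun_prop : Continuous fun q : (ℝ × Rn 2) × (Rn 2 × Rn 2) => q.1.1).prodMk h3')
  exact (h1.mul (Complex.continuous_conj.comp h2)).mul h3

lemma RapidFamily.integrable_tri (hw : RapidFamily w) (t : ℝ) (ξ : Rn 2) :
    Integrable fun x : Rn 2 × Rn 2 => w t x.1 * (starRingEnd ℂ) (w t x.2) * w t (third ξ x) := by
  obtain ⟨D, hD0, hD⟩ := hw.exists_norm_tri_le 0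
  refine Integrable.mono' (integrable_jap_inv_prod.const_mul D) ?_
    (Filter.Eventually.of_forall fun x => by simpa using hD t ξ x)
  exact (hw.continuous_tri.comp (by fun_prop :
    Continuous fun x : Rn 2 × Rn 2 => ((t, ξ), x))).aestronglyMeasurable

/-- The Fourier transform of `|f|² f` in terms of that of `f`. -/
abbrev cubic (v : Rn 2 → ℂ) (ξ : Rn 2) : ℂ := triForm (fun _ => 1) v ξ

lemma cubic_eq (v : Rn 2 → ℂ) (ξ : Rn 2) :
    cubic v ξ = ∫ x : Rn 2 × Rn 2, v x.1 * (starRingEnd ℂ) (v x.2) * v (third ξ x) := by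
  simp [cubic, triForm]

lemma RapidFamily.cubicFamily (hw : RapidFamily w) : RapidFamily fun t ξ => cubic (w t) ξ := by
  simp only [cubic_eq]
  constructor
  · obtain ⟨D, hD0, hD⟩ := hw.exists_norm_tri_le 0
    refine continuous_of_dominated (bound := fun x => D * ((jap x.1 ^ 3)⁻¹ * (jap x.2 ^ 3)⁻¹))
      (fun p => ?_) (fun p => Filter.Eventually.of_forall fun x => by simpa using hD p.1 p.2 x)
      (integrable_jap_inv_prod.const_mul D) (Filter.Eventually.of_forall fun x => ?_)
    · exact (hw.integrable_tri p.1 p.2).aestronglyMeasurable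
    · exact hw.continuous_tri.comp (by fun_prop : Continuous fun p : ℝ × Rn 2 => (p, x))
  · intro k
    obtain ⟨D, hD0, hD⟩ := hw.exists_norm_tri_le k
    refine ⟨∫ x : Rn 2 × Rn 2, D * ((jap x.1 ^ 3)⁻¹ * (jap x.2 ^ 3)⁻¹), fun t ξ => ?_⟩
    have hj := pow_pos (jap_pos ξ) k
    calc _ ≤ jap ξ ^ k * ∫ x : Rn 2 × Rn 2,
          ‖w t x.1 * (starRingEnd ℂ) (w t x.2) * w t (third ξ x)‖ := by
          gcongr; exact norm_integral_le_integral_norm _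
      _ = ∫ x : Rn 2 × Rn 2, jap ξ ^ k *
          ‖w t x.1 * (starRingEnd ℂ) (w t x.2) * w t (third ξ x)‖ := by rw [integral_const_mul]
      _ ≤ _ := integral_mono ((hw.integrable_tri t ξ).norm.const_mul _)
          (integrable_jap_inv_prod.const_mul D) fun x => hD t ξ x

lemma RapidFamily.integrable_jap_mul (hw : RapidFamily w) (k : ℕ) (t : ℝ) :
    Integrable fun ξ => jap ξ ^ k * ‖w t ξ‖ := by
  obtain ⟨C, hC0, hC⟩ := hw.exists_norm_le (k + 3)
  refine Integrable.mono' ((integrable_jap_inv_pow le_rfl).const_mul C)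
    ((continuous_jap.pow k).mul (hw.cont_space t).norm).aestronglyMeasurable
    (Filter.Eventually.of_forall fun ξ => ?_)
  have hj := jap_pos ξ
  rw [Real.norm_of_nonneg (by positivity)]
  calc _ ≤ jap ξ ^ k * (C * (jap ξ ^ (k + 3))⁻¹) := by gcongr; exact hC t ξ
    _ = _ := by field_simp; ring

lemma RapidFamily.integrable (hw : RapidFamily w) (t : ℝ) : Integrable (w t) := by
  have h := hw.integrable_jap_mul 0 t
  simp only [pow_zero, one_mul] at h
  exact (integrable_norm_iff (hw.cont_space t).aestronglyMeasurable).1 h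

/-- The cubic Schrödinger equation on the Fourier side. -/
structure FourierSolution (T : ℝ) (v : ℝ → Rn 2 → ℂ) : Prop where
  fam : RapidFamily v
  deriv : ∀ ξ, ∀ t ∈ Ioo 0 T, HasDerivAt (fun t => v t ξ)
    (-(I * ((lam ξ : ℂ) * v t ξ + cubic (v t) ξ))) t

lemma FourierSolution.restrict (hv : FourierSolution T v) {t : ℝ} (ht : t ≤ T) :
    FourierSolution t v :=
  ⟨hv.fam, fun ξ τ hτ => hv.deriv ξ τ ⟨hτ.1, hτ.2.trans_le ht⟩⟩

/-- The envelope of a solution: initial size plus total nonlinear forcing. -/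
def env (v : ℝ → Rn 2 → ℂ) (T : ℝ) (ξ : Rn 2) : ℝ :=
  ‖v 0 ξ‖ + ∫ t in (0 : ℝ)..T, ‖cubic (v t) ξ‖

lemma RapidFamily.continuous_env (hv : RapidFamily v) :
    Continuous fun p : ℝ × Rn 2 => env v p.1 p.2 := by
  unfold env
  refine ((hv.cont_space 0).comp continuous_snd).norm.add ?_
  have h := hv.cubicFamily.cont.norm
  revert h
  generalize hf : (fun t ξ => ‖cubic (v t) ξ‖) = f
  have e : ∀ t ξ, ‖cubic (v t) ξ‖ = f t ξ := fun t ξ => congrFun (congrFun hf t) ξ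
  simp only [e]
  intro h
  have h' : Continuous (Function.uncurry fun (p : ℝ × Rn 2) (t : ℝ) => f t p.2) :=
    h.comp (by fun_prop : Continuous fun q : (ℝ × Rn 2) × ℝ => (q.2, q.1.2))
  exact intervalIntegral.continuous_parametric_intervalIntegral_of_continuous h' continuous_fst

lemma RapidFamily.exists_jap_env_le (hv : RapidFamily v) (k : ℕ) (T₀ : ℝ) :
    ∃ C, ∀ T ∈ Icc 0 T₀, ∀ ξ, jap ξ ^ k * env v T ξ ≤ C := by
  obtain ⟨C, hC⟩ := hv.decay k
  obtain ⟨D, hD⟩ := hv.cubicFamily.decay k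
  refine ⟨C + D * T₀, fun T hT ξ => ?_⟩
  have hD0 : 0 ≤ D := le_trans (by have := jap_pos (0 : Rn 2); positivity) (hD 0 0)
  unfold env
  rw [mul_add, ← intervalIntegral.integral_const_mul]
  refine add_le_add (hC 0 ξ) ?_
  have hc := hv.cubicFamily.cont_time ξ
  calc _ ≤ ∫ t in (0 : ℝ)..T, D :=
        intervalIntegral.integral_mono_on hT.1
          ((continuous_const.mul hc.norm).intervalIntegrable _ _)
          (continuous_const.intervalIntegrable _ _) fun t _ => hD t ξ
    _ = D * T := by simp; ring
    _ ≤ D * T₀ := by gcongr; exact hT.2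

lemma RapidFamily.env_nonneg (v : ℝ → Rn 2 → ℂ) (hT : 0 ≤ T) (ξ : Rn 2) : 0 ≤ env v T ξ :=
  add_nonneg (norm_nonneg _) (intervalIntegral.integral_nonneg hT fun _ _ => norm_nonneg _)

lemma FourierSolution.profile (hv : FourierSolution T v) (hT : 0 ≤ T) :
    Profile T v (env v T) := by
  refine ⟨hv.fam.cont.measurable, ?_, fun ξ => ⟨?_, fun t => cexp (I * (lam ξ * t : ℝ)) *
    -(I * cubic (v t) ξ), fun t ht => ?_, ?_, ?_⟩, ?_⟩
  · exact (hv.fam.continuous_env.comp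
      (by fun_prop : Continuous fun ξ : Rn 2 => (T, ξ))).measurable
  · have := hv.fam.cont_time ξ
    fun_prop
  · have h1 : HasDerivAt (fun t : ℝ => I * ((lam ξ * t : ℝ) : ℂ)) (I * (lam ξ : ℂ)) t := by
      have := ((hasDerivAt_id t).const_mul (lam ξ)).ofReal_comp.const_mul I
      simpa using this
    refine (h1.cexp.mul (hv.deriv ξ t ht)).congr_deriv ?_
    push_cast; ring
  · have := hv.fam.cubicFamily.cont_time ξ
    exact Continuous.intervalIntegrable (by fun_prop) _ _
  · refine le_of_eq ?_
    unfold env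
    congr 1
    · simp
    · congr 1; ext t
      rw [norm_mul, mul_comm I, Complex.norm_exp_ofReal_mul_I]
      simp
  · obtain ⟨C, hC⟩ := hv.fam.exists_jap_env_le 6 T
    exact ⟨C, hC T ⟨hT, le_rfl⟩⟩

end RapidFamily

section Bootstrap

variable {s N T θ κ : ℝ} {m₁ : Rn 2 → ℝ} {v : ℝ → Rn 2 → ℂ}

/-- The squared weighted norm of the envelope of a solution. -/
def envSq (m₁ : Rn 2 → ℝ) (N : ℝ) (v : ℝ → Rn 2 → ℂ) (T : ℝ) : ℝ≥0∞ :=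
  ∫⁻ ξ, ENNReal.ofReal (gw m₁ N ξ * env v T ξ) ^ 2

/-- The squared weighted space-time norm of the nonlinearity. -/
def forcingSq (m₁ : Rn 2 → ℝ) (N : ℝ) (v : ℝ → Rn 2 → ℂ) (T : ℝ) : ℝ≥0∞ :=
  ∫⁻ ξ, ∫⁻ t in Ioc 0 T, ENNReal.ofReal (gw m₁ N ξ * ‖cubic (v t) ξ‖) ^ 2

lemma triForm_const (a : ℝ) (v : Rn 2 → ℂ) (ξ : Rn 2) :
    triForm (fun _ => a) v ξ = a * cubic v ξ := by
  simp only [cubic, triForm, Complex.ofReal_one, one_mul]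
  rw [integral_const_mul]

lemma exists_forcingSq_le (hs0 : 0 < s) (hs1 : s < 1) (hm : IsAdmissibleMultiplier 2 s m₁)
    (hθ : 0 < θ) (hθκ : θ < κ) (hκ : κ < 1) (hκs : 1 / 2 + κ ≤ s) :
    ∃ C : ℝ, 0 ≤ C ∧ ∀ N : ℝ, 1 ≤ N → ∀ {T : ℝ} {v : ℝ → Rn 2 → ℂ}, FourierSolution T v → 0 ≤ T →
      forcingSq m₁ N v T ≤ ENNReal.ofReal (C * T ^ θ) * envSq m₁ N v T ^ 3 := by
  obtain ⟨C, hC0, hC⟩ := exists_lintegral_triForm_sq_le hθ hθκ hκ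
  refine ⟨C * 192 ^ 2, by positivity, fun N hN T v hv hT => ?_⟩
  have h := hC (hv.profile hT) hT (continuous_gw (N := N) hm).measurable
    (fun ξ => (gw_pos hm ξ).le) (A := 192) (by norm_num) (M := fun ξ _ => gw m₁ N ξ)
    (fun ξ => measurable_const) (fun ξ => ⟨|gw m₁ N ξ|, fun _ => le_rfl⟩) (fun ξ x => by
      rw [abs_of_pos (gw_pos hm ξ)]
      exact gw_le_pairWeight hs0 hs1 hm hN hκs (by unfold third; abel))
  refine le_trans (le_of_eq ?_) h
  unfold forcingSq
  refine lintegral_congr fun ξ => lintegral_congr fun t => ?_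
  rw [triForm_const, ← ofReal_norm, norm_mul, Complex.norm_real,
    Real.norm_of_nonneg (gw_pos hm ξ).le]

lemma sq_integral_le (hT : 0 ≤ T) {f : ℝ → ℝ} (hf : Continuous f) (hf0 : ∀ t, 0 ≤ f t) :
    ENNReal.ofReal (∫ t in (0 : ℝ)..T, f t) ^ 2 ≤
      ENNReal.ofReal T * ∫⁻ t in Ioc 0 T, ENNReal.ofReal (f t) ^ 2 := by
  have h := ENNReal.lintegral_mul_le_Lp_mul_Lq (volume.restrict (Ioc 0 T))
    (Real.HolderConjugate.two_two) (f := fun _ => 1) (g := fun t => ENNReal.ofReal (f t))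
    aemeasurable_const hf.measurable.ennreal_ofReal.aemeasurable
  have e : ENNReal.ofReal (∫ t in (0 : ℝ)..T, f t) = ∫⁻ t in Ioc 0 T, ENNReal.ofReal (f t) := by
    rw [intervalIntegral.integral_of_le hT, ofReal_integral_eq_lintegral_ofReal
      ((hf.intervalIntegrable 0 T).1) (Filter.Eventually.of_forall hf0)]
  simp only [Pi.mul_apply, one_mul, lintegral_const, MeasurableSet.univ,
    Measure.restrict_apply, univ_inter, Real.volume_Ioc, sub_zero, ENNReal.rpow_ofNat] at h
  rw [e]
  calc _ ≤ _ := pow_le_pow_left₀ (by simp) h 2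
    _ = _ := by
      rw [mul_pow, ← ENNReal.rpow_mul_natCast, ← ENNReal.rpow_mul_natCast]
      norm_num

lemma ennreal_add_sq_le (a b : ℝ≥0∞) : (a + b) ^ 2 ≤ 2 * a ^ 2 + 2 * b ^ 2 := by
  have h := ENNReal.rpow_add_le_mul_rpow_add_rpow a b (p := 2) (by norm_num)
  norm_num at h
  rwa [mul_add] at h

lemma envSq_le (hm : IsAdmissibleMultiplier 2 s m₁) (hv : RapidFamily v) (hT : 0 ≤ T) :
    envSq m₁ N v T ≤ 2 * envSq m₁ N v 0 + ENNReal.ofReal (2 * T) * forcingSq m₁ N v T := by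
  have hg := (continuous_gw (N := N) hm)
  unfold envSq forcingSq
  rw [← lintegral_const_mul' _ _ (by simp), ← lintegral_const_mul' _ _ ENNReal.ofReal_ne_top,
    ← lintegral_add_left]
  · refine lintegral_mono fun ξ => ?_
    have hg0 := (gw_pos (N := N) hm ξ).le
    have hc := (hv.cubicFamily.cont_time ξ).norm
    have h_int : 0 ≤ ∫ t in (0 : ℝ)..T, gw m₁ N ξ * ‖cubic (v t) ξ‖ :=
      intervalIntegral.integral_nonneg hT fun t _ => by positivity
    have h1 : gw m₁ N ξ * env v T ξ = gw m₁ N ξ * env v 0 ξ +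
        ∫ t in (0 : ℝ)..T, gw m₁ N ξ * ‖cubic (v t) ξ‖ := by
      unfold env; rw [intervalIntegral.integral_const_mul]; simp; ring
    have h2 := sq_integral_le hT (continuous_const.mul hc : Continuous fun t =>
      gw m₁ N ξ * ‖cubic (v t) ξ‖) fun t => mul_nonneg hg0 (norm_nonneg _)
    simp only
    rw [h1, ENNReal.ofReal_add (mul_nonneg hg0 (RapidFamily.env_nonneg v le_rfl ξ)) h_int]
    refine (ennreal_add_sq_le _ _).trans (add_le_add le_rfl ?_)
    rw [← two_mul_ofReal, mul_assoc]
    exact mul_le_mul' le_rfl h2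
  · have := (hv.continuous_env.comp (by fun_prop : Continuous fun ξ : Rn 2 => ((0 : ℝ), ξ)))
    exact (((hg.mul this).measurable.ennreal_ofReal).pow_const 2).const_mul 2

lemma exists_envSq_eq (hm : IsAdmissibleMultiplier 2 s m₁) (hv : RapidFamily v) (T : ℝ) (N : ℝ) :
    ∃ y : ℝ → ℝ, ContinuousOn y (Icc 0 T) ∧ (∀ t ∈ Icc 0 T, 0 ≤ y t) ∧
      ∀ t ∈ Icc 0 T, envSq m₁ N v t = ENNReal.ofReal (y t) := by
  have hg := (continuous_gw (N := N) hm)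
  obtain ⟨C, hC⟩ := hv.exists_jap_env_le 4 T
  have hbound : ∀ t ∈ Icc 0 T, ∀ ξ, ‖(gw m₁ N ξ * env v t ξ) ^ 2‖ ≤ C ^ 2 * (jap ξ ^ 3)⁻¹ := by
    intro t ht ξ
    have h0 := RapidFamily.env_nonneg v ht.1 ξ
    have hj := jap_pos ξ
    have h1 : gw m₁ N ξ * env v t ξ ≤ C * (jap ξ ^ 3)⁻¹ := by
      rw [← div_eq_mul_inv, le_div_iff₀ (by positivity)]
      calc gw m₁ N ξ * env v t ξ * jap ξ ^ 3 ≤ jap ξ * env v t ξ * jap ξ ^ 3 := by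
            gcongr; exact gw_le_jap hm ξ
        _ = jap ξ ^ 4 * env v t ξ := by ring
        _ ≤ C := hC t ht ξ
    have h2 : 0 ≤ gw m₁ N ξ * env v t ξ := mul_nonneg (gw_pos hm ξ).le h0
    rw [Real.norm_of_nonneg (by positivity)]
    calc _ ≤ (C * (jap ξ ^ 3)⁻¹) ^ 2 := by gcongr
      _ = C ^ 2 * ((jap ξ ^ 3)⁻¹ * (jap ξ ^ 3)⁻¹) := by ring
      _ ≤ C ^ 2 * ((jap ξ ^ 3)⁻¹ * 1) := by
        gcongr
        exact inv_le_one_of_one_le₀ (one_le_pow₀ (one_le_jap ξ))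
      _ = _ := by ring
  have hcont : ∀ t, Continuous fun ξ => (gw m₁ N ξ * env v t ξ) ^ 2 := fun t =>
    (hg.mul (hv.continuous_env.comp (by fun_prop : Continuous fun ξ : Rn 2 => (t, ξ)))).pow 2
  have h_int := (integrable_jap_inv_pow le_rfl).const_mul (C ^ 2)
  refine ⟨fun t => ∫ ξ, (gw m₁ N ξ * env v t ξ) ^ 2, ?_, fun t _ => by positivity, fun t ht => ?_⟩
  · refine continuousOn_of_dominated (fun t _ => (hcont t).aestronglyMeasurable)
      (fun t ht => Filter.Eventually.of_forall (hbound t ht)) h_int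
      (Filter.Eventually.of_forall fun ξ => Continuous.continuousOn ?_)
    exact (continuous_const.mul
      (hv.continuous_env.comp (by fun_prop : Continuous fun t : ℝ => (t, ξ)))).pow 2
  · rw [ofReal_integral_eq_lintegral_ofReal (Integrable.mono' h_int (hcont t).aestronglyMeasurable
      (Filter.Eventually.of_forall (hbound t ht))) (Filter.Eventually.of_forall fun ξ => sq_nonneg _)]
    unfold envSq
    refine lintegral_congr fun ξ => ?_
    rw [ENNReal.ofReal_pow (mul_nonneg (gw_pos hm ξ).le (RapidFamily.env_nonneg v ht.1 ξ))]

/-- A continuity argument for a quantity satisfying a cubic self-bound. -/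
lemma le_two_mul_of_cubic_bound {y : ℝ → ℝ} {A K : ℝ} (hT : 0 ≤ T) (hy : ContinuousOn y (Icc 0 T))
    (hA : 0 < A) (h0 : y 0 ≤ A)
    (hle : ∀ t ∈ Icc 0 T, y t ≤ A + K * y t ^ 3) (hK : 8 * K * A ^ 2 < 1) : y T ≤ 2 * A := by
  by_contra! hlt
  obtain ⟨t, ht, hyt⟩ := intermediate_value_Icc hT hy
    (⟨by linarith, hlt.le⟩ : 2 * A ∈ Icc (y 0) (y T))
  have h := hle t ht
  rw [hyt] at h
  nlinarith

lemma exists_bootstrap (hs0 : 0 < s) (hs1 : s < 1) (hm : IsAdmissibleMultiplier 2 s m₁)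
    (hθ : 0 < θ) (hθκ : θ < κ) (hκ : κ < 1) (hκs : 1 / 2 + κ ≤ s) :
    ∃ C : ℝ, 0 ≤ C ∧ ∀ N : ℝ, 1 ≤ N → ∀ {T : ℝ} {v : ℝ → Rn 2 → ℂ}, FourierSolution T v → 0 ≤ T →
      ∀ A : ℝ, 0 < A → 2 * envSq m₁ N v 0 ≤ ENNReal.ofReal A → C * T ^ (1 + θ) * A ^ 2 < 1 →
      envSq m₁ N v T ≤ ENNReal.ofReal (2 * A) := by
  obtain ⟨C, hC0, hC⟩ := exists_forcingSq_le hs0 hs1 hm hθ hθκ hκ hκs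
  refine ⟨16 * C, by positivity, fun N hN T v hv hT A hA hA0 hsmall => ?_⟩
  obtain ⟨y, hyc, hy0, hy⟩ := exists_envSq_eq hm hv.fam T N
  rw [hy T ⟨hT, le_rfl⟩]
  refine ENNReal.ofReal_le_ofReal (le_two_mul_of_cubic_bound (K := 2 * C * T ^ (1 + θ)) hT hyc hA
    ?_ (fun t ht => ?_) (by linarith))
  · have h0 : (0 : ℝ) ∈ Icc 0 T := ⟨le_rfl, hT⟩
    rw [hy 0 h0, two_mul_ofReal] at hA0
    have := (ENNReal.ofReal_le_ofReal_iff hA.le).1 hA0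
    linarith [hy0 0 h0]
  · have h1 := envSq_le (N := N) hm hv.fam ht.1
    have h2 := hC N hN (hv.restrict ht.2) ht.1
    have hyt := hy0 t ht
    have h3 := h1.trans (add_le_add hA0 (mul_le_mul' le_rfl h2))
    have htθ : 0 ≤ t ^ θ := Real.rpow_nonneg ht.1 θ
    rw [hy t ht, ← ENNReal.ofReal_pow hyt, ← ENNReal.ofReal_mul (by positivity),
      ← ENNReal.ofReal_mul (by linarith [ht.1]),
      ← ENNReal.ofReal_add hA.le (by have := ht.1; positivity)] at h3
    have ht0 := ht.1
    have h4 := (ENNReal.ofReal_le_ofReal_iff (by positivity)).1 h3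
    refine h4.trans (add_le_add le_rfl ?_)
    have e : t * t ^ θ ≤ T ^ (1 + θ) := by
      rw [← Real.rpow_one_add' ht.1 (by linarith)]
      exact Real.rpow_le_rpow ht.1 ht.2 (by linarith)
    calc _ = 2 * C * (t * t ^ θ) * y t ^ 3 := by ring
      _ ≤ _ := by gcongr

end Bootstrap

section Increment

variable {s N T θ κ : ℝ} {m₁ : Rn 2 → ℝ} {v : ℝ → Rn 2 → ℂ}

/-- The commutator of the smoothing multiplier with the cubic nonlinearity, in frequency. -/
def commTerm (m₁ : Rn 2 → ℝ) (N : ℝ) (v : Rn 2 → ℂ) (ξ : Rn 2) : ℂ :=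
  triForm (commMult m₁ N ξ) v ξ

lemma RapidFamily.commTerm_eq (hv : RapidFamily v) (hm : IsAdmissibleMultiplier 2 s m₁) (t : ℝ)
    (ξ : Rn 2) : commTerm m₁ N (v t) ξ =
      mN m₁ N ξ * cubic (v t) ξ - cubic (fun ξ => (mN m₁ N ξ : ℂ) * v t ξ) ξ := by
  unfold commTerm
  rw [cubic_eq, cubic_eq, triForm, ← integral_const_mul,
    ← integral_sub ((hv.integrable_tri t ξ).const_mul _) ((hv.mul_mN hm N).integrable_tri t ξ)]
  congr 1; ext x
  simp only [commMult, map_mul, Complex.conj_ofReal]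
  push_cast; ring

lemma RapidFamily.commFamily (hv : RapidFamily v) (hm : IsAdmissibleMultiplier 2 s m₁) (N : ℝ) :
    RapidFamily fun t ξ => commTerm m₁ N (v t) ξ := by
  simp only [hv.commTerm_eq hm]
  have h := (hv.cubicFamily.mul_mN hm N).add ((hv.mul_mN hm N).cubicFamily.const_mul (-1))
  simpa [sub_eq_add_neg] using h

/-- The squared norm of the commutator, with one derivative gained. -/
def commSq (m₁ : Rn 2 → ℝ) (N : ℝ) (v : ℝ → Rn 2 → ℂ) (T : ℝ) : ℝ≥0∞ :=
  ∫⁻ ξ, ∫⁻ t in Ioc 0 T, ENNReal.ofReal ((jap ξ)⁻¹ * ‖commTerm m₁ N (v t) ξ‖) ^ 2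

lemma triForm_const_mul (a : ℝ) (M : Rn 2 × Rn 2 → ℝ) (v : Rn 2 → ℂ) (ξ : Rn 2) :
    triForm (fun x => a * M x) v ξ = a * triForm M v ξ := by
  unfold triForm
  rw [← integral_const_mul]
  congr 1; ext x; push_cast; ring

lemma exists_commSq_le (hs0 : 0 < s) (hs1 : s < 1) (hm : IsAdmissibleMultiplier 2 s m₁)
    (hθ : 0 < θ) (hθκ : θ < κ) (hκ : κ < 1) (hκs : 1 / 2 + κ ≤ s) :
    ∃ C : ℝ, 0 ≤ C ∧ ∀ N : ℝ, 1 ≤ N → ∀ {T : ℝ} {v : ℝ → Rn 2 → ℂ}, FourierSolution T v → 0 ≤ T →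
      commSq m₁ N v T ≤
        ENNReal.ofReal (C * (N ^ (-(3 / 2 - κ))) ^ 2 * T ^ θ) * envSq m₁ N v T ^ 3 := by
  obtain ⟨C, hC0, hC⟩ := exists_lintegral_triForm_sq_le hθ hθκ hκ
  obtain ⟨D, hD0, hD⟩ := exists_comm_pairWeight_le hs0 hs1 hm (hθ.trans hθκ).le hκs
  refine ⟨C * D ^ 2, by positivity, fun N hN T v hv hT => ?_⟩
  have hN0 : 0 < N := by linarith
  have h := hC (hv.profile hT) hT (continuous_gw (N := N) hm).measurable
    (fun ξ => (gw_pos hm ξ).le) (A := D * N ^ (-(3 / 2 - κ))) (by positivity)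
    (M := fun ξ x => (jap ξ)⁻¹ * commMult m₁ N ξ x)
    (fun ξ => (measurable_commMult hm ξ).const_mul _) (fun ξ => ⟨(jap ξ)⁻¹, fun x => by
      have hj := inv_pos.2 (jap_pos ξ)
      rw [abs_mul, abs_of_pos hj]
      exact mul_le_of_le_one_right hj.le (abs_commMult_le_one hm ξ x)⟩) (fun ξ x => by
      have hj := inv_pos.2 (jap_pos ξ)
      rw [abs_mul, abs_of_pos hj]
      exact hD N hN x.1 x.2 (third ξ x) ξ (by unfold third; abel))
  refine le_trans (le_of_eq ?_) (h.trans (le_of_eq ?_))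
  · unfold commSq
    refine lintegral_congr fun ξ => lintegral_congr fun t => ?_
    have hj := inv_pos.2 (jap_pos ξ)
    rw [triForm_const_mul, ← ofReal_norm, norm_mul, Complex.norm_real,
      Real.norm_of_nonneg hj.le]
    rfl
  · unfold envSq
    rw [mul_pow]; congr 2; ring

/-- The contribution to the energy increment that is quartic in the solution. -/
def quarticIncr (m₁ : Rn 2 → ℝ) (N : ℝ) (v : ℝ → Rn 2 → ℂ) (T : ℝ) : ℂ :=
  ∫ t in Ioc 0 T, ∫ ξ, ((lam ξ * mN m₁ N ξ : ℝ) : ℂ) *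
    ((starRingEnd ℂ) (v t ξ) * commTerm m₁ N (v t) ξ)

/-- The contribution to the energy increment that is sextic in the solution. -/
def sexticIncr (m₁ : Rn 2 → ℝ) (N : ℝ) (v : ℝ → Rn 2 → ℂ) (T : ℝ) : ℂ :=
  ∫ t in Ioc 0 T, ∫ ξ, (mN m₁ N ξ : ℂ) *
    (commTerm m₁ N (v t) ξ * (starRingEnd ℂ) (cubic (v t) ξ))

lemma enorm_sexticIncr_le (hm : IsAdmissibleMultiplier 2 s m₁) (hv : RapidFamily v) {r : ℝ}
    (hr : 0 < r) : ‖sexticIncr m₁ N v T‖ₑ ≤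
      ENNReal.ofReal r⁻¹ * commSq m₁ N v T + ENNReal.ofReal r * forcingSq m₁ N v T := by
  have hm' := continuous_mN (N := N) hm
  have hg := continuous_gw (N := N) hm
  have hc := hv.cubicFamily.cont
  have he := (hv.commFamily hm N).cont
  have hmeas : Measurable fun p : ℝ × Rn 2 => ‖(mN m₁ N p.2 : ℂ) *
      (commTerm m₁ N (v p.1) p.2 *
        (starRingEnd ℂ) (cubic (v p.1) p.2))‖ₑ := by
    refine Measurable.enorm (Continuous.measurable ?_)
    exact (Complex.continuous_ofReal.comp (hm'.comp continuous_snd)).mul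
      (he.mul (Complex.continuous_conj.comp hc))
  have hmc : Measurable fun p : Rn 2 × ℝ =>
      ENNReal.ofReal ((jap p.1)⁻¹ * ‖commTerm m₁ N (v p.2) p.1‖) ^ 2 := by
    refine ((Measurable.ennreal_ofReal ?_).pow_const 2)
    exact ((continuous_jap.comp continuous_fst).measurable.inv).mul
      (he.comp continuous_swap).norm.measurable
  have hmf : Measurable fun p : Rn 2 × ℝ =>
      ENNReal.ofReal (gw m₁ N p.1 * ‖cubic (v p.2) p.1‖) ^ 2 := by
    refine ((Measurable.ennreal_ofReal ?_).pow_const 2)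
    exact ((hg.comp continuous_fst).mul (hc.comp continuous_swap).norm).measurable
  calc ‖sexticIncr m₁ N v T‖ₑ ≤ ∫⁻ t in Ioc 0 T, ∫⁻ ξ, ‖(mN m₁ N ξ : ℂ) *
        (commTerm m₁ N (v t) ξ *
          (starRingEnd ℂ) (cubic (v t) ξ))‖ₑ :=
        (enorm_integral_le_lintegral_enorm _).trans
          (lintegral_mono fun t => enorm_integral_le_lintegral_enorm _)
    _ = ∫⁻ ξ, ∫⁻ t in Ioc 0 T, ‖(mN m₁ N ξ : ℂ) *
        (commTerm m₁ N (v t) ξ *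
          (starRingEnd ℂ) (cubic (v t) ξ))‖ₑ :=
        lintegral_lintegral_swap hmeas.aemeasurable
    _ ≤ ∫⁻ ξ, ∫⁻ t in Ioc 0 T,
          (ENNReal.ofReal r⁻¹ *
            ENNReal.ofReal ((jap ξ)⁻¹ * ‖commTerm m₁ N (v t) ξ‖) ^ 2 +
          ENNReal.ofReal r *
            ENNReal.ofReal (gw m₁ N ξ * ‖cubic (v t) ξ‖) ^ 2) := by
        refine lintegral_mono fun ξ => lintegral_mono fun t => ?_
        have hj := jap_pos ξ
        have hmp := mN_pos (N := N) hm ξ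
        have hgp := gw_pos (N := N) hm ξ
        set a := (jap ξ)⁻¹ * ‖commTerm m₁ N (v t) ξ‖ with ha
        set b := gw m₁ N ξ * ‖cubic (v t) ξ‖ with hb
        have ha0 : 0 ≤ a := by positivity
        have hb0 : 0 ≤ b := by positivity
        have e : ‖(mN m₁ N ξ : ℂ) * (commTerm m₁ N (v t) ξ *
            (starRingEnd ℂ) (cubic (v t) ξ))‖ = a * b := by
          rw [norm_mul, norm_mul, RCLike.norm_conj, Complex.norm_real,
            Real.norm_of_nonneg hmp.le, ha, hb, gw]
          field_simp
        simp only
        rw [← ofReal_norm, e, ← ENNReal.ofReal_pow ha0, ← ENNReal.ofReal_pow hb0,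
          ← ENNReal.ofReal_mul (by positivity), ← ENNReal.ofReal_mul hr.le,
          ← ENNReal.ofReal_add (by positivity) (by positivity)]
        refine ENNReal.ofReal_le_ofReal ?_
        have h1 : 0 ≤ r⁻¹ * ((a - r * b) ^ 2 + r * (a * b)) := by positivity
        have h2 : r⁻¹ * ((a - r * b) ^ 2 + r * (a * b)) = r⁻¹ * a ^ 2 + r * b ^ 2 - a * b := by
          field_simp; ring
        linarith
    _ = _ := by
        unfold commSq forcingSq
        rw [← lintegral_const_mul' _ _ ENNReal.ofReal_ne_top,
          ← lintegral_const_mul' _ _ ENNReal.ofReal_ne_top, ← lintegral_add_left]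
        · refine lintegral_congr fun ξ => ?_
          rw [← lintegral_const_mul' _ _ ENNReal.ofReal_ne_top,
            ← lintegral_const_mul' _ _ ENNReal.ofReal_ne_top, ← lintegral_add_left]
          exact (hmc.comp measurable_prodMk_left).const_mul _
        · exact hmc.lintegral_prod_right'.const_mul _

lemma exists_increment_le (hs1 : s < 1) (hm : IsAdmissibleMultiplier 2 s m₁)
    (hκ0 : 0 < κ) (hκ : κ < 1) (hκs : 1 / 2 + κ ≤ s) :
    ∃ K : ℝ, 0 ≤ K ∧ ∀ N : ℝ, 1 ≤ N → ∀ {T : ℝ} {v : ℝ → Rn 2 → ℂ}, FourierSolution T v → 0 ≤ T →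
      ∀ A : ℝ, 0 < A → 2 * envSq m₁ N v 0 ≤ ENNReal.ofReal A → K * T ^ (1 + κ / 3) * A ^ 2 < 1 →
      ‖quarticIncr m₁ N v T‖ + ‖sexticIncr m₁ N v T‖ ≤
        K * T ^ (κ / 3) * (A ^ 2 + A ^ 3) * N ^ (-(3 / 2 - κ)) := by
  have hs0 : 0 < s := by linarith
  have hθ : 0 < κ / 3 := by positivity
  have hθκ : κ / 3 < κ := by linarith
  obtain ⟨C₁, h₁0, h₁⟩ := exists_bootstrap hs0 hs1 hm hθ hθκ hκ hκs
  obtain ⟨C₂, h₂0, h₂⟩ := exists_enorm_quartic_le (by linarith : 1 / 2 ≤ s) hs1 hm hθ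
    (by linarith)
  obtain ⟨C₃, h₃0, h₃⟩ := exists_commSq_le hs0 hs1 hm hθ hθκ hκ hκs
  obtain ⟨C₄, h₄0, h₄⟩ := exists_forcingSq_le hs0 hs1 hm hθ hθκ hκ hκs
  refine ⟨C₁ + 4 * C₂ + 8 * C₃ + 8 * C₄, by positivity, fun N hN T v hv hT A hA hA0 hsm => ?_⟩
  have hN0 : 0 < N := by linarith
  have hTθ : 0 ≤ T ^ (κ / 3) := Real.rpow_nonneg hT _
  have hTθ1 : 0 ≤ T ^ (1 + κ / 3) := Real.rpow_nonneg hT _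
  set r := N ^ (-(3 / 2 - κ)) with hr
  have hr0 : 0 < r := Real.rpow_pos_of_pos hN0 _
  have hB := h₁ N hN hv hT A hA hA0 (lt_of_le_of_lt (by gcongr; linarith) hsm)
  have hq := h₂ N hN (hv.profile hT) hT
  have e3 : 3 / 2 - 3 * (κ / 3) = 3 / 2 - κ := by ring
  rw [e3, ← hr] at hq
  have hq' : ‖quarticIncr m₁ N v T‖ ≤ C₂ * T ^ (κ / 3) * r * (2 * A) ^ 2 := by
    have h5 := hq.trans (mul_le_mul' le_rfl (pow_le_pow_left₀ zero_le hB 2))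
    rw [← ENNReal.ofReal_pow (by positivity), ← ENNReal.ofReal_mul (by positivity),
      ← ofReal_norm] at h5
    exact (ENNReal.ofReal_le_ofReal_iff (by positivity)).1 h5
  have hs' : ‖sexticIncr m₁ N v T‖ ≤ r⁻¹ * (C₃ * r ^ 2 * T ^ (κ / 3) * (2 * A) ^ 3) +
      r * (C₄ * T ^ (κ / 3) * (2 * A) ^ 3) := by
    have hB3 := pow_le_pow_left₀ zero_le hB 3
    have h5 := (enorm_sexticIncr_le (N := N) (T := T) hm hv.fam hr0).trans
      (add_le_add (mul_le_mul' le_rfl ((h₃ N hN hv hT).trans (mul_le_mul' le_rfl hB3)))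
        (mul_le_mul' le_rfl ((h₄ N hN hv hT).trans (mul_le_mul' le_rfl hB3))))
    rw [← ENNReal.ofReal_pow (by positivity), ← ENNReal.ofReal_mul (by positivity),
      ← ENNReal.ofReal_mul (by positivity), ← ENNReal.ofReal_mul (by positivity),
      ← ENNReal.ofReal_mul (by positivity), ← ENNReal.ofReal_add (by positivity) (by positivity),
      ← ofReal_norm] at h5
    exact (ENNReal.ofReal_le_ofReal_iff (by positivity)).1 h5
  have e1 : r⁻¹ * (C₃ * r ^ 2 * T ^ (κ / 3) * (2 * A) ^ 3) + r * (C₄ * T ^ (κ / 3) * (2 * A) ^ 3) =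
      (8 * C₃ + 8 * C₄) * T ^ (κ / 3) * A ^ 3 * r := by
    field_simp; ring
  have e2 : C₂ * T ^ (κ / 3) * r * (2 * A) ^ 2 = 4 * C₂ * T ^ (κ / 3) * A ^ 2 * r := by ring
  rw [e1] at hs'
  rw [e2] at hq'
  calc _ ≤ 4 * C₂ * T ^ (κ / 3) * A ^ 2 * r +
        (8 * C₃ + 8 * C₄) * T ^ (κ / 3) * A ^ 3 * r := add_le_add hq' hs'
    _ ≤ (C₁ + 4 * C₂ + 8 * C₃ + 8 * C₄) * T ^ (κ / 3) * A ^ 2 * r +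
        (C₁ + 4 * C₂ + 8 * C₃ + 8 * C₄) * T ^ (κ / 3) * A ^ 3 * r := by
        gcongr <;> linarith
    _ = _ := by ring

end Increment

section

/-- The inverse Fourier transform is self-adjoint for the bilinear pairing. -/
lemma integral_fourierInv_mul {f g : Rn 2 → ℂ} (hf : Integrable f) (hg : Integrable g) :
    ∫ x, 𝓕⁻ f x * g x = ∫ ξ, f ξ * 𝓕⁻ g ξ := by
  have h := VectorFourier.integral_fourierIntegral_smul_eq_flip (μ := volume) (ν := volume)
    (L := -innerₗ (Rn 2)) (f := f) (g := g) Real.continuous_fourierChar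
    (continuous_inner.neg : Continuous fun p : Rn 2 × Rn 2 => -⟪p.1, p.2⟫) hf hg
  simp only [smul_eq_mul] at h
  convert! h using 3 with x x
  · simp [Real.fourierInv_eq, VectorFourier.fourierIntegral, real_inner_comm]

lemma continuous_fourierInv {f : Rn 2 → ℂ} (hf : Integrable f) : Continuous (𝓕⁻ f) := by
  have h : 𝓕⁻ f = fun x => 𝓕 f (-x) := by
    ext x; rw [Real.fourierInv_eq_fourier_neg]
  rw [h]
  have h' : Continuous (𝓕 f) := VectorFourier.fourierIntegral_continuous (L := innerₗ (Rn 2))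
    Real.continuous_fourierChar continuous_inner hf
  exact h'.comp continuous_neg

lemma norm_fourierInv_le (f : Rn 2 → ℂ) (x : Rn 2) : ‖𝓕⁻ f x‖ ≤ ∫ ξ, ‖f ξ‖ := by
  rw [Real.fourierInv_eq]
  refine (norm_integral_le_integral_norm _).trans_eq ?_
  simp

/-- On `L¹ ∩ L²` the `L²` inverse Fourier transform is given by the integral. -/
lemma fourierInv_toLp_ae_eq {f : Rn 2 → ℂ} (hf : Integrable f) (hf2 : MemLp f 2) :
    (𝓕⁻ (hf2.toLp f) : Lp ℂ 2 (volume : Measure (Rn 2))) =ᵐ[volume] 𝓕⁻ f := by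
  refine ae_eq_of_integral_contDiff_smul_eq
    ((Lp.memLp _).locallyIntegrable (by norm_num))
    ((continuous_fourierInv hf).locallyIntegrable) fun g hg hgc => ?_
  have hgc' : HasCompactSupport (fun x => (g x : ℂ)) := hgc.comp_left Complex.ofReal_zero
  have hg' : ContDiff ℝ (⊤ : ℕ∞) (fun x => (g x : ℂ)) := Complex.ofRealCLM.contDiff.comp hg
  let G : SchwartzMap (Rn 2) ℂ := hgc'.toSchwartzMap hg'
  have hG : ∀ x, G x = g x := fun x => rfl
  have h1 := congrArg (fun D => D G)
    (MeasureTheory.Lp.fourierInv_toTemperedDistribution_eq (hf2.toLp f))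
  simp only [TemperedDistribution.fourierInv_apply, Lp.toTemperedDistribution_apply] at h1
  have h2 : ∫ x, (𝓕⁻ G) x • (hf2.toLp f) x = ∫ x, f x * 𝓕⁻ (⇑G) x := by
    refine integral_congr_ae ?_
    filter_upwards [hf2.coeFn_toLp] with x hx
    rw [hx, smul_eq_mul, mul_comm, SchwartzMap.fourierInv_coe]
  rw [h2, ← integral_fourierInv_mul hf G.integrable] at h1
  simp only [hG] at h1
  simp only [Complex.real_smul]
  simp only [smul_eq_mul] at h1
  rw [← h1]
  simp only [mul_comm]

lemma memLp_fourierInv {f : Rn 2 → ℂ} (hf : Integrable f) (hf2 : MemLp f 2) :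
    MemLp (𝓕⁻ f) 2 :=
  (memLp_congr_ae (fourierInv_toLp_ae_eq hf hf2)).1 (Lp.memLp _)

/-- Parseval's identity. -/
lemma integral_conj_fourierInv_mul {f g : Rn 2 → ℂ} (hf : Integrable f) (hf2 : MemLp f 2)
    (hg : Integrable g) (hg2 : MemLp g 2) :
    ∫ x, (starRingEnd ℂ) (𝓕⁻ f x) * 𝓕⁻ g x = ∫ ξ, (starRingEnd ℂ) (f ξ) * g ξ := by
  have h := MeasureTheory.Lp.inner_fourier_eq (𝓕⁻ (hf2.toLp f)) (𝓕⁻ (hg2.toLp g))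
  rw [FourierTransform.fourier_fourierInv_eq, FourierTransform.fourier_fourierInv_eq, L2.inner_def,
    L2.inner_def] at h
  have h1 : ∫ x, inner ℂ ((𝓕⁻ (hf2.toLp f) : Lp ℂ 2 (volume : Measure (Rn 2))) x)
      ((𝓕⁻ (hg2.toLp g) : Lp ℂ 2 (volume : Measure (Rn 2))) x) =
      ∫ x, (starRingEnd ℂ) (𝓕⁻ f x) * 𝓕⁻ g x := by
    refine integral_congr_ae ?_
    filter_upwards [fourierInv_toLp_ae_eq hf hf2, fourierInv_toLp_ae_eq hg hg2] with x hx hx'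
    rw [hx, hx', RCLike.inner_apply, mul_comm]
  have h2 : ∫ x, inner ℂ ((hf2.toLp f) x) ((hg2.toLp g) x) =
      ∫ ξ, (starRingEnd ℂ) (f ξ) * g ξ := by
    refine integral_congr_ae ?_
    filter_upwards [hf2.coeFn_toLp, hg2.coeFn_toLp] with x hx hx'
    rw [hx, hx', RCLike.inner_apply, mul_comm]
  rw [← h1, ← h2, h]

/-- Plancherel's identity. -/
lemma integral_norm_sq_fourierInv {f : Rn 2 → ℂ} (hf : Integrable f) (hf2 : MemLp f 2) :
    ∫ x, ‖𝓕⁻ f x‖ ^ 2 = ∫ ξ, ‖f ξ‖ ^ 2 := by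
  have h := integral_conj_fourierInv_mul hf hf2 hf hf2
  simp only [Complex.conj_mul'] at h
  have e : ∀ g : Rn 2 → ℂ, ∫ x, (‖g x‖ : ℂ) ^ 2 = ((∫ x, ‖g x‖ ^ 2 : ℝ) : ℂ) := fun g => by
    rw [← integral_complex_ofReal]; simp
  rw [e, e] at h
  exact_mod_cast h

end

section

variable {s N T : ℝ} {m₁ : Rn 2 → ℝ} {w w' v : ℝ → Rn 2 → ℂ}

lemma RapidFamily.memLp (hw : RapidFamily w) (t : ℝ) : MemLp (w t) 2 := by
  obtain ⟨C, hC0, hC⟩ := hw.exists_norm_le 0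
  refine (memLp_two_iff_integrable_sq_norm (hw.cont_space t).aestronglyMeasurable).2 ?_
  refine Integrable.mono' ((hw.integrable t).norm.const_mul C)
    ((hw.cont_space t).norm.pow 2).aestronglyMeasurable (Filter.Eventually.of_forall fun ξ => ?_)
  have h := hC t ξ
  simp only [pow_zero, inv_one, mul_one] at h
  rw [Real.norm_of_nonneg (by positivity), sq]
  exact mul_le_mul_of_nonneg_right h (norm_nonneg _)

/-- Evaluation of the inverse Fourier transform with the plane wave made explicit. -/
lemma fourierInv_eq_integral_cexp (f : Rn 2 → ℂ) (x : Rn 2) :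
    𝓕⁻ f x = ∫ ξ, cexp ((2 * Real.pi * ⟪ξ, x⟫ : ℝ) * I) * f ξ := by
  simp [Real.fourierInv_eq']

lemma conj_cexp_ofReal_mul_I (a : ℝ) :
    (starRingEnd ℂ) (cexp ((a : ℂ) * I)) = cexp ((-a : ℝ) * I) := by
  rw [← Complex.exp_conj]; simp

/-- The cubic nonlinearity becomes a double convolution on the Fourier side. -/
lemma RapidFamily.fourierInv_cubic (hw : RapidFamily w) (t : ℝ) (x : Rn 2) :
    𝓕⁻ (cubic (w t)) x = (‖𝓕⁻ (w t) x‖ : ℂ) ^ 2 * 𝓕⁻ (w t) x := by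
  set e : Rn 2 → ℂ := fun ξ => cexp ((2 * Real.pi * ⟪ξ, x⟫ : ℝ) * I) with he
  have hec : Continuous e := by rw [he]; fun_prop
  have hen : ∀ ξ, ‖e ξ‖ = 1 := fun ξ => Complex.norm_exp_ofReal_mul_I _
  have hF : ∀ f : Rn 2 → ℂ, 𝓕⁻ f x = ∫ ξ, e ξ * f ξ := fun f => fourierInv_eq_integral_cexp f x
  have hadd : ∀ η a b : Rn 2, e (η + (a - b)) = e a * (starRingEnd ℂ) (e b) * e η := by
    intro η a b
    rw [he]
    simp only [conj_cexp_ofReal_mul_I, ← Complex.exp_add]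
    congr 1
    simp only [inner_add_left, inner_sub_left]
    push_cast
    ring
  obtain ⟨D, hD0, hD⟩ := hw.exists_norm_tri_le 3
  have h_int : Integrable (Function.uncurry fun (ξ : Rn 2) (p : Rn 2 × Rn 2) =>
      e ξ * (w t p.1 * (starRingEnd ℂ) (w t p.2) * w t (third ξ p))) (volume.prod volume) := by
    refine Integrable.mono' (((integrable_jap_inv_pow (le_refl 3)).mul_prod
      integrable_jap_inv_prod).const_mul D) ?_ (Filter.Eventually.of_forall fun z => ?_)
    · refine Continuous.aestronglyMeasurable ((hec.comp continuous_fst).mul ?_)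
      exact hw.continuous_tri.comp (by fun_prop :
        Continuous fun z : Rn 2 × (Rn 2 × Rn 2) => ((t, z.1), z.2))
    · obtain ⟨ξ, p⟩ := z
      have h := hD t ξ p
      have hj := pow_pos (jap_pos ξ) 3
      simp only [Function.uncurry_apply_pair]
      rw [norm_mul, hen, one_mul, mul_left_comm, ← div_eq_inv_mul, le_div_iff₀ hj, mul_comm]
      exact h
  have hinner : ∀ p : Rn 2 × Rn 2, ∫ ξ, e ξ * (w t p.1 * (starRingEnd ℂ) (w t p.2) *
      w t (third ξ p)) = (e p.1 * w t p.1) * ((starRingEnd ℂ) (e p.2 * w t p.2) * 𝓕⁻ (w t) x) := by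
    intro p
    rw [← integral_add_right_eq_self _ (p.1 - p.2), hF, ← integral_const_mul, ← integral_const_mul]
    refine integral_congr_ae (Filter.Eventually.of_forall fun η => ?_)
    have h3 : third (η + (p.1 - p.2)) p = η := by unfold third; abel
    simp only [h3, hadd, map_mul]
    ring
  calc 𝓕⁻ (cubic (w t)) x
      = ∫ ξ, ∫ p : Rn 2 × Rn 2, e ξ * (w t p.1 * (starRingEnd ℂ) (w t p.2) * w t (third ξ p)) := by
        rw [hF]
        refine integral_congr_ae (Filter.Eventually.of_forall fun ξ => ?_)
        simp only [cubic_eq, integral_const_mul]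
    _ = ∫ p : Rn 2 × Rn 2, (e p.1 * w t p.1) *
          ((starRingEnd ℂ) (e p.2 * w t p.2) * 𝓕⁻ (w t) x) := by
        rw [integral_integral_swap h_int]
        simp only [hinner]
    _ = 𝓕⁻ (w t) x * ((starRingEnd ℂ) (𝓕⁻ (w t) x) * 𝓕⁻ (w t) x) := by
        rw [Measure.volume_eq_prod, integral_prod_mul (fun a => e a * w t a)
          (fun b => (starRingEnd ℂ) (e b * w t b) * 𝓕⁻ (w t) x), integral_mul_const,
          integral_conj, ← hF]
    _ = _ := by
        rw [← Complex.conj_mul']; ring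

end

section

variable {s N T : ℝ} {m₁ : Rn 2 → ℝ} {w w' v : ℝ → Rn 2 → ℂ}

lemma norm_cexp_inner (ξ x : Rn 2) : ‖cexp ((2 * Real.pi * ⟪ξ, x⟫ : ℝ) * I)‖ = 1 :=
  Complex.norm_exp_ofReal_mul_I _

lemma RapidFamily.continuous_fourierInv (hw : RapidFamily w) :
    Continuous fun p : ℝ × Rn 2 => 𝓕⁻ (w p.1) p.2 := by
  obtain ⟨C, hC0, hC⟩ := hw.exists_norm_le 3
  simp only [fourierInv_eq_integral_cexp]
  refine continuous_of_dominated (bound := fun ξ => C * (jap ξ ^ 3)⁻¹)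
    (fun p => ?_) (fun p => Filter.Eventually.of_forall fun ξ => ?_)
    ((integrable_jap_inv_pow le_rfl).const_mul C) (Filter.Eventually.of_forall fun ξ => ?_)
  · exact (Continuous.mul (by fun_prop) (hw.cont_space p.1)).aestronglyMeasurable
  · rw [norm_mul, norm_cexp_inner, one_mul]; exact hC _ _
  · exact Continuous.mul (by fun_prop) ((hw.cont_time ξ).comp continuous_fst)

lemma RapidFamily.exists_norm_fourierInv_le (hw : RapidFamily w) :
    ∃ M : ℝ, 0 ≤ M ∧ ∀ t x, ‖𝓕⁻ (w t) x‖ ≤ M := by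
  obtain ⟨C, hC0, hC⟩ := hw.exists_norm_le 3
  refine ⟨∫ ξ : Rn 2, C * (jap ξ ^ 3)⁻¹, integral_nonneg fun ξ => ?_, fun t x => ?_⟩
  · have := jap_pos ξ
    positivity
  · exact (norm_fourierInv_le _ _).trans (integral_mono (hw.integrable t).norm
      ((integrable_jap_inv_pow le_rfl).const_mul C) fun ξ => hC t ξ)

lemma RapidFamily.exists_integral_sq_le (hw : RapidFamily w) :
    ∃ B : ℝ, 0 ≤ B ∧ ∀ t, ∫ ξ, ‖w t ξ‖ ^ 2 ≤ B := by
  obtain ⟨C, hC0, hC⟩ := hw.exists_norm_le 3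
  have hj : ∀ ξ : Rn 2, 0 ≤ C ^ 2 * (jap ξ ^ 6)⁻¹ := fun ξ => by
    have := jap_pos ξ
    positivity
  refine ⟨∫ ξ : Rn 2, C ^ 2 * (jap ξ ^ 6)⁻¹, integral_nonneg hj, fun t => ?_⟩
  refine integral_mono_of_nonneg (Filter.Eventually.of_forall fun ξ => by positivity)
    ((integrable_jap_inv_pow (by norm_num)).const_mul _) (Filter.Eventually.of_forall fun ξ => ?_)
  refine (pow_le_pow_left₀ (norm_nonneg _) (hC t ξ) 2).trans_eq ?_
  rw [mul_pow, inv_pow, ← pow_mul]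

lemma RapidFamily.integrable_norm_sq_fourierInv (hw : RapidFamily w) (t : ℝ) :
    Integrable fun x => ‖𝓕⁻ (w t) x‖ ^ 2 :=
  (memLp_two_iff_integrable_sq_norm
    (AlmostConservation.continuous_fourierInv (hw.integrable t)).aestronglyMeasurable).1
    (memLp_fourierInv (hw.integrable t) (hw.memLp t))

lemma RapidFamily.integrable_norm_pow_four_fourierInv (hw : RapidFamily w) (t : ℝ) :
    Integrable fun x => ‖𝓕⁻ (w t) x‖ ^ 4 := by
  obtain ⟨M, hM0, hM⟩ := hw.exists_norm_fourierInv_le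
  refine Integrable.mono' ((hw.integrable_norm_sq_fourierInv t).const_mul (M ^ 2))
    ((AlmostConservation.continuous_fourierInv (hw.integrable t)).norm.pow 4).aestronglyMeasurable
    (Filter.Eventually.of_forall fun x => ?_)
  rw [Real.norm_of_nonneg (by positivity)]
  have h := pow_le_pow_left₀ (norm_nonneg _) (hM t x) 2
  calc ‖𝓕⁻ (w t) x‖ ^ 4 = ‖𝓕⁻ (w t) x‖ ^ 2 * ‖𝓕⁻ (w t) x‖ ^ 2 := by ring
    _ ≤ _ := mul_le_mul_of_nonneg_right h (by positivity)

lemma RapidFamily.hasDerivAt_fourierInv (hw : RapidFamily w) (hw' : RapidFamily w')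
    (hd : ∀ ξ, ∀ t ∈ Ioo 0 T, HasDerivAt (fun t => w t ξ) (w' t ξ) t) {t : ℝ}
    (ht : t ∈ Ioo 0 T) (x : Rn 2) :
    HasDerivAt (fun t => 𝓕⁻ (w t) x) (𝓕⁻ (w' t) x) t := by
  obtain ⟨C, hC0, hC⟩ := hw'.exists_norm_le 3
  simp only [fourierInv_eq_integral_cexp]
  have hm : ∀ {u : ℝ → Rn 2 → ℂ}, RapidFamily u → ∀ t, AEStronglyMeasurable
      (fun ξ => cexp ((2 * Real.pi * ⟪ξ, x⟫ : ℝ) * I) * u t ξ) volume := fun hu t =>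
    (Continuous.mul (by fun_prop) (hu.cont_space t)).aestronglyMeasurable
  refine (hasDerivAt_integral_of_dominated_loc_of_deriv_le (Ioo_mem_nhds ht.1 ht.2)
    (bound := fun ξ => C * (jap ξ ^ 3)⁻¹)
    (F' := fun t ξ => cexp ((2 * Real.pi * ⟪ξ, x⟫ : ℝ) * I) * w' t ξ)
    (Filter.Eventually.of_forall fun t => hm hw t) ?_ (hm hw' t)
    (Filter.Eventually.of_forall fun ξ τ hτ => ?_)
    ((integrable_jap_inv_pow le_rfl).const_mul C)
    (Filter.Eventually.of_forall fun ξ τ hτ => ?_)).2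
  · refine (hw.integrable t).norm.mono' (hm hw t) (Filter.Eventually.of_forall fun ξ => ?_)
    rw [norm_mul, norm_cexp_inner, one_mul]
  · rw [norm_mul, norm_cexp_inner, one_mul]; exact hC _ _
  · exact (hd ξ τ hτ).const_mul _

lemma hasDerivAt_norm_pow_four {f : ℝ → ℂ} {f' : ℂ} {t : ℝ} (h : HasDerivAt f f' t) :
    HasDerivAt (fun t => ‖f t‖ ^ 4)
      (4 * ((starRingEnd ℂ) ((‖f t‖ : ℂ) ^ 2 * f t) * f').re) t := by
  have h2 := (h.norm_sq).pow 2
  have e : (fun t => ‖f t‖ ^ 4) = (fun t => ‖f t‖ ^ 2) ^ 2 := by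
    ext t; simp only [Pi.pow_apply]; ring
  rw [e]
  refine h2.congr_deriv ?_
  have e2 : (starRingEnd ℂ) ((‖f t‖ : ℂ) ^ 2 * f t) * f' =
      ((‖f t‖ ^ 2 : ℝ) : ℂ) * ((starRingEnd ℂ) (f t) * f') := by simp [mul_assoc]
  rw [e2, Complex.re_ofReal_mul, Complex.inner, Nat.add_one_sub_one, pow_one]
  push_cast
  ring_nf

/-- The fundamental theorem of calculus in time for a spatial integral. -/
lemma integral_sub_eq_integral_deriv {F : ℝ → Rn 2 → ℝ} {H : ℝ → Rn 2 → ℂ} (hT : 0 ≤ T)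
    (hF : ∀ x, Continuous fun t => F t x) (hF0 : Integrable (F 0)) (hFT : Integrable (F T))
    (hHc : Continuous fun p : ℝ × Rn 2 => H p.1 p.2) (hHx : ∀ t, Integrable (H t)) {B : ℝ}
    (hB : ∀ t, ∫ x, ‖H t x‖ ≤ B)
    (hd : ∀ x, ∀ t ∈ Ioo 0 T, HasDerivAt (fun t => F t x) (H t x).re t) :
    (∫ x, F T x) - ∫ x, F 0 x = ∫ t in Ioc 0 T, (∫ x, H t x).re := by
  have hm : AEStronglyMeasurable (Function.uncurry H)
      ((volume.restrict (Ioc 0 T)).prod (volume : Measure (Rn 2))) := hHc.aestronglyMeasurable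
  have hprod : Integrable (Function.uncurry H)
      ((volume.restrict (Ioc 0 T)).prod (volume : Measure (Rn 2))) := by
    rw [integrable_prod_iff hm]
    refine ⟨Filter.Eventually.of_forall fun t => hHx t, ?_⟩
    refine Integrable.mono' (g := fun _ => B) (integrable_const _)
      hm.norm.integral_prod_right' (Filter.Eventually.of_forall fun t => ?_)
    rw [Real.norm_of_nonneg (integral_nonneg fun _ => norm_nonneg _)]
    exact hB t
  have hftc : ∀ x, F T x - F 0 x = ∫ t in Ioc 0 T, (H t x).re := by
    intro x
    have hc : Continuous fun t => H t x := hHc.comp (by fun_prop : Continuous fun t : ℝ => (t, x))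
    rw [← intervalIntegral.integral_of_le hT]
    exact (intervalIntegral.integral_eq_sub_of_hasDerivAt_of_le hT
      (f := fun t => F t x) (hF x).continuousOn (fun t ht => hd x t ht)
      ((Complex.continuous_re.comp hc).intervalIntegrable _ _)).symm
  rw [← integral_sub hFT hF0]
  simp only [hftc]
  have h2 : ∀ t, (∫ x, H t x).re = ∫ x, (H t x).re := fun t => (integral_re (hHx t)).symm
  simp only [h2]
  exact (integral_integral_swap (f := fun t x => (H t x).re) hprod.re).symm

/-- The `L⁴` norm of a family evolves by the pairing of its cubic convolution with its velocity. -/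
lemma RapidFamily.potential_increment (hw : RapidFamily w) (hw' : RapidFamily w') (hT : 0 ≤ T)
    (hd : ∀ ξ, ∀ t ∈ Ioo 0 T, HasDerivAt (fun t => w t ξ) (w' t ξ) t) :
    (∫ x, ‖𝓕⁻ (w T) x‖ ^ 4) - ∫ x, ‖𝓕⁻ (w 0) x‖ ^ 4 =
      ∫ t in Ioc 0 T, 4 * (∫ ξ, (starRingEnd ℂ) (cubic (w t) ξ) * w' t ξ).re := by
  obtain ⟨M, hM0, hM⟩ := hw.exists_norm_fourierInv_le
  obtain ⟨B, hB0, hB⟩ := hw.exists_integral_sq_le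
  obtain ⟨B', hB0', hB'⟩ := hw'.exists_integral_sq_le
  set f : ℝ → Rn 2 → ℂ := fun t x => 𝓕⁻ (w t) x with hf
  set f' : ℝ → Rn 2 → ℂ := fun t x => 𝓕⁻ (w' t) x with hf'
  have hfc : Continuous fun p : ℝ × Rn 2 => f p.1 p.2 := hw.continuous_fourierInv
  have hfc' : Continuous fun p : ℝ × Rn 2 => f' p.1 p.2 := hw'.continuous_fourierInv
  set H : ℝ → Rn 2 → ℂ := fun t x => (starRingEnd ℂ) ((‖f t x‖ : ℂ) ^ 2 * f t x) * f' t x with hH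
  have hHc : Continuous fun p : ℝ × Rn 2 => H p.1 p.2 :=
    (Complex.continuous_conj.comp (((Complex.continuous_ofReal.comp hfc.norm).pow 2).mul hfc)).mul
      hfc'
  have hHle : ∀ t x, ‖H t x‖ ≤ M ^ 2 * (‖f t x‖ ^ 2 + ‖f' t x‖ ^ 2) := by
    intro t x
    have h1 := pow_le_pow_left₀ (norm_nonneg _) (hM t x) 2
    simp only [hH, norm_mul, RCLike.norm_conj, norm_pow, Complex.norm_real, norm_norm]
    rw [mul_assoc]
    refine mul_le_mul h1 ?_ (by positivity) (by positivity)
    nlinarith [sq_nonneg (‖f t x‖ - ‖f' t x‖), sq_nonneg (‖f t x‖), sq_nonneg (‖f' t x‖)]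
  have hmaj : ∀ t, Integrable fun x => M ^ 2 * (‖f t x‖ ^ 2 + ‖f' t x‖ ^ 2) := fun t =>
    ((hw.integrable_norm_sq_fourierInv t).add (hw'.integrable_norm_sq_fourierInv t)).const_mul _
  have hHx : ∀ t, Integrable (H t) := fun t => (hmaj t).mono'
    (hHc.comp (by fun_prop : Continuous fun x : Rn 2 => (t, x))).aestronglyMeasurable
    (Filter.Eventually.of_forall (hHle t))
  have hHB : ∀ t, ∫ x, ‖H t x‖ ≤ M ^ 2 * (B + B') := fun t => by
    calc ∫ x, ‖H t x‖ ≤ ∫ x, M ^ 2 * (‖f t x‖ ^ 2 + ‖f' t x‖ ^ 2) :=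
          integral_mono (hHx t).norm (hmaj t) (hHle t)
      _ = M ^ 2 * ((∫ x, ‖w t x‖ ^ 2) + ∫ x, ‖w' t x‖ ^ 2) := by
          rw [integral_const_mul, integral_add (hw.integrable_norm_sq_fourierInv t)
            (hw'.integrable_norm_sq_fourierInv t),
            integral_norm_sq_fourierInv (hw.integrable t) (hw.memLp t),
            integral_norm_sq_fourierInv (hw'.integrable t) (hw'.memLp t)]
      _ ≤ _ := mul_le_mul_of_nonneg_left (add_le_add (hB t) (hB' t)) (by positivity)
  have h4 : ∀ t, (4 : ℝ) * (∫ ξ, (starRingEnd ℂ) (cubic (w t) ξ) * w' t ξ).re =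
      4 * (∫ x, H t x).re := fun t => by
    rw [← integral_conj_fourierInv_mul (hw.cubicFamily.integrable t) (hw.cubicFamily.memLp t)
      (hw'.integrable t) (hw'.memLp t)]
    simp only [hw.fourierInv_cubic t, hH, hf, hf']
  have key := integral_sub_eq_integral_deriv (F := fun t x => ‖f t x‖ ^ 4 / 4) (H := H) hT
    (fun x => ((hfc.comp (by fun_prop : Continuous fun t : ℝ => (t, x))).norm.pow 4).div_const 4)
    ((hw.integrable_norm_pow_four_fourierInv 0).div_const 4)
    ((hw.integrable_norm_pow_four_fourierInv T).div_const 4) hHc hHx hHB (fun x t ht =>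
      ((hasDerivAt_norm_pow_four (hw.hasDerivAt_fourierInv hw' hd ht x)).div_const 4).congr_deriv
        (by simp only [hH, hf, hf']; ring))
  simp only [h4, integral_const_mul]
  rw [← key, integral_div, integral_div]
  ring

end

section

variable {s N T : ℝ} {m₁ : Rn 2 → ℝ} {w w' v : ℝ → Rn 2 → ℂ}

lemma fderiv_fourierInv_single {f : Rn 2 → ℂ} (hf : Integrable f)
    (hf' : Integrable fun ξ => ‖ξ‖ * ‖f ξ‖) (x : Rn 2) (i : Fin 2) :
    fderiv ℝ (𝓕⁻ f) x (EuclideanSpace.single i 1) =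
      𝓕⁻ (fun ξ => (2 * Real.pi * I * (ξ i : ℂ)) * f ξ) x := by
  have hF : 𝓕⁻ f = fun x => 𝓕 f (-x) := by
    ext x; rw [Real.fourierInv_eq_fourier_neg]
  have h_int : Integrable (VectorFourier.fourierSMulRight (innerSL ℝ) f) := by
    refine (hf'.const_mul (2 * Real.pi)).mono' hf.aestronglyMeasurable.fourierSMulRight
      (Filter.Eventually.of_forall fun ξ => ?_)
    refine (VectorFourier.norm_fourierSMulRight_le _ _ _).trans ?_
    have h1 : ‖innerSL ℝ (E := Rn 2)‖ ≤ 1 := norm_innerSL_le _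
    have h2 := mul_le_mul_of_nonneg_left h1
      (by positivity : 0 ≤ 2 * Real.pi * (‖ξ‖ * ‖f ξ‖))
    linarith
  have h1 := (Real.hasFDerivAt_fourier hf hf' (-x)).comp x (hasFDerivAt_id x).neg
  simp only [Function.comp_def] at h1
  rw [Real.fourierInv_eq_fourier_neg, hF, h1.fderiv]
  simp only [ContinuousLinearMap.comp_apply, neg_apply, ContinuousLinearMap.id_apply, map_neg]
  rw [Real.fourier_continuousLinearMap_apply h_int, Real.fourier_eq, Real.fourier_eq, ← integral_neg]
  refine integral_congr_ae (Filter.Eventually.of_forall fun ξ => ?_)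
  have h2 : innerSL ℝ ξ (EuclideanSpace.single i (1 : ℝ)) = ξ i := by
    rw [innerSL_apply_apply, EuclideanSpace.inner_single_right]; simp
  simp only [VectorFourier.fourierSMulRight_apply, ← smul_neg, h2]
  simp [mul_assoc, mul_left_comm]

lemma norm_apply_le_jap (ξ : Rn 2) (i : Fin 2) : ‖ξ i‖ ≤ jap ξ :=
  (PiLp.norm_apply_le ξ i).trans (norm_le_jap ξ)

lemma RapidFamily.mul_coord (hw : RapidFamily w) (i : Fin 2) :
    RapidFamily fun t ξ => (2 * Real.pi * I * (ξ i : ℂ)) * w t ξ :=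
  hw.mul (D := 2 * Real.pi) (j := 1) (by fun_prop) fun ξ => by
    have h := norm_apply_le_jap ξ i
    simp only [norm_mul, Complex.norm_ofNat, Complex.norm_real, Complex.norm_I, mul_one, pow_one,
      Real.norm_of_nonneg Real.pi_pos.le]
    exact mul_le_mul_of_nonneg_left h (by positivity)

lemma sum_norm_coord_sq (ξ : Rn 2) (z : ℂ) :
    ∑ i, ‖(2 * Real.pi * I * (ξ i : ℂ)) * z‖ ^ 2 = lam ξ * ‖z‖ ^ 2 := by
  simp only [norm_mul, Complex.norm_ofNat, Complex.norm_real, Complex.norm_I, mul_one,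
      Real.norm_of_nonneg Real.pi_pos.le, mul_pow, Fin.sum_univ_two, lam, EuclideanSpace.norm_sq_eq]
  ring

lemma RapidFamily.integrable_norm_sq (hw : RapidFamily w) (t : ℝ) :
    Integrable fun ξ => ‖w t ξ‖ ^ 2 :=
  (memLp_two_iff_integrable_sq_norm (hw.cont_space t).aestronglyMeasurable).1 (hw.memLp t)

lemma RapidFamily.integrable_lam_mul_sq (hw : RapidFamily w) (t : ℝ) :
    Integrable fun ξ => lam ξ * ‖w t ξ‖ ^ 2 := by
  simp only [← sum_norm_coord_sq]
  exact integrable_finsetSum _ fun i _ => (hw.mul_coord i).integrable_norm_sq t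

/-- The energy expressed through the Fourier transform. -/
lemma RapidFamily.energy_fourierInv (hw : RapidFamily w) (t : ℝ) :
    energy (𝓕⁻ (w t)) = 1 / 2 * (∫ ξ, lam ξ * ‖w t ξ‖ ^ 2) +
      1 / 4 * ∫ x, ‖𝓕⁻ (w t) x‖ ^ 4 := by
  have h1 : Integrable fun ξ => ‖ξ‖ * ‖w t ξ‖ := by
    refine (hw.integrable_jap_mul 1 t).mono'
      (continuous_norm.mul (hw.cont_space t).norm).aestronglyMeasurable
      (Filter.Eventually.of_forall fun ξ => ?_)
    rw [Real.norm_of_nonneg (by positivity), pow_one]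
    exact mul_le_mul_of_nonneg_right (norm_le_jap ξ) (norm_nonneg _)
  unfold energy
  simp only [fderiv_fourierInv_single (hw.integrable t) h1]
  have hi : ∀ i : Fin 2, Integrable fun x =>
      ‖𝓕⁻ (fun ξ : Rn 2 => (2 * Real.pi * I * (ξ i : ℂ)) * w t ξ) x‖ ^ 2 := fun i =>
    (hw.mul_coord i).integrable_norm_sq_fourierInv t
  rw [integral_add ((integrable_finsetSum _ fun i _ => hi i).const_mul _)
    ((hw.integrable_norm_pow_four_fourierInv t).const_mul _), integral_const_mul,
    integral_const_mul, integral_finsetSum _ fun i _ => hi i]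
  simp only [integral_norm_sq_fourierInv ((hw.mul_coord _).integrable t) ((hw.mul_coord _).memLp t)]
  rw [← integral_finsetSum _ fun i _ => (hw.mul_coord i).integrable_norm_sq t]
  simp only [sum_norm_coord_sq]

/-- The kinetic energy evolves by the pairing of the Laplacian with the velocity. -/
lemma RapidFamily.kinetic_increment (hw : RapidFamily w) (hw' : RapidFamily w') (hT : 0 ≤ T)
    (hd : ∀ ξ, ∀ t ∈ Ioo 0 T, HasDerivAt (fun t => w t ξ) (w' t ξ) t) :
    (∫ ξ, lam ξ * ‖w T ξ‖ ^ 2) - ∫ ξ, lam ξ * ‖w 0 ξ‖ ^ 2 =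
      ∫ t in Ioc 0 T, 2 * (∫ ξ, (starRingEnd ℂ) (lam ξ * w t ξ) * w' t ξ).re := by
  obtain ⟨C, hC0, hC⟩ := hw.mul_lam.exists_norm_le 0
  obtain ⟨C', hC0', hC'⟩ := hw'.exists_norm_le 3
  simp only [pow_zero, inv_one, mul_one] at hC
  have hle : ∀ t ξ, ‖(starRingEnd ℂ) (lam ξ * w t ξ) * w' t ξ‖ ≤ C * (C' * (jap ξ ^ 3)⁻¹) := by
    intro t ξ
    rw [norm_mul, RCLike.norm_conj]
    exact mul_le_mul (hC t ξ) (hC' t ξ) (norm_nonneg _) hC0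
  have hmaj : Integrable fun ξ : Rn 2 => C * (C' * (jap ξ ^ 3)⁻¹) :=
    ((integrable_jap_inv_pow le_rfl).const_mul _).const_mul _
  have hc : Continuous fun p : ℝ × Rn 2 => (starRingEnd ℂ) (lam p.2 * w p.1 p.2) * w' p.1 p.2 :=
    (Complex.continuous_conj.comp hw.mul_lam.cont).mul hw'.cont
  have hx : ∀ t, Integrable fun ξ => (starRingEnd ℂ) (lam ξ * w t ξ) * w' t ξ := fun t =>
    hmaj.mono' (hc.comp (by fun_prop : Continuous fun ξ : Rn 2 => (t, ξ))).aestronglyMeasurable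
      (Filter.Eventually.of_forall (hle t))
  have key := integral_sub_eq_integral_deriv (F := fun t ξ => lam ξ * ‖w t ξ‖ ^ 2 / 2)
    (H := fun t ξ => (starRingEnd ℂ) (lam ξ * w t ξ) * w' t ξ) hT
    (fun ξ => (((hw.cont_time ξ).norm.pow 2).const_mul _).div_const 2)
    ((hw.integrable_lam_mul_sq 0).div_const 2) ((hw.integrable_lam_mul_sq T).div_const 2) hc hx
    (fun t => integral_mono (hx t).norm hmaj (hle t)) (fun ξ t ht =>
      (((hd ξ t ht).norm_sq.const_mul (lam ξ)).div_const 2).congr_deriv (by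
        rw [map_mul, Complex.conj_ofReal, mul_assoc, Complex.re_ofReal_mul, Complex.inner]
        ring_nf))
  rw [integral_const_mul, ← key, integral_div, integral_div]
  ring

end

section

variable {s N T : ℝ} {m₁ : Rn 2 → ℝ} {w w' v : ℝ → Rn 2 → ℂ}

lemma energy_rate_identity (l m : ℝ) (a c d : ℂ) :
    ((starRingEnd ℂ) (l * (m * a)) * (m * -(I * (l * a + c)))).re +
      ((starRingEnd ℂ) d * (m * -(I * (l * a + c)))).re =
    (((l * m : ℝ) : ℂ) * ((starRingEnd ℂ) a * (m * c - d)) +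
      m * ((m * c - d) * (starRingEnd ℂ) c)).im := by
  simp
  ring

lemma RapidFamily.conj_mul (hw : RapidFamily w) (hw' : RapidFamily w') :
    RapidFamily fun t ξ => (starRingEnd ℂ) (w t ξ) * w' t ξ := by
  refine ⟨(Complex.continuous_conj.comp hw.cont).mul hw'.cont, fun k => ?_⟩
  obtain ⟨C, hC0, hC⟩ := hw.exists_norm_le 0
  obtain ⟨D, hD⟩ := hw'.decay k
  refine ⟨C * D, fun t ξ => ?_⟩
  have h := hC t ξ
  simp only [pow_zero, inv_one, mul_one] at h
  have hj := pow_pos (jap_pos ξ) k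
  rw [norm_mul, RCLike.norm_conj, mul_left_comm]
  exact mul_le_mul h (hD t ξ) (by positivity) hC0

lemma RapidFamily.continuous_integral (hw : RapidFamily w) : Continuous fun t => ∫ ξ, w t ξ := by
  obtain ⟨C, hC0, hC⟩ := hw.exists_norm_le 3
  exact continuous_of_dominated (fun t => (hw.cont_space t).aestronglyMeasurable)
    (fun t => Filter.Eventually.of_forall (hC t)) ((integrable_jap_inv_pow le_rfl).const_mul C)
    (Filter.Eventually.of_forall fun ξ => hw.cont_time ξ)

/-- The increment of the smoothed energy of a solution is given by the two commutator terms. -/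
lemma FourierSolution.energy_sub_eq (hv : FourierSolution T v) (hm : IsAdmissibleMultiplier 2 s m₁)
    (hT : 0 ≤ T) :
    energy (𝓕⁻ fun ξ => (mN m₁ N ξ : ℂ) * v T ξ) - energy (𝓕⁻ fun ξ => (mN m₁ N ξ : ℂ) * v 0 ξ) =
      (quarticIncr m₁ N v T + sexticIncr m₁ N v T).im := by
  have hw : RapidFamily fun t ξ => (mN m₁ N ξ : ℂ) * v t ξ := hv.fam.mul_mN hm N
  have hw' : RapidFamily fun t ξ =>
      (mN m₁ N ξ : ℂ) * -(I * ((lam ξ : ℂ) * v t ξ + cubic (v t) ξ)) := by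
    have h := ((hv.fam.mul_lam.add hv.fam.cubicFamily).const_mul (-I)).mul_mN hm N
    simpa [neg_mul] using h
  have hd : ∀ ξ, ∀ t ∈ Ioo 0 T, HasDerivAt (fun t => (mN m₁ N ξ : ℂ) * v t ξ)
      ((mN m₁ N ξ : ℂ) * -(I * ((lam ξ : ℂ) * v t ξ + cubic (v t) ξ))) t :=
    fun ξ t ht => (hv.deriv ξ t ht).const_mul _
  have hP := hw.potential_increment hw' hT hd
  have hK := hw.kinetic_increment hw' hT hd
  have hP1 := hw.mul_lam.conj_mul hw'
  have hP2 := hw.cubicFamily.conj_mul hw'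
  have hQ1 : RapidFamily fun t ξ => ((lam ξ * mN m₁ N ξ : ℝ) : ℂ) *
      ((starRingEnd ℂ) (v t ξ) * commTerm m₁ N (v t) ξ) := by
    have h := ((hv.fam.conj_mul (hv.fam.commFamily hm N)).mul_mN hm N).mul_lam
    simpa [mul_assoc] using h
  have hQ2 : RapidFamily fun t ξ => (mN m₁ N ξ : ℂ) *
      (commTerm m₁ N (v t) ξ * (starRingEnd ℂ) (cubic (v t) ξ)) := by
    have h := (hv.fam.cubicFamily.conj_mul (hv.fam.commFamily hm N)).mul_mN hm N
    simpa [mul_comm] using h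
  have hrate : ∀ t, (∫ ξ, (starRingEnd ℂ) ((lam ξ : ℂ) * ((mN m₁ N ξ : ℂ) * v t ξ)) *
        ((mN m₁ N ξ : ℂ) * -(I * ((lam ξ : ℂ) * v t ξ + cubic (v t) ξ)))).re +
      (∫ ξ, (starRingEnd ℂ) (cubic (fun ξ => (mN m₁ N ξ : ℂ) * v t ξ) ξ) *
        ((mN m₁ N ξ : ℂ) * -(I * ((lam ξ : ℂ) * v t ξ + cubic (v t) ξ)))).re =
      (∫ ξ, ((lam ξ * mN m₁ N ξ : ℝ) : ℂ) *
        ((starRingEnd ℂ) (v t ξ) * commTerm m₁ N (v t) ξ)).im +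
      (∫ ξ, (mN m₁ N ξ : ℂ) *
        (commTerm m₁ N (v t) ξ * (starRingEnd ℂ) (cubic (v t) ξ))).im := by
    intro t
    rw [← Complex.add_re, ← Complex.add_im, ← integral_add (hP1.integrable t) (hP2.integrable t),
      ← integral_add (hQ1.integrable t) (hQ2.integrable t)]
    refine (integral_re ((hP1.add hP2).integrable t)).symm.trans
      (Eq.trans ?_ (integral_im ((hQ1.add hQ2).integrable t)))
    refine integral_congr_ae (Filter.Eventually.of_forall fun ξ => ?_)
    have h := energy_rate_identity (lam ξ) (mN m₁ N ξ) (v t ξ) (cubic (v t) ξ)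
      (cubic (fun ξ => (mN m₁ N ξ : ℂ) * v t ξ) ξ)
    rw [← hv.fam.commTerm_eq hm t ξ, ← Complex.add_re] at h
    exact h
  have h_int : ∀ {u : ℝ → Rn 2 → ℂ}, RapidFamily u →
      IntegrableOn (fun t => ∫ ξ, u t ξ) (Ioc 0 T) := fun hu =>
    hu.continuous_integral.integrableOn_Ioc
  rw [hw.energy_fourierInv T, hw.energy_fourierInv 0]
  simp only [integral_const_mul] at hP hK
  have hE := integral_add (h_int hP1).re (h_int hP2).re
  have hQ : (quarticIncr m₁ N v T + sexticIncr m₁ N v T).im =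
      ∫ t in Ioc 0 T, ((∫ ξ, ((lam ξ * mN m₁ N ξ : ℝ) : ℂ) *
        ((starRingEnd ℂ) (v t ξ) * commTerm m₁ N (v t) ξ)).im +
      (∫ ξ, (mN m₁ N ξ : ℂ) *
        (commTerm m₁ N (v t) ξ * (starRingEnd ℂ) (cubic (v t) ξ))).im) := by
    refine Eq.trans ?_ (integral_add (h_int hQ1).im (h_int hQ2).im).symm
    rw [Complex.add_im]
    exact congrArg₂ _ (integral_im (h_int hQ1)).symm (integral_im (h_int hQ2)).symm
  rw [hQ]
  simp only [← hrate]
  simp only [RCLike.re_eq_complex_re] at hE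
  rw [hE]
  linarith

end

section

variable {s N T : ℝ} {m₁ : Rn 2 → ℝ} {ψ : ℝ → Rn 2 → ℂ}

/-- A jointly continuous family of functions that is bounded in the Schwartz space. -/
structure SchwartzFamily (ψ : ℝ → Rn 2 → ℂ) : Prop where
  smooth : ∀ t, ContDiff ℝ (⊤ : ℕ∞) (ψ t)
  cont : Continuous fun p : ℝ × Rn 2 => ψ p.1 p.2
  decay : ∀ k l : ℕ, ∃ C : ℝ, ∀ t x, ‖x‖ ^ k * ‖iteratedFDeriv ℝ l (ψ t) x‖ ≤ C

lemma jap_pow_le (ξ : Rn 2) (k : ℕ) : jap ξ ^ k ≤ 2 ^ (k - 1) * (1 + ‖ξ‖ ^ k) := by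
  refine (pow_le_pow_left₀ (jap_pos ξ).le (jap_le ξ) k).trans ?_
  simpa using add_pow_le zero_le_one (norm_nonneg ξ) k

lemma SchwartzFamily.exists_norm_le (h : SchwartzFamily ψ) (k l : ℕ) :
    ∃ C : ℝ, 0 ≤ C ∧ ∀ t x, ‖iteratedFDeriv ℝ l (ψ t) x‖ ≤ C * (jap x ^ k)⁻¹ := by
  obtain ⟨A, hA⟩ := h.decay 0 l
  obtain ⟨B, hB⟩ := h.decay k l
  have hA0 : 0 ≤ A := le_trans (by positivity) (hA 0 0)
  have hB0 : 0 ≤ B := le_trans (by positivity) (hB 0 0)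
  refine ⟨2 ^ (k - 1) * (A + B), by positivity, fun t x => ?_⟩
  rw [← div_eq_mul_inv, le_div_iff₀ (pow_pos (jap_pos x) k)]
  have h1 := mul_le_mul_of_nonneg_left (jap_pow_le x k)
    (norm_nonneg (iteratedFDeriv ℝ l (ψ t) x))
  have h2 := hA t x
  have h3 := hB t x
  rw [pow_zero, one_mul] at h2
  calc _ ≤ _ := h1
    _ = 2 ^ (k - 1) * (‖iteratedFDeriv ℝ l (ψ t) x‖ + ‖x‖ ^ k * ‖iteratedFDeriv ℝ l (ψ t) x‖) := by
      ring
    _ ≤ _ := mul_le_mul_of_nonneg_left (add_le_add h2 h3) (by positivity)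

lemma SchwartzFamily.integrable_pow_mul (h : SchwartzFamily ψ) (k l : ℕ) (t : ℝ) :
    Integrable fun x => ‖x‖ ^ k * ‖iteratedFDeriv ℝ l (ψ t) x‖ := by
  obtain ⟨C, hC0, hC⟩ := h.exists_norm_le (k + 3) l
  have hc : Continuous (iteratedFDeriv ℝ l (ψ t)) :=
    (h.smooth t).continuous_iteratedFDeriv (by exact_mod_cast le_top)
  refine Integrable.mono' ((integrable_jap_inv_pow le_rfl).const_mul C)
    ((continuous_norm.pow k).mul hc.norm).aestronglyMeasurable
    (Filter.Eventually.of_forall fun x => ?_)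
  have hj := jap_pos x
  rw [Real.norm_of_nonneg (by positivity)]
  calc _ ≤ jap x ^ k * (C * (jap x ^ (k + 3))⁻¹) :=
        mul_le_mul (pow_le_pow_left₀ (norm_nonneg _) (norm_le_jap x) k) (hC t x) (norm_nonneg _)
          (by positivity)
    _ = _ := by rw [pow_add]; field_simp

lemma SchwartzFamily.rapid (h : SchwartzFamily ψ) : RapidFamily ψ := by
  refine ⟨h.cont, fun k => ?_⟩
  obtain ⟨C, hC0, hC⟩ := h.exists_norm_le k 0
  refine ⟨C, fun t x => ?_⟩
  have h1 := hC t x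
  rw [← div_eq_mul_inv, le_div_iff₀ (pow_pos (jap_pos x) k), norm_iteratedFDeriv_zero] at h1
  linarith

lemma SchwartzFamily.exists_integral_le (h : SchwartzFamily ψ) (l : ℕ) :
    ∃ C : ℝ, ∀ t, ∫ x, ‖iteratedFDeriv ℝ l (ψ t) x‖ ≤ C := by
  obtain ⟨C, hC0, hC⟩ := h.exists_norm_le 3 l
  refine ⟨∫ x : Rn 2, C * (jap x ^ 3)⁻¹, fun t => integral_mono_of_nonneg
    (Filter.Eventually.of_forall fun x => norm_nonneg _)
    ((integrable_jap_inv_pow le_rfl).const_mul C) (Filter.Eventually.of_forall (hC t))⟩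

lemma SchwartzFamily.exists_pow_mul_fourier_le (h : SchwartzFamily ψ) (k : ℕ) :
    ∃ C : ℝ, ∀ t ξ, ‖ξ‖ ^ k * ‖𝓕 (ψ t) ξ‖ ≤ C := by
  choose C hC using fun l => h.exists_integral_le l
  refine ⟨2 ^ k * ∑ p ∈ Finset.range (0 + 1) ×ˢ Finset.range (k + 1), C p.2, fun t ξ => ?_⟩
  have h1 := Real.pow_mul_norm_iteratedFDeriv_fourier_le (K := 0) (N := ⊤) (k := 0) (n := k)
    (h.smooth t) (fun a b _ _ => h.integrable_pow_mul a b t) le_rfl le_top ξ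
  rw [norm_iteratedFDeriv_zero] at h1
  refine h1.trans ?_
  simp only [Nat.cast_zero, mul_zero, zero_add, pow_zero, one_mul]
  refine mul_le_mul_of_nonneg_left (Finset.sum_le_sum fun p hp => ?_) (by positivity)
  have hp0 : p.1 = 0 := by simpa using (Finset.mem_product.1 hp).1
  rw [hp0]
  simpa using hC p.2 t

/-- The Fourier transform with the plane wave made explicit. -/
lemma fourier_eq_integral_cexp (f : Rn 2 → ℂ) (ξ : Rn 2) :
    𝓕 f ξ = ∫ x, cexp ((2 * Real.pi * ⟪-ξ, x⟫ : ℝ) * I) * f x := by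
  rw [Real.fourier_eq']
  refine integral_congr_ae (Filter.Eventually.of_forall fun x => ?_)
  simp [real_inner_comm]

lemma SchwartzFamily.fourierFamily (h : SchwartzFamily ψ) : RapidFamily fun t => 𝓕 (ψ t) := by
  constructor
  · obtain ⟨C, hC0, hC⟩ := h.rapid.exists_norm_le 3
    simp only [fourier_eq_integral_cexp]
    refine continuous_of_dominated (bound := fun x => C * (jap x ^ 3)⁻¹)
      (fun p => ?_) (fun p => Filter.Eventually.of_forall fun x => ?_)
      ((integrable_jap_inv_pow le_rfl).const_mul C) (Filter.Eventually.of_forall fun x => ?_)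
    · exact (Continuous.mul (by fun_prop) (h.rapid.cont_space p.1)).aestronglyMeasurable
    · rw [norm_mul, norm_cexp_inner, one_mul]; exact hC _ _
    · exact Continuous.mul (by fun_prop) ((h.rapid.cont_time x).comp continuous_fst)
  · intro k
    obtain ⟨A, hA⟩ := h.exists_pow_mul_fourier_le 0
    obtain ⟨B, hB⟩ := h.exists_pow_mul_fourier_le k
    refine ⟨2 ^ (k - 1) * (A + B), fun t ξ => ?_⟩
    have h2 := hA t ξ
    have h3 := hB t ξ
    rw [pow_zero, one_mul] at h2
    calc _ ≤ _ := mul_le_mul_of_nonneg_right (jap_pow_le ξ k) (norm_nonneg _)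
      _ = 2 ^ (k - 1) * (‖𝓕 (ψ t) ξ‖ + ‖ξ‖ ^ k * ‖𝓕 (ψ t) ξ‖) := by ring
      _ ≤ _ := mul_le_mul_of_nonneg_left (add_le_add h2 h3) (by positivity)

lemma SchwartzFamily.fourierInv_fourier (h : SchwartzFamily ψ) (t : ℝ) : 𝓕⁻ (𝓕 (ψ t)) = ψ t :=
  (h.rapid.cont_space t).fourierInv_fourier_eq (h.rapid.integrable t)
    (h.fourierFamily.integrable t)

/-- The Fourier transform of the cubic nonlinearity. -/
lemma SchwartzFamily.fourier_cubic (h : SchwartzFamily ψ) (t : ℝ) (ξ : Rn 2) :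
    𝓕 (fun x => (‖ψ t x‖ : ℂ) ^ 2 * ψ t x) ξ = cubic (𝓕 (ψ t)) ξ := by
  have h1 : 𝓕⁻ (cubic (𝓕 (ψ t))) = fun x => (‖ψ t x‖ : ℂ) ^ 2 * ψ t x := by
    ext x
    have := h.fourierFamily.fourierInv_cubic t x
    rw [this, h.fourierInv_fourier]
  obtain ⟨M, hM0, hM⟩ := h.rapid.exists_norm_le 0
  simp only [pow_zero, inv_one, mul_one] at hM
  have h_int : Integrable fun x => (‖ψ t x‖ : ℂ) ^ 2 * ψ t x := by
    have hc := h.rapid.cont_space t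
    refine ((h.rapid.integrable t).norm.const_mul (M ^ 2)).mono'
      (((Complex.continuous_ofReal.comp hc.norm).pow 2).mul hc).aestronglyMeasurable
      (Filter.Eventually.of_forall fun x => ?_)
    rw [norm_mul, norm_pow, Complex.norm_real, norm_norm]
    exact mul_le_mul_of_nonneg_right (pow_le_pow_left₀ (norm_nonneg _) (hM t x) 2) (norm_nonneg _)
  have h2 : Integrable (𝓕 (cubic (𝓕 (ψ t)))) := by
    have h3 : 𝓕 (cubic (𝓕 (ψ t))) = fun x => 𝓕⁻ (cubic (𝓕 (ψ t))) (-x) := by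
      ext x
      rw [Real.fourierInv_eq_fourier_neg, neg_neg]
    rw [h3, h1]
    exact h_int.comp_neg
  rw [← h1]
  exact congrFun ((h.fourierFamily.cubicFamily.cont_space t).fourier_fourierInv_eq
    (h.fourierFamily.cubicFamily.integrable t) h2) ξ

end

section

variable {s N T : ℝ} {m₁ : Rn 2 → ℝ} {ψ : ℝ → Rn 2 → ℂ}

lemma fourier_fderiv_single {g : Rn 2 → ℂ} (hg : Integrable g) (hd : Differentiable ℝ g)
    (hg' : Integrable (fderiv ℝ g)) (i : Fin 2) (ξ : Rn 2) :
    𝓕 (fun x => fderiv ℝ g x (EuclideanSpace.single i 1)) ξ =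
      (2 * Real.pi * I * (ξ i : ℂ)) * 𝓕 g ξ := by
  have h1 := congrArg (fun L => L (EuclideanSpace.single i (1 : ℝ)))
    (congrFun (Real.fourier_fderiv hg hd hg') ξ)
  have h2 : innerSL ℝ ξ (EuclideanSpace.single i (1 : ℝ)) = ξ i := by
    rw [innerSL_apply_apply, EuclideanSpace.inner_single_right]; simp
  simp only [Real.fourier_continuousLinearMap_apply hg', VectorFourier.fourierSMulRight_apply,
    neg_apply, h2] at h1
  rw [h1]
  simp [mul_assoc]

lemma norm_single_one (i : Fin 2) : ‖(EuclideanSpace.single i (1 : ℝ) : Rn 2)‖ = 1 := by simp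

lemma norm_fderiv_fderiv_single_le {f : Rn 2 → ℂ} (hf : ContDiff ℝ (⊤ : ℕ∞) f) (i : Fin 2)
    (x : Rn 2) : ‖fderiv ℝ (fun y => fderiv ℝ f y (EuclideanSpace.single i 1)) x‖ ≤
      ‖iteratedFDeriv ℝ 2 f x‖ := by
  have h1 : ContDiff ℝ 1 (fderiv ℝ f) :=
    hf.fderiv_right (WithTop.coe_le_coe.2 (le_top : (1 + 1 : ℕ∞) ≤ ⊤))
  have h2 : HasFDerivAt (fderiv ℝ f) (fderiv ℝ (fderiv ℝ f) x) x :=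
    ((h1.differentiable one_ne_zero) x).hasFDerivAt
  have h3 := h2.clm_apply (hasFDerivAt_const (EuclideanSpace.single i (1 : ℝ) : Rn 2) x)
  rw [h3.fderiv]
  have h4 : ‖iteratedFDeriv ℝ 2 f x‖ = ‖fderiv ℝ (fderiv ℝ f) x‖ := by
    rw [← norm_iteratedFDeriv_one, norm_iteratedFDeriv_fderiv]
  rw [h4]
  simp only [ContinuousLinearMap.comp_zero, zero_add]
  refine ContinuousLinearMap.opNorm_le_bound _ (by positivity) fun y => ?_
  rw [ContinuousLinearMap.flip_apply]
  refine (ContinuousLinearMap.le_opNorm _ _).trans ?_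
  rw [norm_single_one, mul_one]
  exact ContinuousLinearMap.le_opNorm _ _

lemma SchwartzFamily.differentiable_fderiv_single (h : SchwartzFamily ψ) (t : ℝ) (i : Fin 2) :
    ContDiff ℝ 1 fun y => fderiv ℝ (ψ t) y (EuclideanSpace.single i 1) :=
  ((h.smooth t).fderiv_right (m := 1)
    (WithTop.coe_le_coe.2 (le_top : (1 + 1 : ℕ∞) ≤ ⊤))).clm_apply contDiff_const

lemma SchwartzFamily.integrable_fderiv (h : SchwartzFamily ψ) (t : ℝ) :
    Integrable (fderiv ℝ (ψ t)) := by
  refine (h.integrable_pow_mul 0 1 t).mono'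
    ((h.smooth t).continuous_fderiv (by simp)).aestronglyMeasurable
    (Filter.Eventually.of_forall fun x => ?_)
  rw [norm_iteratedFDeriv_one]; simp

lemma SchwartzFamily.integrable_fderiv_single (h : SchwartzFamily ψ) (t : ℝ) (i : Fin 2) :
    Integrable fun y => fderiv ℝ (ψ t) y (EuclideanSpace.single i 1) := by
  refine (h.integrable_fderiv t).norm.mono'
    (h.differentiable_fderiv_single t i).continuous.aestronglyMeasurable
    (Filter.Eventually.of_forall fun x => ?_)
  refine (ContinuousLinearMap.le_opNorm _ _).trans ?_
  rw [norm_single_one, mul_one]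

lemma SchwartzFamily.integrable_fderiv_fderiv_single (h : SchwartzFamily ψ) (t : ℝ) (i : Fin 2) :
    Integrable (fderiv ℝ fun y => fderiv ℝ (ψ t) y (EuclideanSpace.single i 1)) := by
  refine (h.integrable_pow_mul 0 2 t).mono'
    ((h.differentiable_fderiv_single t i).continuous_fderiv one_ne_zero).aestronglyMeasurable
    (Filter.Eventually.of_forall fun x => ?_)
  simpa using norm_fderiv_fderiv_single_le (h.smooth t) i x

lemma norm_laplacian_le {f : Rn 2 → ℂ} (hf : ContDiff ℝ (⊤ : ℕ∞) f) (x : Rn 2) :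
    ‖laplacian f x‖ ≤ 2 * ‖iteratedFDeriv ℝ 2 f x‖ := by
  unfold laplacian
  rw [Fin.sum_univ_two, two_mul]
  refine (norm_add_le _ _).trans (add_le_add ?_ ?_) <;>
  · refine (ContinuousLinearMap.le_opNorm _ _).trans ?_
    rw [norm_single_one, mul_one]
    exact norm_fderiv_fderiv_single_le hf _ x

lemma SchwartzFamily.continuous_laplacian (h : SchwartzFamily ψ) (t : ℝ) :
    Continuous (laplacian (ψ t)) := by
  unfold laplacian
  exact continuous_finsetSum _ fun i _ =>
    ((h.differentiable_fderiv_single t i).continuous_fderiv one_ne_zero).clm_apply continuous_const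

lemma SchwartzFamily.integrable_laplacian (h : SchwartzFamily ψ) (t : ℝ) :
    Integrable (laplacian (ψ t)) := by
  refine ((h.integrable_pow_mul 0 2 t).const_mul 2).mono'
    (h.continuous_laplacian t).aestronglyMeasurable (Filter.Eventually.of_forall fun x => ?_)
  simpa using norm_laplacian_le (h.smooth t) x

lemma SchwartzFamily.fourier_laplacian (h : SchwartzFamily ψ) (t : ℝ) (ξ : Rn 2) :
    𝓕 (laplacian (ψ t)) ξ = -(lam ξ * 𝓕 (ψ t) ξ) := by
  have h1 : ∀ i : Fin 2, 𝓕 (fun x => fderiv ℝ (fun y => fderiv ℝ (ψ t) y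
      (EuclideanSpace.single i 1)) x (EuclideanSpace.single i 1)) ξ =
      (2 * Real.pi * I * (ξ i : ℂ)) * ((2 * Real.pi * I * (ξ i : ℂ)) * 𝓕 (ψ t) ξ) := fun i => by
    rw [fourier_fderiv_single (h.integrable_fderiv_single t i)
      ((h.differentiable_fderiv_single t i).differentiable one_ne_zero)
      (h.integrable_fderiv_fderiv_single t i), fourier_fderiv_single (h.rapid.integrable t)
      ((h.smooth t).differentiable (by simp)) (h.integrable_fderiv t)]
  have h_int : ∀ i : Fin 2, Integrable fun x => fderiv ℝ (fun y => fderiv ℝ (ψ t) y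
      (EuclideanSpace.single i 1)) x (EuclideanSpace.single i 1) := fun i =>
    (h.integrable_fderiv_fderiv_single t i).apply_continuousLinearMap _
  have h2 : 𝓕 (laplacian (ψ t)) ξ = ∑ i : Fin 2, 𝓕 (fun x => fderiv ℝ (fun y => fderiv ℝ (ψ t) y
      (EuclideanSpace.single i 1)) x (EuclideanSpace.single i 1)) ξ := by
    simp only [fourier_eq_integral_cexp, laplacian, Finset.mul_sum]
    rw [integral_finsetSum]
    intro i _
    refine (h_int i).norm.mono' ((Continuous.aestronglyMeasurable (by fun_prop)).mul
      (h_int i).aestronglyMeasurable) (Filter.Eventually.of_forall fun x => ?_)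
    rw [norm_mul, norm_cexp_inner, one_mul]
  rw [h2, Fin.sum_univ_two, h1, h1, lam, EuclideanSpace.norm_sq_eq, Fin.sum_univ_two]
  simp only [Real.norm_eq_abs, sq_abs]
  push_cast
  ring_nf
  simp only [I_sq]
  ring

/-- Projection of time onto the interval `[0, T]`. -/
def clampTime (T t : ℝ) : ℝ := max 0 (min t T)

lemma continuous_clampTime (T : ℝ) : Continuous (clampTime T) := by
  unfold clampTime; fun_prop

lemma clampTime_mem (hT : 0 ≤ T) (t : ℝ) : clampTime T t ∈ Icc 0 T :=
  ⟨le_max_left _ _, max_le hT (min_le_right _ _)⟩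

lemma clampTime_of_mem {t : ℝ} (ht : t ∈ Icc 0 T) : clampTime T t = t := by
  rw [clampTime, min_eq_left ht.2, max_eq_right ht.1]

lemma schwartzFamily_of_isNLSSolution {φ : Rn 2 → ℝ → ℂ} {φ₀ : Rn 2 → ℂ} (hT : 0 ≤ T)
    (h : IsNLSSolution 2 T φ φ₀) : SchwartzFamily fun t x => φ x (clampTime T t) := by
  obtain ⟨h1, h2, -, -⟩ := h
  refine ⟨fun t => h1.comp (contDiff_id.prodMk contDiff_const), ?_, fun k l => ?_⟩
  · exact h1.continuous.comp
      (continuous_snd.prodMk ((continuous_clampTime T).comp continuous_fst))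
  · obtain ⟨C, hC⟩ := h2 k l
    exact ⟨C, fun t x => hC _ (clampTime_mem hT t) x⟩

/-- A solution of the cubic equation solves the equation on the Fourier side. -/
lemma fourierSolution_of_isNLSSolution {φ : Rn 2 → ℝ → ℂ} {φ₀ : Rn 2 → ℂ} (hT : 0 ≤ T)
    (h : IsNLSSolution 2 T φ φ₀) :
    FourierSolution T fun t => 𝓕 fun x => φ x (clampTime T t) := by
  set ψ : ℝ → Rn 2 → ℂ := fun t x => φ x (clampTime T t) with hψ
  have hS : SchwartzFamily ψ := schwartzFamily_of_isNLSSolution hT h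
  obtain ⟨h1, -, h3, -⟩ := h
  refine ⟨hS.fourierFamily, fun ξ t ht => ?_⟩
  set V : ℝ → Rn 2 → ℂ := fun t x =>
    I * laplacian (ψ t) x - I * ((‖ψ t x‖ : ℂ) ^ 2 * ψ t x) with hV
  have hdφ : ∀ x, ∀ τ ∈ Ioo 0 T, HasDerivAt (fun t => ψ t x) (V τ x) τ := by
    intro x τ hτ
    have hτ' : τ ∈ Icc 0 T := Ioo_subset_Icc_self hτ
    have hd : HasDerivAt (fun t => φ x t) (deriv (fun t => φ x t) τ) τ :=
      ((h1.comp (contDiff_const.prodMk contDiff_id)).differentiable (by simp) τ).hasDerivAt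
    have heq : V τ x = deriv (fun t => φ x t) τ := by
      have e := h3 x τ hτ'
      simp only [hV, hψ, clampTime_of_mem hτ', ← e]
      ring_nf
      simp
    rw [heq]
    refine hd.congr_of_eventuallyEq ?_
    filter_upwards [Ioo_mem_nhds hτ.1 hτ.2] with r hr
    simp only [hψ, clampTime_of_mem (Ioo_subset_Icc_self hr)]
  obtain ⟨A, hA0, hA⟩ := hS.exists_norm_le 3 2
  obtain ⟨B, hB0, hB⟩ := hS.rapid.exists_norm_le 3
  obtain ⟨M, hM0, hM⟩ := hS.rapid.exists_norm_le 0
  simp only [pow_zero, inv_one, mul_one] at hM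
  have hVle : ∀ τ x, ‖V τ x‖ ≤ (2 * A + M ^ 2 * B) * (jap x ^ 3)⁻¹ := by
    intro τ x
    have e1 := (norm_laplacian_le (hS.smooth τ) x).trans
      (mul_le_mul_of_nonneg_left (hA τ x) zero_le_two)
    have e2 := mul_le_mul (pow_le_pow_left₀ (norm_nonneg _) (hM τ x) 2) (hB τ x) (norm_nonneg _)
      (by positivity)
    refine (norm_sub_le _ _).trans ?_
    simp only [norm_mul, Complex.norm_I, one_mul, norm_pow, Complex.norm_real, norm_norm]
    linarith
  have hVc : ∀ τ, Continuous (V τ) := fun τ => by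
    have hc := hS.rapid.cont_space τ
    exact (continuous_const.mul (hS.continuous_laplacian τ)).sub (continuous_const.mul
      (((Complex.continuous_ofReal.comp hc.norm).pow 2).mul hc))
  have hmaj : Integrable fun x : Rn 2 => (2 * A + M ^ 2 * B) * (jap x ^ 3)⁻¹ :=
    (integrable_jap_inv_pow le_rfl).const_mul _
  have hVi : Integrable (V t) := hmaj.mono' (hVc t).aestronglyMeasurable
    (Filter.Eventually.of_forall (hVle t))
  have hexp : Continuous fun x : Rn 2 => cexp ((2 * Real.pi * ⟪-ξ, x⟫ : ℝ) * I) := by fun_prop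
  have hder : HasDerivAt (fun t => 𝓕 (ψ t) ξ) (𝓕 (V t) ξ) t := by
    simp only [fourier_eq_integral_cexp]
    refine (hasDerivAt_integral_of_dominated_loc_of_deriv_le (Ioo_mem_nhds ht.1 ht.2)
      (bound := fun x => (2 * A + M ^ 2 * B) * (jap x ^ 3)⁻¹)
      (F' := fun t x => cexp ((2 * Real.pi * ⟪-ξ, x⟫ : ℝ) * I) * V t x)
      (Filter.Eventually.of_forall fun τ =>
        (hexp.mul (hS.rapid.cont_space τ)).aestronglyMeasurable) ?_
      (hexp.mul (hVc t)).aestronglyMeasurable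
      (Filter.Eventually.of_forall fun x τ hτ => ?_) hmaj
      (Filter.Eventually.of_forall fun x τ hτ => ?_)).2
    · refine (hS.rapid.integrable t).norm.mono'
        (hexp.mul (hS.rapid.cont_space t)).aestronglyMeasurable
        (Filter.Eventually.of_forall fun x => ?_)
      rw [Pi.mul_apply, norm_mul, norm_cexp_inner, one_mul]
    · rw [norm_mul, norm_cexp_inner, one_mul]; exact hVle _ _
    · exact (hdφ x τ hτ).const_mul _
  refine hder.congr_deriv ?_
  have hci : Integrable fun x => (‖ψ t x‖ : ℂ) ^ 2 * ψ t x := by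
    have e : (fun x => (‖ψ t x‖ : ℂ) ^ 2 * ψ t x) = fun x => I * V t x + laplacian (ψ t) x := by
      ext x
      simp only [hV]
      ring_nf
      simp
    rw [e]
    exact (hVi.const_mul I).add (hS.integrable_laplacian t)
  have hFV : 𝓕 (V t) ξ = I * 𝓕 (laplacian (ψ t)) ξ -
      I * 𝓕 (fun x => (‖ψ t x‖ : ℂ) ^ 2 * ψ t x) ξ := by
    have hi : ∀ {g : Rn 2 → ℂ}, Integrable g →
        Integrable fun x => cexp ((2 * Real.pi * ⟪-ξ, x⟫ : ℝ) * I) * g x := fun {g} hg =>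
      hg.norm.mono' (hexp.aestronglyMeasurable.mul hg.aestronglyMeasurable)
        (Filter.Eventually.of_forall fun x => by rw [norm_mul, norm_cexp_inner, one_mul])
    simp only [fourier_eq_integral_cexp]
    rw [← integral_const_mul, ← integral_const_mul, ← integral_sub
      ((hi (hS.integrable_laplacian t)).const_mul I) ((hi hci).const_mul I)]
    refine integral_congr_ae (Filter.Eventually.of_forall fun x => ?_)
    simp only [hV]
    ring
  rw [hFV, hS.fourier_laplacian, hS.fourier_cubic]
  ring

end

section

variable {s N T : ℝ} {m₁ : Rn 2 → ℝ} {v : ℝ → Rn 2 → ℂ}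

lemma lpNorm_two_sq (f : Rn 2 → ℂ) : lpNorm 2 2 f ^ 2 = ∫ x, ‖f x‖ ^ 2 := by
  have h : 0 ≤ ∫ x, ‖f x‖ ^ (2 : ℝ) := integral_nonneg fun x => by positivity
  rw [_root_.lpNorm, ← Real.rpow_natCast, ← Real.rpow_mul h]
  norm_num

lemma norm_sq_le_lam (ξ : Rn 2) : ‖ξ‖ ^ 2 ≤ lam ξ := by
  have h : (1 : ℝ) ≤ 4 * Real.pi ^ 2 := by nlinarith [Real.pi_gt_three]
  exact le_mul_of_one_le_left (sq_nonneg _) h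

/-- The modified energy controls the weighted norm of the data. -/
lemma RapidFamily.envSq_zero_le (hv : RapidFamily v) (hm : IsAdmissibleMultiplier 2 s m₁)
    (N : ℝ) :
    envSq m₁ N v 0 ≤ ENNReal.ofReal ((∫ x, ‖𝓕⁻ (v 0) x‖ ^ 2) +
      2 * energy (𝓕⁻ fun ξ => (mN m₁ N ξ : ℂ) * v 0 ξ)) := by
  have hw := hv.mul_mN hm N
  have hE := hw.energy_fourierInv 0
  have hpot : 0 ≤ ∫ x, ‖𝓕⁻ (fun ξ => (mN m₁ N ξ : ℂ) * v 0 ξ) x‖ ^ 4 :=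
    integral_nonneg fun x => by positivity
  have hi1 := hv.integrable_norm_sq 0
  have hi2 := hw.integrable_lam_mul_sq 0
  have hle : ∀ ξ, (gw m₁ N ξ * env v 0 ξ) ^ 2 ≤
      ‖v 0 ξ‖ ^ 2 + lam ξ * ‖(mN m₁ N ξ : ℂ) * v 0 ξ‖ ^ 2 := fun ξ => by
    have h0 := mN_pos (N := N) hm ξ
    have h1 : mN m₁ N ξ ≤ 1 := (hm.2.1 _).2
    have h2 : mN m₁ N ξ ^ 2 ≤ 1 := pow_le_one₀ h0.le h1
    rw [norm_mul, Complex.norm_real, Real.norm_of_nonneg h0.le, env,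
      intervalIntegral.integral_same, add_zero, gw, mul_pow, mul_pow, jap_sq, mul_pow]
    have h3 : mN m₁ N ξ ^ 2 * ‖v 0 ξ‖ ^ 2 ≤ ‖v 0 ξ‖ ^ 2 := mul_le_of_le_one_left (sq_nonneg _) h2
    have h4 := mul_le_mul_of_nonneg_right (norm_sq_le_lam ξ)
      (by positivity : 0 ≤ mN m₁ N ξ ^ 2 * ‖v 0 ξ‖ ^ 2)
    linarith
  calc envSq m₁ N v 0
      ≤ ∫⁻ ξ, ENNReal.ofReal (‖v 0 ξ‖ ^ 2 + lam ξ * ‖(mN m₁ N ξ : ℂ) * v 0 ξ‖ ^ 2) := by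
        refine lintegral_mono fun ξ => ?_
        have henv : 0 ≤ env v 0 ξ := by simp [env]
        rw [← ENNReal.ofReal_pow (mul_nonneg (gw_pos hm ξ).le henv)]
        exact ENNReal.ofReal_le_ofReal (hle ξ)
    _ = ENNReal.ofReal (∫ ξ, (‖v 0 ξ‖ ^ 2 + lam ξ * ‖(mN m₁ N ξ : ℂ) * v 0 ξ‖ ^ 2)) :=
        (ofReal_integral_eq_lintegral_ofReal (hi1.add hi2) (Filter.Eventually.of_forall fun ξ =>
          add_nonneg (sq_nonneg _) (mul_nonneg (lam_nonneg ξ) (sq_nonneg _)))).symm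
    _ ≤ _ := by
        refine ENNReal.ofReal_le_ofReal ?_
        rw [integral_add hi1 hi2, integral_norm_sq_fourierInv (hv.integrable 0) (hv.memLp 0)]
        linarith

lemma exists_time_small {a b : ℝ} (ha : 0 < a) (hb : 0 < b) (B D : ℝ) :
    ∃ δ : ℝ, 0 < δ ∧ B * δ ^ a < 1 ∧ D * δ ^ b ≤ 1 := by
  have h : ∀ {c : ℝ}, 0 < c → ∀ B : ℝ,
      Filter.Tendsto (fun δ : ℝ => B * δ ^ c) (nhdsWithin 0 (Ioi 0)) (nhds 0) := fun {c} hc B => by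
    have h1 := ((Real.continuousAt_rpow_const 0 c (Or.inr hc.le)).tendsto.const_mul B).mono_left
      (nhdsWithin_le_nhds (s := Ioi 0))
    simpa [Real.zero_rpow hc.ne'] using h1
  obtain ⟨δ, h1, h2, h3⟩ := (((h ha B).eventually_lt_const one_pos).and
    (((h hb D).eventually_lt_const one_pos).and self_mem_nhdsWithin)).exists
  exact ⟨δ, h3, h1, h2.le⟩

lemma almost_conservation (hs : 4 / 7 < s) (hs1 : s < 1) (hm : IsAdmissibleMultiplier 2 s m₁)
    {ε R : ℝ} (hε : 0 < ε) (hε' : ε < 1 / 14) (hR : 0 < R) :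
    ∃ δ > 0, ∀ N : ℝ, 1 ≤ N → ∀ (φ₀ : Rn 2 → ℂ), lpNorm 2 2 φ₀ ≤ R →
      energy (Iop m₁ N φ₀) ≤ 1 → ∀ φ : Rn 2 → ℝ → ℂ, IsNLSSolution 2 δ φ φ₀ →
      ∀ t ∈ Icc 0 δ, |energy (Iop m₁ N fun x => φ x t) - energy (Iop m₁ N φ₀)| ≤
        N ^ (-(3 / 2 : ℝ) + ε) := by
  obtain ⟨K, hK0, hK⟩ := exists_increment_le hs1 hm hε (by linarith) (by linarith)
  set A : ℝ := 2 * (R ^ 2 + 2) with hA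
  have hA0 : 0 < A := by positivity
  obtain ⟨δ, hδ, hδ1, hδ2⟩ := exists_time_small (a := 1 + ε / 3) (b := ε / 3) (by positivity)
    (by positivity) (K * A ^ 2) (K * (A ^ 2 + A ^ 3))
  refine ⟨δ, hδ, fun N hN φ₀ hL hE φ hφ t ht => ?_⟩
  have hN0 : 0 < N := one_pos.trans_le hN
  have hv := fourierSolution_of_isNLSSolution hδ.le hφ
  have hS := schwartzFamily_of_isNLSSolution hδ.le hφ
  have h0 : (fun x => φ x (clampTime δ 0)) = φ₀ := by
    ext x
    rw [clampTime_of_mem ⟨le_rfl, hδ.le⟩, hφ.2.2.2]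
  have hL0 : 0 ≤ lpNorm 2 2 φ₀ :=
    Real.rpow_nonneg (integral_nonneg fun x => Real.rpow_nonneg (norm_nonneg _) _) _
  have hsmall : 2 * envSq m₁ N (fun t => 𝓕 fun x => φ x (clampTime δ t)) 0 ≤
      ENNReal.ofReal A := by
    have h1 := hv.fam.envSq_zero_le hm N
    rw [hS.fourierInv_fourier 0, h0, ← lpNorm_two_sq] at h1
    rw [hA, ENNReal.ofReal_mul zero_le_two, ENNReal.ofReal_ofNat]
    refine mul_le_mul_right (h1.trans (ENNReal.ofReal_le_ofReal ?_)) 2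
    refine add_le_add (pow_le_pow_left₀ hL0 hL 2) ?_
    have : energy (𝓕⁻ fun ξ => (mN m₁ N ξ : ℂ) * 𝓕 φ₀ ξ) ≤ 1 := hE
    linarith
  have hr1 : t ^ (1 + ε / 3) ≤ δ ^ (1 + ε / 3) := Real.rpow_le_rpow ht.1 ht.2 (by positivity)
  have hr2 : t ^ (ε / 3) ≤ δ ^ (ε / 3) := Real.rpow_le_rpow ht.1 ht.2 (by positivity)
  have hinc := hK N hN (hv.restrict ht.2) ht.1 A hA0 hsmall (by
    refine lt_of_le_of_lt ?_ hδ1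
    have := mul_le_mul_of_nonneg_left hr1 (by positivity : 0 ≤ K * A ^ 2)
    linarith)
  have heq := (hv.restrict ht.2).energy_sub_eq (N := N) hm ht.1
  simp only [h0, clampTime_of_mem ht] at heq
  have hfin : K * t ^ (ε / 3) * (A ^ 2 + A ^ 3) ≤ 1 := by
    refine le_trans ?_ hδ2
    have := mul_le_mul_of_nonneg_left hr2 (by positivity : 0 ≤ K * (A ^ 2 + A ^ 3))
    linarith
  calc |energy (Iop m₁ N fun x => φ x t) - energy (Iop m₁ N φ₀)|
      = |(quarticIncr m₁ N (fun t => 𝓕 fun x => φ x (clampTime δ t)) t +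
          sexticIncr m₁ N (fun t => 𝓕 fun x => φ x (clampTime δ t)) t).im| :=
        congrArg abs heq
    _ ≤ _ := (Complex.abs_im_le_norm _).trans (norm_add_le _ _)
    _ ≤ 1 * N ^ (-(3 / 2 - ε)) := hinc.trans
        (mul_le_mul_of_nonneg_right hfin (Real.rpow_nonneg hN0.le _))
    _ = N ^ (-(3 / 2 : ℝ) + ε) := by rw [one_mul]; congr 1; ring

end

end AlmostConservation

/-- Almost conservation law in ℝ². -/
theorem statement_2 :
    ∀ s : ℝ, 4/7 < s → s < 1 →
    ∀ m₁ : Rn 2 → ℝ, IsAdmissibleMultiplier 2 s m₁ →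
    ∃ ε₀ > (0:ℝ), ∀ ε : ℝ, 0 < ε → ε < ε₀ →
    ∃ C > (0:ℝ), ∀ R : ℝ, 0 < R → ∃ δ > (0:ℝ),
    ∀ N : ℝ, 1 ≤ N →
    ∀ φ₀ : SchwartzMap (Rn 2) ℂ,
      lpNorm 2 2 ⇑φ₀ ≤ R → energy (Iop m₁ N ⇑φ₀) ≤ 1 →
    ∀ φ : Rn 2 → ℝ → ℂ, IsNLSSolution 2 δ φ ⇑φ₀ →
    ∀ t ∈ Icc (0:ℝ) δ,
      |energy (Iop m₁ N (fun x => φ x t)) - energy (Iop m₁ N ⇑φ₀)|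
        ≤ C * N ^ (-(3/2 : ℝ) + ε) := by
  intro s hs hs1 m₁ hm
  refine ⟨1 / 14, by norm_num, fun ε hε hε' => ⟨1, one_pos, fun R hR => ?_⟩⟩
  obtain ⟨δ, hδ, h⟩ := AlmostConservation.almost_conservation hs hs1 hm hε hε' hR
  refine ⟨δ, hδ, fun N hN φ₀ hL hE φ hφ t ht => ?_⟩
  rw [one_mul]
  exact h N hN φ₀ hL hE φ hφ t ht

end
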